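/- For all integers k ≥ 3 and 0 ≤ g ≤ k − 3 there exists a nonzero homogeneous polynomial P ∈ ℝ[x₀,x₁,x₂] of degree 2k, squarefree over ℂ, such that every singular point of the complex curve C = {P = 0} ⊂ ℙ²(ℂ) is a node, the total number of singular points of C in ℙ²(ℂ) equals (2k−1)(k−1) − g (i.e., C has geometric genus g), the set ℝZ(P) is finite, and |ℝZ(P)| = k² + g + 1. -/

import Mathlib

open MvPolynomial

/-- The real projective zero set of a homogeneous polynomial in three variables. -/
noncomputable def RZ (P : MvPolynomial (Fin 3) ℝ) : Set (Projectivization ℝ (Fin 3 → ℝ)) :=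
  {x | MvPolynomial.eval x.rep P = 0}

/-- The set of singular points of the plane curve `{Q = 0} ⊂ ℙ²(ℂ)`. -/
noncomputable def SingSet (Q : MvPolynomial (Fin 3) ℂ) :
    Set (Projectivization ℂ (Fin 3 → ℂ)) :=
  {x | ∀ i : Fin 3, MvPolynomial.eval x.rep (pderiv i Q) = 0}

/-- The point `x` is a node of the curve `{Q = 0}`. -/
noncomputable def IsNodeAt (Q : MvPolynomial (Fin 3) ℂ)
    (x : Projectivization ℂ (Fin 3 → ℂ)) : Prop :=
  (Matrix.of fun i j : Fin 3 =>
    MvPolynomial.eval x.rep (pderiv i (pderiv j Q))).rank = 2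

open MvPolynomial
namespace NC

/-- twisted shift matrix -/
noncomputable def W (k n : ℕ) : Matrix (Fin k) (Fin k) (MvPolynomial (Fin 3) ℝ) :=
  fun i j => if (i : ℕ) = j + n then X 2 else if (i : ℕ) + k = j + n then X 0 else 0

noncomputable def Mb (k : ℕ) (b : Polynomial ℝ) :
    Matrix (Fin k) (Fin k) (MvPolynomial (Fin 3) ℝ) :=
  ∑ n ∈ Finset.range (k + 1), (C (b.coeff n) : MvPolynomial (Fin 3) ℝ) • W k n

noncomputable def Me (k : ℕ) (e : Polynomial ℝ) :
    Matrix (Fin k) (Fin k) (MvPolynomial (Fin 3) ℝ) :=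
  ∑ n ∈ Finset.range k, (C (e.coeff n) * X 2 : MvPolynomial (Fin 3) ℝ) • W k n +
  ∑ n ∈ Finset.range (k + 1), (C (e.coeff (k + n)) * X 0 : MvPolynomial (Fin 3) ℝ) • W k n

noncomputable def PM (k : ℕ) (b e : Polynomial ℝ) :
    Matrix (Fin k) (Fin k) (MvPolynomial (Fin 3) ℝ) :=
  ((X 1 : MvPolynomial (Fin 3) ℝ) • 1 - Mb k b) * ((X 1 : MvPolynomial (Fin 3) ℝ) • 1 - Mb k b)
    - Me k e

noncomputable def PP (k : ℕ) (b e : Polynomial ℝ) : MvPolynomial (Fin 3) ℝ := (PM k b e).det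

lemma W_hom (k n : ℕ) (i j : Fin k) : (W k n i j).IsHomogeneous 1 := by
  unfold W
  split_ifs
  · exact isHomogeneous_X _ _
  · exact isHomogeneous_X _ _
  · exact isHomogeneous_zero _ _ _

lemma PM_hom (k : ℕ) (b e : Polynomial ℝ) (i j : Fin k) : (PM k b e i j).IsHomogeneous 2 := by
  have h1 : ∀ i j, (((X 1 : MvPolynomial (Fin 3) ℝ) • 1 - Mb k b) i j).IsHomogeneous 1 := by
    intro i j
    rw [Matrix.sub_apply]
    apply IsHomogeneous.sub
    · rw [Matrix.smul_apply, Matrix.one_apply]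
      split_ifs
      · simpa using isHomogeneous_X ℝ (1 : Fin 3)
      · simpa using isHomogeneous_zero (Fin 3) ℝ 1
    · rw [Mb, Matrix.sum_apply]
      apply IsHomogeneous.sum
      intro n _
      rw [Matrix.smul_apply, smul_eq_mul]
      simpa using (isHomogeneous_C (Fin 3) (b.coeff n)).mul (W_hom k n i j)
  unfold PM
  rw [Matrix.sub_apply]
  apply IsHomogeneous.sub
  · rw [Matrix.mul_apply]
    apply IsHomogeneous.sum
    intro n _
    exact (h1 i n).mul (h1 n j)
  · rw [Me, Matrix.add_apply]
    apply IsHomogeneous.add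
    · rw [Matrix.sum_apply]
      apply IsHomogeneous.sum
      intro n _
      rw [Matrix.smul_apply, smul_eq_mul]
      simpa using ((isHomogeneous_C (Fin 3) (e.coeff n)).mul (isHomogeneous_X ℝ 2)).mul (W_hom k n i j)
    · rw [Matrix.sum_apply]
      apply IsHomogeneous.sum
      intro n _
      rw [Matrix.smul_apply, smul_eq_mul]
      simpa using ((isHomogeneous_C (Fin 3) (e.coeff (k+n))).mul (isHomogeneous_X ℝ 0)).mul
        (W_hom k n i j)

lemma PP_hom (k : ℕ) (b e : Polynomial ℝ) : (PP k b e).IsHomogeneous (2 * k) := by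
  unfold PP
  rw [Matrix.det_apply']
  apply IsHomogeneous.sum
  intro σ _
  have := (IsHomogeneous.prod (Finset.univ) (fun i => PM k b e (σ i) i) (fun _ => 2)
    (fun i _ => PM_hom k b e _ _))
  have h2 : (C ((Equiv.Perm.sign σ : ℤ) : ℝ) : MvPolynomial (Fin 3) ℝ) = ((Equiv.Perm.sign σ : ℤ) : MvPolynomial (Fin 3) ℝ) := by
    simp
  rw [← h2]
  have := (isHomogeneous_C (Fin 3) ((Equiv.Perm.sign σ : ℤ) : ℝ)).mul this
  convert this using 1
  simp [mul_comm]

/-- the factor `G` in homogeneous form -/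
noncomputable def Gh (k : ℕ) (b e : Polynomial ℝ) (u v Y : ℂ) : ℂ :=
  (Y - ∑ n ∈ Finset.range (k + 1), (b.coeff n : ℂ) * (u ^ n * v ^ (k - n))) ^ 2
    - ∑ n ∈ Finset.range (2 * k + 1), (e.coeff n : ℂ) * (u ^ n * v ^ (2 * k - n))

/-- evaluation homomorphism at a complex point -/
noncomputable def evC (z : Fin 3 → ℂ) : MvPolynomial (Fin 3) ℝ →+* ℂ :=
  (eval z).comp (map (algebraMap ℝ ℂ))

lemma evC_X (z : Fin 3 → ℂ) (i) : evC z (X i) = z i := by simp [evC]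
lemma evC_C (z : Fin 3 → ℂ) (r : ℝ) : evC z (C r) = r := by simp [evC]

lemma row_W (k n : ℕ) (hn : n ≤ k) (u v Y : ℂ) :
    Matrix.vecMul (fun i : Fin k => u ^ (i : ℕ) * v ^ (k - 1 - i))
      ((W k n).map (evC ![u ^ k, Y, v ^ k])) =
    (u ^ n * v ^ (k - n)) • (fun i : Fin k => u ^ (i : ℕ) * v ^ (k - 1 - i)) := by
  ext j
  rw [Matrix.vecMul, dotProduct]
  have hj := j.2
  by_cases h : (j : ℕ) + n < k
  · rw [Finset.sum_eq_single (⟨j + n, h⟩ : Fin k)]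
    · simp [W, evC_X, pow_add]
      have : v ^ (k - 1 - (j + n)) * v ^ k = v ^ (k - n) * v ^ (k - 1 - j) := by
        rw [← pow_add, ← pow_add]
        congr 1
        omega
      linear_combination (u ^ (j : ℕ) * u ^ n) * this
    · intro i _ hi
      have h1 : (i : ℕ) ≠ j + n := fun h' => hi (Fin.ext h')
      have h2 : (i : ℕ) + k ≠ j + n := by omega
      simp [W, h1, h2]
    · simp
  · have hlt : (j : ℕ) + n - k < k := by omega
    rw [Finset.sum_eq_single (⟨j + n - k, hlt⟩ : Fin k)]
    · have h1 : ¬ ((j : ℕ) + n - k = j + n) := by omega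
      have h2 : ((j : ℕ) + n - k + k = j + n) := by omega
      simp only [W, Matrix.map_apply, h1, h2, if_true, if_false, evC_X]
      simp
      have : u ^ n * v ^ (k - n) * (u ^ (j : ℕ) * v ^ (k - 1 - j)) = u ^ n * u ^ (j : ℕ) * (v ^ (k - n) * v ^ (k - 1 - j)) := by ring
      rw [this, mul_right_comm, ← pow_add, ← pow_add, ← pow_add]
      congr 2
      · omega
      · omega
    · intro i _ hi
      have h1 : (i : ℕ) ≠ j + n := by omega
      have h2 : (i : ℕ) + k ≠ j + n := by
        intro h'; apply hi; apply Fin.ext; simp; omega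
      simp [W, h1, h2]
    · simp

lemma row_smulW (k n : ℕ) (hn : n ≤ k) (u v Y : ℂ) (c : MvPolynomial (Fin 3) ℝ) :
    Matrix.vecMul (fun i : Fin k => u ^ (i : ℕ) * v ^ (k - 1 - i))
      ((c • W k n).map (evC ![u ^ k, Y, v ^ k])) =
    (evC ![u ^ k, Y, v ^ k] c * (u ^ n * v ^ (k - n))) •
      (fun i : Fin k => u ^ (i : ℕ) * v ^ (k - 1 - i)) := by
  have : (c • W k n).map (evC ![u ^ k, Y, v ^ k]) =
      evC ![u ^ k, Y, v ^ k] c • (W k n).map (evC ![u ^ k, Y, v ^ k]) := by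
    ext i j; simp [Matrix.map_apply]
  rw [this, Matrix.vecMul_smul, row_W k n hn, smul_smul]

lemma map_sum' (k : ℕ) (f : MvPolynomial (Fin 3) ℝ →+* ℂ) {ι} (s : Finset ι)
    (M : ι → Matrix (Fin k) (Fin k) (MvPolynomial (Fin 3) ℝ)) :
    (∑ i ∈ s, M i).map f = ∑ i ∈ s, (M i).map f := by
  ext i j; simp [Matrix.sum_apply, map_sum]

lemma row_Mb (k : ℕ) (b : Polynomial ℝ) (u v Y : ℂ) :
    Matrix.vecMul (fun i : Fin k => u ^ (i : ℕ) * v ^ (k - 1 - i))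
      ((Mb k b).map (evC ![u ^ k, Y, v ^ k])) =
    (∑ n ∈ Finset.range (k + 1), (b.coeff n : ℂ) * (u ^ n * v ^ (k - n))) •
      (fun i : Fin k => u ^ (i : ℕ) * v ^ (k - 1 - i)) := by
  rw [Mb, map_sum', Matrix.vecMul_sum, Finset.sum_smul]
  apply Finset.sum_congr rfl
  intro n hn
  rw [row_smulW k n (by simpa [Nat.lt_succ_iff] using hn), evC_C]

lemma row_Me (k : ℕ) (e : Polynomial ℝ) (u v Y : ℂ) :
    Matrix.vecMul (fun i : Fin k => u ^ (i : ℕ) * v ^ (k - 1 - i))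
      ((Me k e).map (evC ![u ^ k, Y, v ^ k])) =
    (∑ n ∈ Finset.range (2 * k + 1), (e.coeff n : ℂ) * (u ^ n * v ^ (2 * k - n))) •
      (fun i : Fin k => u ^ (i : ℕ) * v ^ (k - 1 - i)) := by
  have h2 : 2 * k + 1 = k + (k + 1) := by ring
  rw [h2, Finset.sum_range_add _ k (k + 1), Me, Matrix.map_add _ (map_add _), map_sum', map_sum', Matrix.vecMul_add, Matrix.vecMul_sum,
    Matrix.vecMul_sum, add_smul, Finset.sum_smul, Finset.sum_smul]
  congr 1
  · apply Finset.sum_congr rfl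
    intro n hn
    have hn : n < k := by simpa using hn
    rw [row_smulW k n (by omega), map_mul, evC_C, evC_X]
    congr 1
    simp
    have : 2 * k - n = k + (k - n) := by omega
    rw [this, pow_add]; ring
  · apply Finset.sum_congr rfl
    intro n hn
    have hn : n < k + 1 := by simpa using hn
    rw [row_smulW k n (by omega), map_mul, evC_C, evC_X]
    congr 1
    simp
    have : 2 * k - (k + n) = (k - n) := by omega
    rw [this, pow_add]; ring

lemma row_PM (k : ℕ) (b e : Polynomial ℝ) (u v Y : ℂ) :
    Matrix.vecMul (fun i : Fin k => u ^ (i : ℕ) * v ^ (k - 1 - i))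
      ((PM k b e).map (evC ![u ^ k, Y, v ^ k])) =
    (Gh k b e u v Y) • (fun i : Fin k => u ^ (i : ℕ) * v ^ (k - 1 - i)) := by
  have hA : ((X 1 : MvPolynomial (Fin 3) ℝ) • (1 : Matrix (Fin k) (Fin k) _) - Mb k b).map
      (evC ![u ^ k, Y, v ^ k]) = Y • 1 - (Mb k b).map (evC ![u ^ k, Y, v ^ k]) := by
    ext i j
    simp only [Matrix.map_apply, Matrix.sub_apply, Matrix.smul_apply, map_sub, smul_eq_mul, map_mul, evC_X,
      Matrix.one_apply]
    split_ifs <;> simp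
  have hB : Matrix.vecMul (fun i : Fin k => u ^ (i : ℕ) * v ^ (k - 1 - i))
      (Y • 1 - (Mb k b).map (evC ![u ^ k, Y, v ^ k])) =
      (Y - ∑ n ∈ Finset.range (k + 1), (b.coeff n : ℂ) * (u ^ n * v ^ (k - n))) •
      (fun i : Fin k => u ^ (i : ℕ) * v ^ (k - 1 - i)) := by
    rw [Matrix.vecMul_sub, row_Mb, Matrix.vecMul_smul, Matrix.vecMul_one, ← sub_smul]
  rw [PM, Matrix.map_sub _ (map_sub _), Matrix.map_mul, hA, Matrix.vecMul_sub, ← Matrix.vecMul_vecMul,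
    row_Me, hB, Matrix.smul_vecMul, hB, smul_smul, ← sub_smul, Gh, sq]

lemma det_eq_aux (k : ℕ) (ζ : ℂ) (hζ : IsPrimitiveRoot ζ k) (b e : Polynomial ℝ) (u v Y : ℂ)
    (hu : u ≠ 0) (hv : v ≠ 0) :
    evC ![u ^ k, Y, v ^ k] (PP k b e) = ∏ j ∈ Finset.range k, Gh k b e (ζ ^ j * u) v Y := by
  set V : Matrix (Fin k) (Fin k) ℂ := Matrix.projVandermonde (fun i : Fin k => ζ ^ (i : ℕ) * u) (fun _ => v)
    with hV
  have hdet : V.det ≠ 0 := by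
    rw [hV, Matrix.det_projVandermonde]
    refine Finset.prod_ne_zero_iff.2 fun i _ => Finset.prod_ne_zero_iff.2 fun j hj => ?_
    have hij : i < j := by simpa using hj
    intro h
    have : ζ ^ (j : ℕ) = ζ ^ (i : ℕ) := by
      have h' : (ζ ^ (j : ℕ) - ζ ^ (i : ℕ)) * (u * v) = 0 := by linear_combination h
      rcases mul_eq_zero.1 h' with h' | h'
      · linear_combination h'
      · simp [hu, hv] at h'
    have := hζ.pow_inj j.2 i.2 this
    have : j = i := Fin.ext this
    exact absurd this (ne_of_gt hij)
  have hmul : V * (PM k b e).map (evC ![u ^ k, Y, v ^ k]) =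
      Matrix.diagonal (fun i : Fin k => Gh k b e (ζ ^ (i : ℕ) * u) v Y) * V := by
    ext i j
    have hrow := congrFun (row_PM k b e (ζ ^ (i : ℕ) * u) v Y) j
    have hp : (ζ ^ (i : ℕ) * u) ^ k = u ^ k := by
      rw [mul_pow, ← pow_mul, mul_comm (i : ℕ), pow_mul, hζ.pow_eq_one, one_pow, one_mul]
    rw [hp] at hrow
    have hVi : ∀ j, V i j = (ζ ^ (i : ℕ) * u) ^ (j : ℕ) * v ^ (k - 1 - j) := by
      intro j
      rw [hV, Matrix.projVandermonde_apply, Fin.val_rev]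
      congr 2
      omega
    rw [Matrix.diagonal_mul, hVi, Matrix.mul_apply]
    simp only [hVi]
    exact hrow
  have := congrArg Matrix.det hmul
  rw [Matrix.det_mul, Matrix.det_mul, Matrix.det_diagonal, mul_comm] at this
  have := mul_right_cancel₀ hdet this
  rw [PP, RingHom.map_det, ← Fin.prod_univ_eq_prod_range (fun j => Gh k b e (ζ ^ j * u) v Y), ← this]
  rfl

lemma cont_evC (p : MvPolynomial (Fin 3) ℝ) : Continuous (fun z => evC z p) := by
  unfold evC
  exact MvPolynomial.continuous_eval _

theorem det_eq (k : ℕ) (ζ : ℂ) (hζ : IsPrimitiveRoot ζ k) (b e : Polynomial ℝ) (u v Y : ℂ) :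
    evC ![u ^ k, Y, v ^ k] (PP k b e) = ∏ j ∈ Finset.range k, Gh k b e (ζ ^ j * u) v Y := by
  have hc : Continuous (fun p : ℂ × ℂ => evC ![p.1 ^ k, Y, p.2 ^ k] (PP k b e)) := by
    refine (cont_evC _).comp ?_
    refine continuous_pi fun i => ?_
    fin_cases i <;> simp <;> fun_prop
  have hc2 : Continuous (fun p : ℂ × ℂ => ∏ j ∈ Finset.range k, Gh k b e (ζ ^ j * p.1) p.2 Y) := by
    unfold Gh
    fun_prop
  have hd : Dense (({0}ᶜ : Set ℂ) ×ˢ ({0}ᶜ : Set ℂ)) :=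
    (dense_compl_singleton 0).prod (dense_compl_singleton 0)
  have := Continuous.ext_on hd hc hc2 (by
    rintro ⟨u, v⟩ ⟨h1, h2⟩
    exact det_eq_aux k ζ hζ b e u v Y h1 h2)
  exact congrFun this (u, v)

end NC

open MvPolynomial
namespace NC

/-! ### local analysis in the chart -/

noncomputable def emb (f : Polynomial ℂ) : MvPolynomial (Fin 2) ℂ :=
  Polynomial.aeval (X 0 : MvPolynomial (Fin 2) ℂ) f

lemma eval_emb (f : Polynomial ℂ) (x Y : ℂ) : eval ![x, Y] (emb f) = f.eval x := by
  unfold emb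
  rw [Polynomial.aeval_def, Polynomial.hom_eval₂]
  simp
  rw [Polynomial.eval₂_eq_eval_map]
  congr 1
  have : (eval ![x, Y]).comp C = RingHom.id ℂ := by ext; simp
  rw [this, Polynomial.map_id]

lemma pd0_emb (f : Polynomial ℂ) : pderiv 0 (emb f) = emb (Polynomial.derivative f) := by
  unfold emb
  rw [Derivation.map_aeval]
  simp

lemma pd1_emb (f : Polynomial ℂ) : pderiv 1 (emb f) = 0 := by
  unfold emb
  rw [Derivation.map_aeval]
  simp

lemma pd_two (i : Fin 2) : pderiv i (2 : MvPolynomial (Fin 2) ℂ) = 0 := by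
  simpa using (pderiv i).map_natCast (R := ℂ) (A := MvPolynomial (Fin 2) ℂ) 2

noncomputable def gp (b e : Polynomial ℂ) : MvPolynomial (Fin 2) ℂ := (X 1 - emb b) ^ 2 - emb e

lemma eval_gp (b e : Polynomial ℂ) (x Y : ℂ) :
    eval ![x, Y] (gp b e) = (Y - b.eval x) ^ 2 - e.eval x := by
  simp [gp, eval_emb]

lemma gp_x (b e : Polynomial ℂ) (x Y : ℂ) : eval ![x, Y] (pderiv 0 (gp b e)) =
    -2 * (Y - b.eval x) * (Polynomial.derivative b).eval x - (Polynomial.derivative e).eval x := by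
  simp [gp, Derivation.leibniz_pow, pd0_emb, eval_emb, pderiv_X]
  ring

lemma gp_y (b e : Polynomial ℂ) (x Y : ℂ) : eval ![x, Y] (pderiv 1 (gp b e)) =
    2 * (Y - b.eval x) := by
  simp [gp, Derivation.leibniz_pow, pd1_emb, eval_emb, pderiv_X]

lemma gp_yy (b e : Polynomial ℂ) (x Y : ℂ) : eval ![x, Y] (pderiv 1 (pderiv 1 (gp b e))) = 2 := by
  simp [gp, Derivation.leibniz_pow, pd1_emb, eval_emb, pderiv_X, Derivation.leibniz, pd_two]

lemma gp_xy (b e : Polynomial ℂ) (x Y : ℂ) : eval ![x, Y] (pderiv 0 (pderiv 1 (gp b e))) =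
    -2 * (Polynomial.derivative b).eval x := by
  simp [gp, Derivation.leibniz_pow, pd1_emb, pd0_emb, eval_emb, pderiv_X, Derivation.leibniz, pd_two]

lemma gp_xx (b e : Polynomial ℂ) (x Y : ℂ) : eval ![x, Y] (pderiv 0 (pderiv 0 (gp b e))) =
    2 * (Polynomial.derivative b).eval x ^ 2 -
    2 * (Y - b.eval x) * (Polynomial.derivative (Polynomial.derivative b)).eval x
      - (Polynomial.derivative (Polynomial.derivative e)).eval x := by
  simp [gp, Derivation.leibniz_pow, pd1_emb, pd0_emb, eval_emb, pderiv_X, Derivation.leibniz, pd_two]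
  ring

/-- evaluation of a Hessian determinant -/
noncomputable def hd (F : MvPolynomial (Fin 2) ℂ) (x Y : ℂ) : ℂ :=
  eval ![x, Y] (pderiv 0 (pderiv 0 F)) * eval ![x, Y] (pderiv 1 (pderiv 1 F))
    - eval ![x, Y] (pderiv 0 (pderiv 1 F)) ^ 2

lemma pd_mul (i : Fin 2) (F G : MvPolynomial (Fin 2) ℂ) :
    pderiv i (F * G) = pderiv i F * G + F * pderiv i G := by
  rw [Derivation.leibniz]; simp; ring

lemma hd_one (F H : MvPolynomial (Fin 2) ℂ) (x Y : ℂ) (h0 : eval ![x, Y] F = 0)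
    (hx : eval ![x, Y] (pderiv 0 F) = 0) (hy : eval ![x, Y] (pderiv 1 F) = 0) :
    hd (F * H) x Y = (eval ![x, Y] H) ^ 2 * hd F x Y := by
  simp only [hd, pd_mul, map_add, map_mul, h0, hx, hy]
  ring

lemma hd_two (F G H : MvPolynomial (Fin 2) ℂ) (x Y : ℂ) (h0 : eval ![x, Y] F = 0)
    (h1 : eval ![x, Y] G = 0) :
    hd (F * (G * H)) x Y = - (eval ![x, Y] H) ^ 2 *
      (eval ![x, Y] (pderiv 0 F) * eval ![x, Y] (pderiv 1 G)
      - eval ![x, Y] (pderiv 1 F) * eval ![x, Y] (pderiv 0 G)) ^ 2 := by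
  simp only [hd, pd_mul, map_add, map_mul, h0, h1]
  ring

/-! ### chain rule -/

noncomputable def psi (k : ℕ) : MvPolynomial (Fin 3) ℂ →ₐ[ℂ] MvPolynomial (Fin 2) ℂ :=
  aeval ![X 0 ^ k, X 1, 1]

lemma eval_psi (k : ℕ) (F : MvPolynomial (Fin 3) ℂ) (x Y : ℂ) :
    eval ![x, Y] (psi k F) = eval ![x ^ k, Y, 1] F := by
  induction F using MvPolynomial.induction_on with
  | C a => simp [psi]
  | add p q hp hq => simp [hp, hq]
  | mul_X p i hp =>
    rw [map_mul, map_mul, map_mul, hp]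
    congr 1
    fin_cases i <;> simp [psi]

lemma psi_0 (k : ℕ) (F : MvPolynomial (Fin 3) ℂ) :
    pderiv 0 (psi k F) = C (k : ℂ) * X 0 ^ (k - 1) * psi k (pderiv 0 F) := by
  induction F using MvPolynomial.induction_on with
  | C a => simp [psi]
  | add p q hp hq => simp [hp, hq]; ring
  | mul_X p i hp =>
    rw [map_mul, pd_mul, hp, Derivation.leibniz]
    fin_cases i <;> simp [psi, Derivation.leibniz_pow, pderiv_X] <;> ring

lemma psi_1 (k : ℕ) (F : MvPolynomial (Fin 3) ℂ) :
    pderiv 1 (psi k F) = psi k (pderiv 1 F) := by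
  induction F using MvPolynomial.induction_on with
  | C a => simp [psi]
  | add p q hp hq => simp [hp, hq]
  | mul_X p i hp =>
    rw [map_mul, pd_mul, hp, Derivation.leibniz]
    fin_cases i <;> simp [psi, Derivation.leibniz_pow, pderiv_X] <;> ring

/-- minor of Hessian -/
noncomputable def mnr (F : MvPolynomial (Fin 3) ℂ) (z : Fin 3 → ℂ) : ℂ :=
  eval z (pderiv 0 (pderiv 0 F)) * eval z (pderiv 1 (pderiv 1 F))
    - eval z (pderiv 0 (pderiv 1 F)) ^ 2

lemma hd_psi (k : ℕ) (F : MvPolynomial (Fin 3) ℂ) (x Y : ℂ)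
    (h0 : eval ![x ^ k, Y, 1] (pderiv 0 F) = 0) :
    hd (psi k F) x Y = (k * x ^ (k - 1)) ^ 2 * mnr F ![x ^ k, Y, 1] := by
  have e1 : eval ![x, Y] (pderiv 0 (pderiv 0 (psi k F))) =
      (k * x ^ (k - 1)) ^ 2 * eval ![x ^ k, Y, 1] (pderiv 0 (pderiv 0 F)) := by
    rw [psi_0, pd_mul, psi_0]
    simp only [map_add, map_mul, eval_psi, h0]
    simp
    ring
  have e2 : eval ![x, Y] (pderiv 0 (pderiv 1 (psi k F))) =
      (k * x ^ (k - 1)) * eval ![x ^ k, Y, 1] (pderiv 0 (pderiv 1 F)) := by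
    rw [psi_1, psi_0]
    simp only [map_mul, eval_psi]
    simp
  rw [hd, mnr, e1, e2, psi_1, psi_1, eval_psi]
  ring

end NC

open MvPolynomial
namespace NC

noncomputable def scl (c : ℂ) (f : Polynomial ℂ) : Polynomial ℂ :=
  f.comp (Polynomial.C c * Polynomial.X)

lemma eval_scl (c : ℂ) (f : Polynomial ℂ) (x : ℂ) : (scl c f).eval x = f.eval (c * x) := by
  simp [scl]

/-- eliminant of the two factors -/
noncomputable def Rp (b b' e e' : Polynomial ℂ) : Polynomial ℂ :=
  (b' - b) ^ 4 - 2 * (b' - b) ^ 2 * (e + e') + (e - e') ^ 2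

noncomputable def Rj (ζ : ℂ) (b e : Polynomial ℂ) (j : ℕ) : Polynomial ℂ :=
  Rp b (scl (ζ ^ j) b) e (scl (ζ ^ j) e)

noncomputable def GG (b e : Polynomial ℂ) (x Y : ℂ) : ℂ := (Y - b.eval x) ^ 2 - e.eval x

lemma GG_scl (c : ℂ) (b e : Polynomial ℂ) (x Y : ℂ) :
    GG (scl c b) (scl c e) x Y = GG b e (c * x) Y := by
  simp [GG, eval_scl]

lemma eval_Rp (b b' e e' : Polynomial ℂ) (x : ℂ) : (Rp b b' e e').eval x =
    (b'.eval x - b.eval x) ^ 4 - 2 * (b'.eval x - b.eval x) ^ 2 * (e.eval x + e'.eval x)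
     + (e.eval x - e'.eval x) ^ 2 := by
  simp [Rp]

open Polynomial in
lemma eval_dRp (b b' e e' : Polynomial ℂ) (x : ℂ) : (derivative (Rp b b' e e')).eval x =
    4 * (b'.eval x - b.eval x) ^ 3 * ((derivative b').eval x - (derivative b).eval x)
    - 4 * (b'.eval x - b.eval x) * ((derivative b').eval x - (derivative b).eval x) *
      (e.eval x + e'.eval x)
    - 2 * (b'.eval x - b.eval x) ^ 2 * ((derivative e).eval x + (derivative e').eval x)
    + 2 * (e.eval x - e'.eval x) * ((derivative e).eval x - (derivative e').eval x) := by
  simp [Rp, Polynomial.derivative_pow]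
  ring

lemma Rp_of_common (b b' e e' : Polynomial ℂ) (x Y : ℂ) (h : GG b e x Y = 0)
    (h' : GG b' e' x Y = 0) : (Rp b b' e e').eval x = 0 := by
  rw [eval_Rp]
  have h1 : e.eval x = (Y - b.eval x) ^ 2 := by unfold GG at h; linear_combination -h
  have h2 : e'.eval x = (Y - b'.eval x) ^ 2 := by unfold GG at h'; linear_combination -h'
  rw [h1, h2]; ring

lemma dRp_of_common (b b' e e' : Polynomial ℂ) (x Y : ℂ) (h : GG b e x Y = 0)
    (h' : GG b' e' x Y = 0) : (Polynomial.derivative (Rp b b' e e')).eval x =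
    -2 * (b'.eval x - b.eval x) *
    (eval ![x, Y] (pderiv 0 (gp b e)) * eval ![x, Y] (pderiv 1 (gp b' e'))
      - eval ![x, Y] (pderiv 1 (gp b e)) * eval ![x, Y] (pderiv 0 (gp b' e'))) := by
  rw [eval_dRp, gp_x, gp_x, gp_y, gp_y]
  have h1 : e.eval x = (Y - b.eval x) ^ 2 := by unfold GG at h; linear_combination -h
  have h2 : e'.eval x = (Y - b'.eval x) ^ 2 := by unfold GG at h'; linear_combination -h'
  rw [h1, h2]; ring

lemma d_ne_of (b b' e e' : Polynomial ℂ) (x : ℂ) (h : (Rp b b' e e').eval x = 0)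
    (h' : (Polynomial.derivative (Rp b b' e e')).eval x ≠ 0) : b'.eval x - b.eval x ≠ 0 := by
  intro h0
  apply h'
  rw [eval_Rp, h0] at h
  have : e.eval x - e'.eval x = 0 := by
    have : (e.eval x - e'.eval x) ^ 2 = 0 := by linear_combination h
    exact pow_eq_zero_iff (two_ne_zero) |>.1 this
  rw [eval_dRp, h0, this]; ring

lemma exists_common (b b' e e' : Polynomial ℂ) (x : ℂ) (h : (Rp b b' e e').eval x = 0)
    (h' : (Polynomial.derivative (Rp b b' e e')).eval x ≠ 0) :
    ∃ Y, GG b e x Y = 0 ∧ GG b' e' x Y = 0 := by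
  have hd := d_ne_of b b' e e' x h h'
  rw [eval_Rp] at h
  set d := b'.eval x - b.eval x with hdd
  have hb' : b'.eval x = b.eval x + d := by rw [hdd]; ring
  refine ⟨b.eval x + (e.eval x + d ^ 2 - e'.eval x) / (2 * d), ?_, ?_⟩
  · unfold GG
    field_simp
    linear_combination h
  · unfold GG
    rw [hb']
    field_simp
    linear_combination h

lemma unique_common (b b' e e' : Polynomial ℂ) (x Y Y' : ℂ) (hd : b'.eval x - b.eval x ≠ 0)
    (h1 : GG b e x Y = 0) (h2 : GG b' e' x Y = 0) (h3 : GG b e x Y' = 0) (h4 : GG b' e' x Y' = 0) :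
    Y = Y' := by
  unfold GG at *
  have : (b'.eval x - b.eval x) * (Y - Y') = 0 := by
    linear_combination (1/2) * (h1 - h2 - h3 + h4)
  rcases mul_eq_zero.1 this with h | h
  · exact absurd h hd
  · linear_combination h

/-- standing hypotheses on singularities -/
structure HypS (k : ℕ) (ζ : ℂ) (B E : Polynomial ℂ) : Prop where
  k0 : 0 < k
  prim : IsPrimitiveRoot ζ k
  h1 : ∀ x ≠ 0, ∀ i j, 0 < i → i < k → 0 < j → j < k → (Rj ζ B E i).eval x = 0 →
    (Rj ζ B E j).eval x = 0 → i = j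
  h2 : ∀ x ≠ 0, ∀ j, 0 < j → j < k → (Rj ζ B E j).eval x = 0 →
    (Polynomial.derivative (Rj ζ B E j)).eval x ≠ 0
  hE : ∀ x, E.eval x = 0 → (Polynomial.derivative E).eval x = 0 →
    (Polynomial.derivative (Polynomial.derivative E)).eval x ≠ 0

variable {k : ℕ} {ζ : ℂ} {B E : Polynomial ℂ}

lemma HypS.R0 {x Y : ℂ} {j : ℕ} (h0 : GG B E x Y = 0)
    (hj : GG B E (ζ ^ j * x) Y = 0) : (Rj ζ B E j).eval x = 0 := by
  rw [← GG_scl] at hj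
  exact Rp_of_common _ _ _ _ x Y h0 hj

lemma HypS.uniq (H : HypS k ζ B E) {x Y : ℂ} (hx : x ≠ 0) {i j : ℕ} (hi : 0 < i) (hi' : i < k)
    (hj : 0 < j) (hj' : j < k)
    (h0 : GG B E x Y = 0) (h1 : GG B E (ζ ^ i * x) Y = 0) (h2 : GG B E (ζ ^ j * x) Y = 0) : i = j :=
  H.h1 x hx i j hi hi' hj hj' (HypS.R0 h0 h1) (HypS.R0 h0 h2)

lemma HypS.uniqY (H : HypS k ζ B E) {x Y Y' : ℂ} (hx : x ≠ 0) {j : ℕ}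
    (hj : 0 < j) (hj' : j < k)
    (h0 : GG B E x Y = 0) (h1 : GG B E (ζ ^ j * x) Y = 0)
    (h2 : GG B E x Y' = 0) (h3 : GG B E (ζ ^ j * x) Y' = 0) : Y = Y' := by
  have h := HypS.R0 h0 h1
  have hd := d_ne_of _ _ _ _ x h (H.h2 x hx j hj hj' h)
  rw [← GG_scl] at h1 h3
  exact unique_common _ _ _ _ x Y Y' hd h0 h1 h2 h3

lemma HypS.existsY (H : HypS k ζ B E) {x : ℂ} (hx : x ≠ 0) {j : ℕ}
    (hj : 0 < j) (hj' : j < k) (h : (Rj ζ B E j).eval x = 0) :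
    ∃ Y, GG B E x Y = 0 ∧ GG B E (ζ ^ j * x) Y = 0 := by
  obtain ⟨Y, h1, h2⟩ := exists_common _ _ _ _ x h (H.h2 x hx j hj hj' h)
  exact ⟨Y, h1, by rwa [GG_scl] at h2⟩

/-- the jacobian is nonzero -/
lemma HypS.jac (H : HypS k ζ B E) {x Y : ℂ} (hx : x ≠ 0) {j : ℕ}
    (hj : 0 < j) (hj' : j < k)
    (h0 : GG B E x Y = 0) (h1 : GG B E (ζ ^ j * x) Y = 0) :
    (eval ![x, Y] (pderiv 0 (gp B E)) *
       eval ![x, Y] (pderiv 1 (gp (scl (ζ ^ j) B) (scl (ζ ^ j) E)))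
      - eval ![x, Y] (pderiv 1 (gp B E)) *
       eval ![x, Y] (pderiv 0 (gp (scl (ζ ^ j) B) (scl (ζ ^ j) E)))) ≠ 0 := by
  have h := HypS.R0 h0 h1
  have h2 := H.h2 x hx j hj hj' h
  rw [← GG_scl] at h1
  rw [Rj, dRp_of_common _ _ _ _ x Y h0 h1] at h2
  exact right_ne_zero_of_mul h2

/-- type i and type ii are disjoint -/
lemma HypS.disj (H : HypS k ζ B E) {x Y : ℂ} (hx : x ≠ 0) {j : ℕ}
    (hj : 0 < j) (hj' : j < k) (h1 : GG B E (ζ ^ j * x) Y = 0) (hY : Y = B.eval x)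
    (he : E.eval x = 0) (he' : (Polynomial.derivative E).eval x = 0) : False := by
  have h0 : GG B E x Y = 0 := by simp [GG, hY, he]
  apply H.jac hx hj hj' h0 h1
  rw [gp_x, gp_y, gp_x, gp_y, hY, he']; ring

/-- hypotheses on the plane curve -/
structure HypQ (k : ℕ) (ζ : ℂ) (B E : Polynomial ℂ) (Q : MvPolynomial (Fin 3) ℂ) : Prop
    extends HypS k ζ B E where
  ev : ∀ x Y, eval ![x ^ k, Y, 1] Q = ∏ j ∈ Finset.range k, GG B E (ζ ^ j * x) Y
  hom : Q.IsHomogeneous (2 * k)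

variable {Q : MvPolynomial (Fin 3) ℂ}

lemma HypQ.psi_eq (H : HypQ k ζ B E Q) :
    psi k Q = ∏ j ∈ Finset.range k, gp (scl (ζ ^ j) B) (scl (ζ ^ j) E) := by
  apply MvPolynomial.funext
  intro z
  have hz : z = ![z 0, z 1] := by ext i; fin_cases i <;> rfl
  rw [hz, eval_psi, H.ev, map_prod]
  refine Finset.prod_congr rfl fun j _ => ?_
  rw [eval_gp, ← GG_scl]; rfl

lemma scl_one (f : Polynomial ℂ) : scl 1 f = f := by simp [scl]

lemma HypQ.psi_split (H : HypQ k ζ B E Q) :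
    psi k Q = gp B E * ∏ j ∈ (Finset.range k).erase 0, gp (scl (ζ ^ j) B) (scl (ζ ^ j) E) := by
  rw [H.psi_eq, ← Finset.mul_prod_erase (Finset.range k) _ (Finset.mem_range.2 H.k0), pow_zero,
    scl_one, scl_one]

/-- singular in the affine chart -/
def Sg (Q : MvPolynomial (Fin 3) ℂ) (z : Fin 3 → ℂ) : Prop :=
  eval z (pderiv 0 Q) = 0 ∧ eval z (pderiv 1 Q) = 0

lemma HypQ.sg_iff (H : HypQ k ζ B E Q) {x Y : ℂ} (hx : x ≠ 0) :
    Sg Q ![x ^ k, Y, 1] ↔ eval ![x, Y] (pderiv 0 (psi k Q)) = 0 ∧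
      eval ![x, Y] (pderiv 1 (psi k Q)) = 0 := by
  rw [Sg, psi_0, psi_1, map_mul, eval_psi, eval_psi]
  have : eval ![x, Y] (C (k : ℂ) * X 0 ^ (k - 1)) ≠ 0 := by
    simp [hx, H.k0.ne']
  simp only [mul_eq_zero, this, false_or]

lemma HypQ.class_two (H : HypQ k ζ B E Q) {x Y : ℂ} (hx : x ≠ 0) (h0 : GG B E x Y = 0)
    {j : ℕ} (hj : 0 < j) (hj' : j < k) (h1 : GG B E (ζ ^ j * x) Y = 0) :
    Sg Q ![x ^ k, Y, 1] ∧ mnr Q ![x ^ k, Y, 1] ≠ 0 := by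
  have hmem : j ∈ (Finset.range k).erase 0 := by simp [hj', hj.ne']
  have hsp := H.psi_split
  rw [← Finset.mul_prod_erase _ _ hmem] at hsp
  set G1 := gp (scl (ζ ^ j) B) (scl (ζ ^ j) E)
  set H1 := ∏ j ∈ ((Finset.range k).erase 0).erase j, gp (scl (ζ ^ j) B) (scl (ζ ^ j) E) with hH1
  have e0 : eval ![x, Y] (gp B E) = 0 := by rw [eval_gp]; exact h0
  have e1 : eval ![x, Y] G1 = 0 := by rw [eval_gp]; rw [← GG_scl] at h1; exact h1
  have hH : eval ![x, Y] H1 ≠ 0 := by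
    rw [hH1, map_prod, Finset.prod_ne_zero_iff]
    intro i hi
    simp only [Finset.mem_erase, Finset.mem_range] at hi
    rw [eval_gp]
    intro hc
    have : GG B E (ζ ^ i * x) Y = 0 := by rw [← GG_scl]; exact hc
    exact hi.1 (H.uniq hx (Nat.pos_of_ne_zero hi.2.1) hi.2.2 hj hj' h0 this h1)
  have hs : Sg Q ![x ^ k, Y, 1] := by
    rw [H.sg_iff hx, hsp]
    simp only [pd_mul, map_add, map_mul, e0, e1]
    simp
  refine ⟨hs, ?_⟩
  have := hd_psi k Q x Y hs.1
  rw [hsp, hd_two _ _ _ _ _ e0 e1] at this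
  intro hc
  rw [hc, mul_zero] at this
  have hJ := H.jac hx hj hj' h0 h1
  simp only [mul_eq_zero, neg_eq_zero, pow_eq_zero_iff, ne_eq, two_ne_zero, not_false_eq_true, hH, false_or] at this
  exact hJ this

lemma HypQ.class_one (H : HypQ k ζ B E Q) {x Y : ℂ} (hx : x ≠ 0) (h0 : GG B E x Y = 0)
    (hn : ∀ j, 0 < j → j < k → GG B E (ζ ^ j * x) Y ≠ 0) :
    (Sg Q ![x ^ k, Y, 1] ↔ Y = B.eval x ∧ E.eval x = 0 ∧ (Polynomial.derivative E).eval x = 0) ∧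
     (Sg Q ![x ^ k, Y, 1] → mnr Q ![x ^ k, Y, 1] ≠ 0) := by
  have hsp := H.psi_split
  set H1 := ∏ j ∈ (Finset.range k).erase 0, gp (scl (ζ ^ j) B) (scl (ζ ^ j) E) with hH1
  have e0 : eval ![x, Y] (gp B E) = 0 := by rw [eval_gp]; exact h0
  have hH : eval ![x, Y] H1 ≠ 0 := by
    rw [hH1, map_prod, Finset.prod_ne_zero_iff]
    intro i hi
    simp only [Finset.mem_erase, Finset.mem_range] at hi
    rw [eval_gp]
    intro hc
    exact hn i (Nat.pos_of_ne_zero hi.1) hi.2 (by rw [← GG_scl]; exact hc)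
  have key : Sg Q ![x ^ k, Y, 1] ↔ eval ![x, Y] (pderiv 0 (gp B E)) = 0 ∧
      eval ![x, Y] (pderiv 1 (gp B E)) = 0 := by
    rw [H.sg_iff hx, hsp]
    simp only [pd_mul, map_add, map_mul, e0, zero_mul, add_zero, mul_eq_zero, hH, or_false]
  have key2 : Sg Q ![x ^ k, Y, 1] ↔ Y = B.eval x ∧ E.eval x = 0 ∧
      (Polynomial.derivative E).eval x = 0 := by
    rw [key, gp_x, gp_y]
    constructor
    · rintro ⟨ha, hb⟩
      have hY : Y - B.eval x = 0 := by simpa using hb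
      refine ⟨by linear_combination hY, ?_, ?_⟩
      · unfold GG at h0; rw [hY] at h0; linear_combination -h0
      · rw [hY] at ha; linear_combination -ha
    · rintro ⟨ha, hb, hc⟩
      rw [ha, hc]; simp
  refine ⟨key2, fun hs hc => ?_⟩
  have h3 := hd_psi k Q x Y hs.1
  obtain ⟨hY, he, he'⟩ := key2.1 hs
  obtain ⟨hx0, hy0⟩ := key.1 hs
  rw [hsp, hd_one _ _ _ _ e0 hx0 hy0, hc, mul_zero, hd, gp_xx, gp_yy, gp_xy, hY] at h3
  have := H.hE x he he'
  apply this
  have h4 : (eval ![x, B.eval x] H1) ^ 2 ≠ 0 := by rw [← hY]; exact pow_ne_zero _ hH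
  have h5 := (mul_eq_zero.1 h3).resolve_left h4
  linear_combination (-1/2) * h5

end NC

open MvPolynomial
namespace NC
variable {k : ℕ} {ζ : ℂ} {B E : Polynomial ℂ} {Q : MvPolynomial (Fin 3) ℂ}

def D1 (B E : Polynomial ℂ) : Set (ℂ × ℂ) :=
  {p | p.1 ≠ 0 ∧ p.2 = B.eval p.1 ∧ E.eval p.1 = 0 ∧ (Polynomial.derivative E).eval p.1 = 0}

def N2 (k : ℕ) (ζ : ℂ) (B E : Polynomial ℂ) : Set (ℂ × ℂ) :=
  {p | p.1 ≠ 0 ∧ GG B E p.1 p.2 = 0 ∧ ∃ j, 0 < j ∧ j < k ∧ GG B E (ζ ^ j * p.1) p.2 = 0}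

def TT (k : ℕ) (ζ : ℂ) (B E : Polynomial ℂ) : Set ℂ :=
  {x | x ≠ 0 ∧ ∃ j, 0 < j ∧ j < k ∧ (Rj ζ B E j).eval x = 0}

def Tr (k : ℕ) (ζ : ℂ) (B E : Polynomial ℂ) : Set ℂ :=
  {x | x ≠ 0 ∧ ∃ j, 0 < j ∧ j < k ∧ (Rj ζ B E j).eval x = 0 ∧ (starRingEnd ℂ) x = ζ ^ j * x}

def pj (k : ℕ) (p : ℂ × ℂ) : ℂ × ℂ := (p.1 ^ k, p.2)

def SingAff (Q : MvPolynomial (Fin 3) ℂ) : Set (ℂ × ℂ) :=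
  {p | p.1 ≠ 0 ∧ eval ![p.1, p.2, 1] Q = 0 ∧ Sg Q ![p.1, p.2, 1]}

lemma orb (H : HypS k ζ B E) {x x' : ℂ} (hx : x ≠ 0) (h : x' ^ k = x ^ k) :
    ∃ j, j < k ∧ x' = ζ ^ j * x := by
  have hq : (x' / x) ^ k = 1 := by
    rw [div_pow, h, div_self (pow_ne_zero _ hx)]
  have : NeZero k := ⟨H.k0.ne'⟩
  obtain ⟨j, hj, h⟩ := H.prim.eq_pow_of_pow_eq_one hq
  exact ⟨j, hj, by rw [h]; field_simp⟩

lemma orb_pow (H : HypS k ζ B E) (x : ℂ) (j : ℕ) : (ζ ^ j * x) ^ k = x ^ k := by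
  rw [mul_pow, ← pow_mul, mul_comm j, pow_mul, H.prim.pow_eq_one, one_pow, one_mul]

lemma zpow_ne (H : HypS k ζ B E) {x : ℂ} (hx : x ≠ 0) (j : ℕ) : ζ ^ j * x ≠ 0 :=
  mul_ne_zero (pow_ne_zero _ (H.prim.ne_zero H.k0.ne')) hx

lemma zpow_back (H : HypS k ζ B E) (x : ℂ) {j : ℕ} (hj : j < k) :
    ζ ^ (k - j) * (ζ ^ j * x) = x := by
  rw [← mul_assoc, ← pow_add, Nat.sub_add_cancel hj.le, H.prim.pow_eq_one, one_mul]

lemma zpow_moves (H : HypS k ζ B E) {x : ℂ} (hx : x ≠ 0) {j : ℕ} (h0 : 0 < j) (hj : j < k) :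
    ζ ^ j * x ≠ x := by
  intro h
  exact H.prim.pow_ne_one_of_pos_of_lt h0.ne' hj (mul_right_cancel₀ hx (by rw [h, one_mul]))

lemma SingAff_eq (H : HypQ k ζ B E Q) :
    SingAff Q = pj k '' D1 B E ∪ pj k '' N2 k ζ B E := by
  ext ⟨a, Y⟩
  constructor
  · rintro ⟨ha, h0, hs⟩
    simp only at ha h0 hs
    obtain ⟨x, hx⟩ := IsAlgClosed.exists_pow_nat_eq a H.k0
    subst hx
    have hx0 : x ≠ 0 := by rintro rfl; simp [H.k0.ne'] at ha
    rw [H.ev, Finset.prod_eq_zero_iff] at h0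
    obtain ⟨j, hj, h0⟩ := h0
    set x' := ζ ^ j * x with hx'
    have hx'0 : x' ≠ 0 := zpow_ne H.toHypS hx0 j
    have hk : x' ^ k = x ^ k := orb_pow H.toHypS x j
    rw [← hk] at hs
    by_cases hex : ∃ i, 0 < i ∧ i < k ∧ GG B E (ζ ^ i * x') Y = 0
    · right
      exact ⟨(x', Y), ⟨hx'0, h0, hex⟩, by simp [pj, hk]⟩
    · left
      push Not at hex
      exact ⟨(x', Y), ⟨hx'0, ((H.class_one hx'0 h0 hex).1.1 hs)⟩, by simp [pj, hk]⟩
  · rintro (⟨⟨x, Y'⟩, ⟨hx, hY, he, he'⟩, heq⟩ | ⟨⟨x, Y'⟩, ⟨hx, h0, j, hj, hj', h1⟩, heq⟩)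
    · simp only [pj, Prod.mk.injEq] at heq hx hY he he'
      obtain ⟨rfl, rfl⟩ := heq
      have h0 : GG B E x Y' = 0 := by simp [GG, hY, he]
      refine ⟨pow_ne_zero _ hx, ?_, ?_⟩
      · simp only; rw [H.ev]
        exact Finset.prod_eq_zero (Finset.mem_range.2 H.k0) (by simpa using h0)
      · refine (H.class_one hx h0 ?_).1.2 ⟨hY, he, he'⟩
        intro j hj hj' h
        exact H.disj hx hj hj' h hY he he'
    · simp only [pj, Prod.mk.injEq] at heq hx h0 h1
      obtain ⟨rfl, rfl⟩ := heq
      refine ⟨pow_ne_zero _ hx, ?_, (H.class_two hx h0 hj hj' h1).1⟩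
      simp only; rw [H.ev]
      exact Finset.prod_eq_zero (Finset.mem_range.2 H.k0) (by simpa using h0)

lemma SingAff_mnr (H : HypQ k ζ B E Q) {p : ℂ × ℂ} (hp : p ∈ SingAff Q) :
    mnr Q ![p.1, p.2, 1] ≠ 0 := by
  rw [SingAff_eq H] at hp
  rcases hp with (⟨⟨x, Y'⟩, ⟨hx, hY, he, he'⟩, rfl⟩ | ⟨⟨x, Y'⟩, ⟨hx, h0, j, hj, hj', h1⟩, rfl⟩)
  · simp only [pj] at *
    have h0 : GG B E x Y' = 0 := by simp [GG, hY, he]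
    have := (H.class_one hx h0 (fun j hj hj' h => H.disj hx hj hj' h hY he he'))
    exact this.2 (this.1.2 ⟨hY, he, he'⟩)
  · exact (H.class_two hx h0 hj hj' h1).2

lemma pj_injOn (H : HypS k ζ B E) : Set.InjOn (pj k) (D1 B E) := by
  rintro ⟨x, Y⟩ ⟨hx, hY, he, he'⟩ ⟨x', Y'⟩ ⟨hx', hY', he2, he2'⟩ heq
  simp only [pj, Prod.mk.injEq] at *
  obtain ⟨h1, rfl⟩ := heq
  obtain ⟨j, hj, hj2⟩ := orb H hx h1.symm
  refine ⟨?_, rfl⟩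
  rcases Nat.eq_zero_or_pos j with rfl | hj0
  · simp [hj2]
  · exfalso
    refine H.disj (j := j) (Y := Y) hx hj0 hj ?_ hY he he'
    rw [← hj2]; simp [GG, hY', he2]

lemma pj_disj (H : HypS k ζ B E) : Disjoint (pj k '' D1 B E) (pj k '' N2 k ζ B E) := by
  rw [Set.disjoint_left]
  rintro _ ⟨⟨x, Y⟩, ⟨hx, hY, he, he'⟩, rfl⟩ ⟨⟨x', Y'⟩, ⟨hx', h0, i, hi, hi', h1⟩, heq⟩
  simp only [pj, Prod.mk.injEq] at *
  obtain ⟨h2, rfl⟩ := heq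
  obtain ⟨j, hj, rfl⟩ := orb H hx h2
  rcases Nat.eq_zero_or_pos j with rfl | hj0
  · simp only [pow_zero, one_mul] at h1
    exact H.disj hx hi hi' h1 hY he he'
  · exact H.disj hx hj0 hj h0 hY he he'

lemma two_to_one (H : HypS k ζ B E) (S : Finset (ℂ × ℂ)) (hS : ∀ p ∈ S, p ∈ N2 k ζ B E)
    (hcl : ∀ p ∈ S, ∀ j, 0 < j → j < k → GG B E (ζ ^ j * p.1) p.2 = 0 → (ζ ^ j * p.1, p.2) ∈ S) :
    S.card = 2 * (S.image (pj k)).card := by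
  classical
  rw [Finset.card_eq_sum_card_image (pj k) S, mul_comm, ← smul_eq_mul, ← Finset.sum_const]
  refine Finset.sum_congr rfl fun q hq => ?_
  obtain ⟨⟨x, Y⟩, hp, rfl⟩ := Finset.mem_image.1 hq
  obtain ⟨hx, h0, j, hj, hj', h1⟩ := hS _ hp
  have : S.filter (fun a => pj k a = pj k (x, Y)) = {(x, Y), (ζ ^ j * x, Y)} := by
    ext ⟨x', Y'⟩
    simp only [Finset.mem_filter, Finset.mem_insert, Finset.mem_singleton, pj, Prod.mk.injEq] at *
    constructor
    · rintro ⟨hm, h2, rfl⟩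
      obtain ⟨i, hi, rfl⟩ := orb H hx h2
      rcases Nat.eq_zero_or_pos i with rfl | hi0
      · left; simp
      · right
        have := (hS _ hm).2.1
        have := H.uniq hx hi0 hi hj hj' h0 this h1
        rw [this]; simp
    · rintro (⟨rfl, rfl⟩ | ⟨rfl, rfl⟩)
      · exact ⟨hp, rfl, rfl⟩
      · exact ⟨hcl _ hp j hj hj' h1, orb_pow H x j, rfl⟩
  rw [this, Finset.card_pair]
  intro h
  exact zpow_moves H hx hj hj' (Prod.mk.inj h).1.symm

lemma two_to_one' (H : HypS k ζ B E) (S : Set (ℂ × ℂ)) (hf : S.Finite) (hS : S ⊆ N2 k ζ B E)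
    (hcl : ∀ p ∈ S, ∀ j, 0 < j → j < k → GG B E (ζ ^ j * p.1) p.2 = 0 → (ζ ^ j * p.1, p.2) ∈ S) :
    S.ncard = 2 * (pj k '' S).ncard := by
  classical
  have := two_to_one H hf.toFinset (by simpa using fun p q h => hS h) (by simpa using fun p q h => hcl _ h)
  rw [← Set.ncard_coe_finset, ← Set.ncard_coe_finset] at this
  simpa using this

lemma N2_fst (H : HypS k ζ B E) : Set.InjOn Prod.fst (N2 k ζ B E) := by
  rintro ⟨x, Y⟩ ⟨hx, h0, j, hj, hj', h1⟩ ⟨x', Y'⟩ ⟨hx', h0', i, hi, hi', h1'⟩ heq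
  simp only at *
  subst heq
  have := H.h1 x hx i j hi hi' hj hj' (HypS.R0 h0' h1') (HypS.R0 h0 h1)
  subst this
  rw [H.uniqY hx hj hj' h0 h1 h0' h1']

lemma N2_img (H : HypS k ζ B E) : Prod.fst '' (N2 k ζ B E) = TT k ζ B E := by
  ext x
  constructor
  · rintro ⟨⟨x, Y⟩, ⟨hx, h0, j, hj, hj', h1⟩, rfl⟩
    exact ⟨hx, j, hj, hj', HypS.R0 h0 h1⟩
  · rintro ⟨hx, j, hj, hj', h1⟩
    obtain ⟨Y, h2, h3⟩ := H.existsY hx hj hj' h1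
    exact ⟨(x, Y), ⟨hx, h2, j, hj, hj', h3⟩, rfl⟩

lemma N2_finite (H : HypS k ζ B E) (hT : (TT k ζ B E).Finite) : (N2 k ζ B E).Finite := by
  rw [← N2_img H] at hT
  exact Set.Finite.of_finite_image hT (N2_fst H)

lemma N2_count (H : HypS k ζ B E) (hT : (TT k ζ B E).Finite) :
    (TT k ζ B E).ncard = 2 * (pj k '' N2 k ζ B E).ncard := by
  rw [← two_to_one' H _ (N2_finite H hT) subset_rfl, ← N2_img H,
    Set.InjOn.ncard_image (N2_fst H)]
  rintro ⟨x, Y⟩ ⟨hx, h0, j, hj, hj', h1⟩ i hi hi' h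
  refine ⟨zpow_ne H hx i, h, k - i, by omega, by omega, ?_⟩
  simp only
  rw [zpow_back H x hi']
  exact h0

def N2r (k : ℕ) (ζ : ℂ) (B E : Polynomial ℂ) : Set (ℂ × ℂ) := {p ∈ N2 k ζ B E | p.1 ∈ Tr k ζ B E}

lemma N2r_img (H : HypS k ζ B E) : Prod.fst '' (N2r k ζ B E) = Tr k ζ B E := by
  ext x
  constructor
  · rintro ⟨⟨x, Y⟩, h, rfl⟩
    exact h.2
  · intro hx
    have : x ∈ TT k ζ B E := by
      obtain ⟨h1, j, h2, h3, h4, h5⟩ := hx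
      exact ⟨h1, j, h2, h3, h4⟩
    rw [← N2_img H] at this
    obtain ⟨p, hp, rfl⟩ := this
    exact ⟨p, ⟨hp, hx⟩, rfl⟩

lemma N2r_count (H : HypS k ζ B E) (hT : (TT k ζ B E).Finite) :
    (Tr k ζ B E).ncard = 2 * (pj k '' N2r k ζ B E).ncard := by
  have hsub : N2r k ζ B E ⊆ N2 k ζ B E := fun p hp => hp.1
  rw [← two_to_one' H _ ((N2_finite H hT).subset hsub) hsub, ← N2r_img H,
    Set.InjOn.ncard_image ((N2_fst H).mono hsub)]
  rintro ⟨x, Y⟩ ⟨⟨hx, h0, j, hj, hj', h1⟩, _, j2, hj2, hj2', hR, hc⟩ i hi hi' h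
  simp only at *
  have := H.h1 x hx i j2 hi hi' hj2 hj2' (HypS.R0 h0 h) hR
  subst this
  have hback : GG B E (ζ ^ (k - i) * (ζ ^ i * x)) Y = 0 := by
    rw [zpow_back H x hi']
    exact h0
  refine ⟨⟨zpow_ne H hx i, h, k - i, by omega, by omega, hback⟩,
    zpow_ne H hx i, k - i, by omega, by omega, HypS.R0 h hback, ?_⟩
  simp only
  rw [zpow_back H x hi', ← hc, Complex.conj_conj]

/-- number of singular points in the torus -/
lemma SingAff_count (H : HypQ k ζ B E Q) (hT : (TT k ζ B E).Finite)
    (hD : (D1 B E).Finite) : (SingAff Q).Finite ∧ 2 * (SingAff Q).ncard = 2 * (D1 B E).ncard + (TT k ζ B E).ncard := by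
  rw [SingAff_eq H]
  have f1 := hD.image (pj k)
  have f2 := (N2_finite H.toHypS hT).image (pj k)
  refine ⟨f1.union f2, ?_⟩
  rw [Set.ncard_union_eq (pj_disj H.toHypS) f1 f2, N2_count H.toHypS hT,
    Set.InjOn.ncard_image (pj_injOn H.toHypS)]
  ring

end NC

open MvPolynomial
namespace NC

lemma eval_smul_hom {R : Type*} [CommRing R] {n : ℕ} {F : MvPolynomial (Fin 3) R}
    (h : F.IsHomogeneous n) (c : R) (z : Fin 3 → R) : eval (c • z) F = c ^ n * eval z F := by
  rw [eval_eq', eval_eq', Finset.mul_sum]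
  apply Finset.sum_congr rfl
  intro d hd
  have h1 := h (mem_support_iff.1 hd)
  rw [Finsupp.weight_apply, Finsupp.sum_fintype _ _ (by simp)] at h1
  simp only [Pi.one_apply, smul_eq_mul, mul_one] at h1
  simp only [Pi.smul_apply, smul_eq_mul, mul_pow, Finset.prod_mul_distrib,
    Finset.prod_pow_eq_pow_sum, h1]
  ring

lemma pderiv_hom {R : Type*} [CommRing R] {n : ℕ} {F : MvPolynomial (Fin 3) R}
    (h : F.IsHomogeneous n) (i : Fin 3) : (pderiv i F).IsHomogeneous (n - 1) := h.pderiv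

/-- affine chart -/
def cht {K : Type*} [Field K] (q : K × K) : Projectivization K (Fin 3 → K) :=
  Projectivization.mk K ![q.1, q.2, 1] (by
    intro h
    have := congrFun h 2
    simp at this)

lemma cht_inj {K : Type*} [Field K] : Function.Injective (cht : K × K → _) := by
  intro p q h
  unfold cht at h
  rw [Projectivization.mk_eq_mk_iff'] at h
  obtain ⟨a, ha⟩ := h
  have h2 := congrFun ha 2
  have h0 := congrFun ha 0
  have h1 := congrFun ha 1
  simp at h0 h1 h2
  subst h2
  ext
  · simpa using h0.symm
  · simpa using h1.symm

lemma rep_cht {K : Type*} [Field K] (q : K × K) : ∃ c : K, c ≠ 0 ∧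
    (cht q).rep = c • ![q.1, q.2, 1] := by
  unfold cht
  obtain ⟨a, ha⟩ := Projectivization.exists_smul_eq_mk_rep K (![q.1, q.2, 1] : Fin 3 → K) (by
    intro h
    have := congrFun h 2
    simp at this)
  exact ⟨a, a.ne_zero, ha.symm⟩

lemma proj_image {K : Type*} [Field K] (p : (Fin 3 → K) → Prop)
    (hp : ∀ c : K, c ≠ 0 → ∀ z, p (c • z) ↔ p z)
    (h0 : ∀ Y, ¬ p ![0, Y, 1]) (h1 : ∀ Y, ¬ p ![1, Y, 0]) (h2 : ¬ p ![0, 1, 0]) :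
    {x : Projectivization K (Fin 3 → K) | p x.rep} =
      cht '' {q : K × K | q.1 ≠ 0 ∧ p ![q.1, q.2, 1]} := by
  ext x
  constructor
  · intro hx
    change p x.rep at hx
    have hne := x.rep_nonzero
    have hv : x.rep = ![x.rep 0, x.rep 1, x.rep 2] := by
      ext i; fin_cases i <;> rfl
    have h20 : x.rep 2 ≠ 0 := by
      intro h
      by_cases h00 : x.rep 0 = 0
      · have h10 : x.rep 1 ≠ 0 := by
          intro h10
          apply hne
          ext i; fin_cases i <;> simp [h, h00, h10]
        apply h2
        rw [← hp _ h10]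
        convert hx using 1
        ext i; fin_cases i <;> simp [h, h00]
      · apply h1 (x.rep 1 / x.rep 0)
        rw [← hp _ h00]
        convert hx using 1
        ext i; fin_cases i
        · simp
        · simp; field_simp
        · simp [h]
    have hsc : x.rep = (x.rep 2) • ![x.rep 0 / x.rep 2, x.rep 1 / x.rep 2, 1] := by
      ext i; fin_cases i
      · simp; field_simp
      · simp; field_simp
      · simp
    have hp' : p ![x.rep 0 / x.rep 2, x.rep 1 / x.rep 2, 1] := by
      rw [hsc, hp _ h20] at hx; exact hx
    refine ⟨(x.rep 0 / x.rep 2, x.rep 1 / x.rep 2), ⟨?_, hp'⟩, ?_⟩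
    · intro h
      apply h0 (x.rep 1 / x.rep 2)
      simp only at h
      rw [h] at hp'; exact hp'
    · conv_rhs => rw [← x.mk_rep]
      unfold cht
      rw [Projectivization.mk_eq_mk_iff']
      refine ⟨(x.rep 2)⁻¹, ?_⟩
      rw [hsc, smul_smul]
      simp [h20]
  · rintro ⟨q, ⟨hq, hq'⟩, rfl⟩
    obtain ⟨c, hc, h⟩ := rep_cht q
    change p _
    rw [h, hp c hc]
    exact hq'

lemma rank_two {M : Matrix (Fin 3) (Fin 3) ℂ} (hm : M 0 0 * M 1 1 - M 0 1 * M 1 0 ≠ 0)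
    (v : Fin 3 → ℂ) (hv : v ≠ 0) (h : Matrix.mulVec M v = 0) : M.rank = 2 := by
  apply le_antisymm
  · by_contra hc
    have h3 : M.rank = 3 := by
      have := M.rank_le_card_width
      simp at this
      omega
    have hdet : M.det = 0 := Matrix.exists_mulVec_eq_zero_iff.1 ⟨v, hv, h⟩
    have hli : LinearIndependent ℂ M.row := by
      rw [linearIndependent_iff_card_eq_finrank_span]
      rw [Set.finrank, ← Matrix.rank_eq_finrank_span_row, h3]; simp
    rw [Matrix.linearIndependent_rows_iff_isUnit, Matrix.isUnit_iff_isUnit_det, hdet] at hli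
    simp at hli
  · have hs : (M.submatrix ![0, 1] ![0, 1] : Matrix (Fin 2) (Fin 2) ℂ).rank = 2 := by
      have : IsUnit (M.submatrix ![0, 1] ![0, 1] : Matrix (Fin 2) (Fin 2) ℂ) := by
        rw [Matrix.isUnit_iff_isUnit_det, Matrix.det_fin_two]
        simpa [Matrix.submatrix] using hm
      rw [Matrix.rank_of_isUnit _ this]; simp
    rw [← hs]
    exact Matrix.rank_submatrix_le _ _ _

/-- all first derivatives vanish -/
def Sing3 (Q : MvPolynomial (Fin 3) ℂ) (z : Fin 3 → ℂ) : Prop := ∀ i : Fin 3, eval z (pderiv i Q) = 0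

noncomputable def Hes (Q : MvPolynomial (Fin 3) ℂ) (z : Fin 3 → ℂ) : Matrix (Fin 3) (Fin 3) ℂ :=
  Matrix.of fun i j : Fin 3 => eval z (pderiv i (pderiv j Q))

lemma pderiv_comm3 (i j : Fin 3) (F : MvPolynomial (Fin 3) ℂ) :
    pderiv i (pderiv j F) = pderiv j (pderiv i F) := by
  induction F using MvPolynomial.induction_on with
  | C a => simp
  | add p q hp hq => simp [hp, hq]
  | mul_X p n hp =>
    have hc : ∀ a b : Fin 3, pderiv a ((Pi.single b (1 : MvPolynomial (Fin 3) ℂ) : Fin 3 → MvPolynomial (Fin 3) ℂ) n) = 0 := by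
      intro a b
      by_cases h : b = n
      · subst h; simp
      · rw [Pi.single_eq_of_ne (Ne.symm h)]; simp
    simp [pderiv_mul, hp, pderiv_X, hc]
    ring

lemma euler_eval {n : ℕ} {F : MvPolynomial (Fin 3) ℂ} (h : F.IsHomogeneous n) (z : Fin 3 → ℂ) :
    z 0 * eval z (pderiv 0 F) + z 1 * eval z (pderiv 1 F) + z 2 * eval z (pderiv 2 F)
      = n * eval z F := by
  have := congrArg (eval z) h.sum_X_mul_pderiv
  simpa [Fin.sum_univ_three] using this

lemma node_rank {n : ℕ} {Q : MvPolynomial (Fin 3) ℂ} (h : Q.IsHomogeneous n)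
    {z : Fin 3 → ℂ} (hz : z ≠ 0) (hs : Sing3 Q z) (hm : mnr Q z ≠ 0) : (Hes Q z).rank = 2 := by
  refine rank_two (M := Hes Q z) ?_ z hz ?_
  · unfold mnr at hm
    simp only [Hes, Matrix.of_apply]
    rw [pderiv_comm3 1 0]
    convert hm using 1
    ring
  · ext i
    have h1 := euler_eval (h.pderiv (i := i)) z
    rw [hs i] at h1
    simp only [Matrix.mulVec, dotProduct, Fin.sum_univ_three, Hes, Matrix.of_apply, Pi.zero_apply]
    rw [pderiv_comm3 i 0, pderiv_comm3 i 1, pderiv_comm3 i 2]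
    linear_combination h1

lemma Hes_smul {n : ℕ} {Q : MvPolynomial (Fin 3) ℂ} (h : Q.IsHomogeneous n) (c : ℂ) (z) :
    Hes Q (c • z) = c ^ (n - 1 - 1) • Hes Q z := by
  ext i j
  simp [Hes, eval_smul_hom (h.pderiv (i := j)).pderiv]

lemma rank_smul_ne {M : Matrix (Fin 3) (Fin 3) ℂ} {c : ℂ} (hc : c ≠ 0) : (c • M).rank = M.rank := by
  have : c • M = M * (c • 1) := by simp
  rw [this, Matrix.rank_mul_eq_left_of_isUnit_det]
  simp [hc]

/-- a polynomial with no zeros off the origin is constant -/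
lemma const_of_nozero {A : MvPolynomial (Fin 3) ℂ} (h : ∀ z : Fin 3 → ℂ, z ≠ 0 → eval z A ≠ 0) :
    IsUnit A := by
  set p : Fin 3 → ℂ := ![1, 0, 0] with hp
  have key : ∀ z : Fin 3 → ℂ, z 1 ≠ 0 → eval z A = eval p A := by
    intro z hz
    set L : Polynomial ℂ := aeval (fun i => Polynomial.C (p i) + Polynomial.C (z i - p i) * Polynomial.X) A
      with hL
    have hev : ∀ t : ℂ, L.eval t = eval (fun i => p i + (z i - p i) * t) A := by
      intro t
      rw [hL, ← Polynomial.coe_aeval_eq_eval]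
      rw [← AlgHom.comp_apply, comp_aeval]
      simp
    have hdeg : L.degree = 0 := by
      by_contra hd
      obtain ⟨t, ht⟩ := Complex.exists_root (f := L) (by
        by_contra hlt
        have hle : L.degree ≤ 0 := not_lt.1 hlt
        have h0 : L ≠ 0 := by
          intro h0
          have := hev 0
          rw [h0] at this
          simp at this
          exact h p (by intro hh; have := congrFun hh 0; simp [hp] at this) this.symm
        exact hd (le_antisymm hle (Polynomial.zero_le_degree_iff.2 h0)))
      rw [Polynomial.IsRoot, hev] at ht
      refine h _ ?_ ht
      intro h0
      have e0 := congrFun h0 0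
      have e1 := congrFun h0 1
      simp [hp] at e0 e1
      rcases e1 with e1 | e1
      · exact hz e1
      · rw [e1] at e0; simp at e0
    rw [Polynomial.eq_C_of_degree_eq_zero hdeg] at hev
    have h0 := hev 0
    have h1 := hev 1
    simp at h0 h1
    rw [← h1, h0]
  have hA : (A - C (eval p A)) * X 1 = 0 := by
    apply MvPolynomial.funext
    intro z
    by_cases hz : z 1 = 0
    · simp [hz]
    · simp [key z hz]
  rcases mul_eq_zero.1 hA with h1 | h1
  · rw [sub_eq_zero.1 h1]
    refine IsUnit.map C ?_
    exact (h p (by intro hh; have := congrFun hh 0; simp [hp] at this)).isUnit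
  · exact absurd h1 (X_ne_zero 1)

lemma sqfree_of_nodes {Q : MvPolynomial (Fin 3) ℂ}
    (hn : ∀ z : Fin 3 → ℂ, z ≠ 0 → Sing3 Q z → (Hes Q z).rank = 2) : Squarefree Q := by
  intro A hA
  by_contra hu
  obtain ⟨B, hB⟩ := hA
  have : ∃ z : Fin 3 → ℂ, z ≠ 0 ∧ eval z A = 0 := by
    by_contra! hc
    exact hu (const_of_nozero hc)
  obtain ⟨z, hz, hA0⟩ := this
  have hs : Sing3 Q z := by
    intro i
    rw [hB]
    simp [hA0]
  have h2 := hn z hz hs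
  have hH : Hes Q z = Matrix.vecMulVec (fun i => 2 * eval z B * eval z (pderiv i A))
      (fun i => eval z (pderiv i A)) := by
    ext i j
    simp only [Hes, Matrix.of_apply, hB, Matrix.vecMulVec_apply]
    simp [hA0]
    ring
  have := Matrix.rank_vecMulVec_le (fun i => 2 * eval z B * eval z (pderiv i A))
      (fun i => eval z (pderiv i A))
  rw [← hH] at this
  omega

end NC

open MvPolynomial
namespace NC

noncomputable abbrev cx (b : Polynomial ℝ) : Polynomial ℂ := b.map (algebraMap ℝ ℂ)

lemma eval_cx_real (b : Polynomial ℝ) (x : ℝ) : (cx b).eval (x : ℂ) = ((b.eval x : ℝ) : ℂ) := by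
  have := Polynomial.eval_map_algebraMap (R := ℝ) (B := ℂ) b x
  rw [this]
  exact Polynomial.aeval_algebraMap_apply ℂ x b

lemma eval_cx_conj (b : Polynomial ℝ) (x : ℂ) :
    (cx b).eval (starRingEnd ℂ x) = starRingEnd ℂ ((cx b).eval x) := by
  rw [Polynomial.eval_map_algebraMap, Polynomial.eval_map_algebraMap, Polynomial.aeval_conj]

lemma eval_cx_zero (b : Polynomial ℝ) : (cx b).eval 0 = (b.coeff 0 : ℂ) := by
  rw [← Polynomial.coeff_zero_eq_eval_zero, cx, Polynomial.coeff_map]; rfl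

lemma Gh_one {k : ℕ} {b e : Polynomial ℝ} (hb : b.natDegree ≤ k) (he : e.natDegree ≤ 2 * k)
    (u Y : ℂ) : Gh k b e u 1 Y = GG (cx b) (cx e) u Y := by
  unfold Gh GG
  rw [Polynomial.eval_eq_sum_range' (p := cx b) (n := k + 1)
      (by rw [Polynomial.natDegree_map]; omega),
    Polynomial.eval_eq_sum_range' (p := cx e) (n := 2 * k + 1)
      (by rw [Polynomial.natDegree_map]; omega)]
  simp [Polynomial.coeff_map]

/-- reversed polynomials -/
noncomputable def rvs (n : ℕ) (b : Polynomial ℝ) : Polynomial ℝ :=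
  ∑ i ∈ Finset.range (n + 1), Polynomial.C (b.coeff i) * Polynomial.X ^ (n - i)

lemma rvs_coeff (n : ℕ) (b : Polynomial ℝ) (m : ℕ) (hm : m ≤ n) :
    (rvs n b).coeff m = b.coeff (n - m) := by
  unfold rvs
  simp only [Polynomial.finsetSum_coeff, Polynomial.coeff_C_mul, Polynomial.coeff_X_pow]
  rw [Finset.sum_eq_single (n - m)]
  · rw [if_pos (by omega)]; simp
  · intro i hi hne
    simp at hi
    rw [if_neg (by omega)]; simp
  · intro h; simp at h

lemma Gh_rev {k : ℕ} {b e : Polynomial ℝ} (c v Y : ℂ) (hc : c ^ k = 1) (hc0 : c ≠ 0) :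
    Gh k b e c v Y = GG (cx (rvs k b)) (cx (rvs (2 * k) e)) (c⁻¹ * v) Y := by
  have key : ∀ n i : ℕ, i ≤ n → c ^ n = 1 → c ^ i * v ^ (n - i) = (c⁻¹ * v) ^ (n - i) := by
    intro n i hi hn
    rw [mul_pow, inv_pow]
    congr 1
    refine eq_inv_of_mul_eq_one_left ?_
    rw [← pow_add, Nat.add_sub_cancel' hi, hn]
  unfold Gh GG
  congr 1
  · congr 2
    rw [cx, rvs, Polynomial.map_sum, Polynomial.eval_finsetSum]
    apply Finset.sum_congr rfl
    intro i hi
    rw [key k i (by simp at hi; omega) hc]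
    simp
  · rw [cx, rvs, Polynomial.map_sum, Polynomial.eval_finsetSum]
    apply Finset.sum_congr rfl
    intro i hi
    rw [key (2 * k) i (by simp at hi; omega) (by rw [mul_comm, pow_mul, hc, one_pow])]
    simp

open Polynomial in
/-- nonvanishing of the derivative at the ramification point -/
lemma ram {k : ℕ} (hk : 0 < k) {ζ : ℂ} (hζ : ζ ≠ 0) {p q : ℂ[X]}
    (h : ∀ u : ℂ, p.eval (u ^ k) = ∏ j ∈ Finset.range k, q.eval (ζ ^ j * u))
    (h0 : q.eval 0 = 0) (h1 : (derivative q).eval 0 ≠ 0) : (derivative p).eval 0 ≠ 0 := by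
  have hp0 : p.eval 0 = 0 := by
    have := h 0
    simp only [mul_zero, h0] at this
    rw [zero_pow hk.ne'] at this
    rw [this]; simp [hk.ne']
  obtain ⟨p', rfl⟩ : Polynomial.X ∣ p := by rw [Polynomial.X_dvd_iff, coeff_zero_eq_eval_zero]; exact hp0
  obtain ⟨q', rfl⟩ : Polynomial.X ∣ q := by rw [Polynomial.X_dvd_iff, coeff_zero_eq_eval_zero]; exact h0
  simp at h1 ⊢
  have hpoly : Polynomial.X ^ k * p'.comp (Polynomial.X ^ k) =
      Polynomial.X ^ k * (Polynomial.C (∏ j ∈ Finset.range k, ζ ^ j) * ∏ j ∈ Finset.range k, q'.comp (Polynomial.C (ζ ^ j) * Polynomial.X)) := by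
    apply Polynomial.funext
    intro u
    have := h u
    simp only [Polynomial.eval_mul, Polynomial.eval_X, Finset.prod_mul_distrib] at this
    simp only [Polynomial.eval_mul, Polynomial.eval_pow, Polynomial.eval_X, eval_comp, Polynomial.eval_prod, Polynomial.eval_C, this]
    simp
    ring
  have h2 := mul_left_cancel₀ (pow_ne_zero k Polynomial.X_ne_zero) hpoly
  have h3 := congrArg (Polynomial.eval 0) h2
  simp [eval_comp, hk.ne', Polynomial.eval_prod] at h3
  rw [h3]
  refine mul_ne_zero (Finset.prod_ne_zero_iff.2 fun j _ => pow_ne_zero _ hζ) (pow_ne_zero _ h1)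

open Polynomial in
lemma line_deriv (i : Fin 3) (F : MvPolynomial (Fin 3) ℂ) (z : Fin 3 → ℂ) :
    ∃ p : ℂ[X], (∀ t, p.eval t = MvPolynomial.eval (Function.update z i t) F) ∧
      ∀ t, (derivative p).eval t = MvPolynomial.eval (Function.update z i t) (pderiv i F) := by
  set φ : MvPolynomial (Fin 3) ℂ →ₐ[ℂ] ℂ[X] :=
    MvPolynomial.aeval (fun j => if j = i then (Polynomial.X : ℂ[X]) else Polynomial.C (z j)) with hφ
  have hev : ∀ G t, (φ G).eval t = MvPolynomial.eval (Function.update z i t) G := by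
    intro G t
    induction G using MvPolynomial.induction_on with
    | C a => simp [hφ]
    | add p q hp hq => simp [hp, hq]
    | mul_X p n hp =>
      rw [map_mul, Polynomial.eval_mul, hp, map_mul]
      congr 1
      by_cases h : n = i
      · subst h; simp [hφ]
      · simp [hφ, h]
  refine ⟨φ F, hev F, ?_⟩
  intro t
  rw [← hev]
  congr 1
  induction F using MvPolynomial.induction_on with
  | C a => simp [hφ]
  | add p q hp hq => simp [hp, hq]
  | mul_X p n hp =>
    rw [map_mul, Polynomial.derivative_mul, hp, pderiv_mul, map_add, map_mul, map_mul]
    have hX : Polynomial.derivative (φ (MvPolynomial.X n)) = φ (pderiv i (MvPolynomial.X n)) := by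
      by_cases h : n = i
      · subst h; simp [hφ]
      · simp [hφ, h, pderiv_X_of_ne h]
    rw [hX]

structure Good (k : ℕ) (ζ : ℂ) (b e : Polynomial ℝ) : Prop
    extends HypS k ζ (cx b) (cx e) where
  db : b.natDegree ≤ k
  de : e.natDegree ≤ 2 * k
  e0 : e.coeff 0 < 0
  eT : e.coeff (2 * k) < 0
  enp : ∀ x : ℝ, e.eval x ≤ 0
  edb : ∀ x : ℝ, e.eval x = 0 → (Polynomial.derivative e).eval x = 0
  Dre : ∀ x : ℂ, (cx e).eval x = 0 → (Polynomial.derivative (cx e)).eval x = 0 → x.im = 0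
  H0 : e.coeff 1 ^ 2 ≠ 4 * b.coeff 1 ^ 2 * e.coeff 0
  HT : e.coeff (2 * k - 1) ^ 2 ≠ 4 * b.coeff (k - 1) ^ 2 * e.coeff (2 * k)
  Tfin : (TT k ζ (cx b) (cx e)).Finite

variable {k : ℕ} {ζ : ℂ} {b e : Polynomial ℝ}

noncomputable abbrev QQ (k : ℕ) (b e : Polynomial ℝ) : MvPolynomial (Fin 3) ℂ :=
  map (algebraMap ℝ ℂ) (PP k b e)

lemma QQ_hom (k : ℕ) (b e : Polynomial ℝ) : (QQ k b e).IsHomogeneous (2 * k) := (PP_hom k b e).map _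

lemma Good.hypQ (H : Good k ζ b e) : HypQ k ζ (cx b) (cx e) (QQ k b e) :=
  { H.toHypS with
    ev := by
      intro x Y
      have := det_eq k ζ H.prim b e x 1 Y
      rw [one_pow] at this
      refine this.trans ?_
      apply Finset.prod_congr rfl
      intro j _
      exact Gh_one H.db H.de _ _
    hom := QQ_hom k b e }

lemma QQ_real (k : ℕ) (b e : Polynomial ℝ) (z : Fin 3 → ℝ) :
    eval (fun i => (z i : ℂ)) (QQ k b e) = ((eval z (PP k b e) : ℝ) : ℂ) := by
  rw [QQ, eval_map]
  exact eval₂_comp_left (algebraMap ℝ ℂ) (RingHom.id ℝ) z (PP k b e) |>.symm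

lemma sing_zero (hk : 0 < k) {Q : MvPolynomial (Fin 3) ℂ} (h : Q.IsHomogeneous (2 * k))
    {z : Fin 3 → ℂ} (hs : Sing3 Q z) : eval z Q = 0 := by
  have := euler_eval h z
  rw [hs 0, hs 1, hs 2] at this
  have hk' : ((2 * k : ℕ) : ℂ) ≠ 0 := by exact_mod_cast (by omega)
  simp only [mul_zero, add_zero] at this
  exact (mul_eq_zero.1 this.symm).resolve_left hk'

lemma Good.val0 (H : Good k ζ b e) (Y : ℂ) :
    eval ![0, Y, 1] (QQ k b e) = ((Y - b.coeff 0) ^ 2 - e.coeff 0) ^ k := by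
  have := H.hypQ.ev 0 Y
  rw [zero_pow H.k0.ne'] at this
  rw [this]
  simp only [GG, mul_zero, eval_cx_zero]
  simp

lemma Good.evT (H : Good k ζ b e) (v Y : ℂ) : eval ![1, Y, v ^ k] (QQ k b e) =
    ∏ j ∈ Finset.range k, GG (cx (rvs k b)) (cx (rvs (2 * k) e)) (ζ⁻¹ ^ j * v) Y := by
  have := det_eq k ζ H.prim b e 1 v Y
  rw [one_pow] at this
  refine this.trans ?_
  apply Finset.prod_congr rfl
  intro j _
  have hz := H.prim.ne_zero H.k0.ne'
  rw [mul_one, Gh_rev (ζ ^ j) v Y (by rw [← pow_mul, mul_comm, pow_mul, H.prim.pow_eq_one, one_pow])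
    (pow_ne_zero _ hz), inv_pow]

lemma Good.valT (H : Good k ζ b e) (Y : ℂ) :
    eval ![1, Y, 0] (QQ k b e) = ((Y - b.coeff k) ^ 2 - e.coeff (2 * k)) ^ k := by
  have := H.evT 0 Y
  rw [zero_pow H.k0.ne'] at this
  rw [this]
  simp only [GG, mul_zero, eval_cx_zero, rvs_coeff _ _ 0 (Nat.zero_le _), Nat.sub_zero]
  simp

lemma Good.valI (H : Good k ζ b e) : eval ![0, 1, 0] (QQ k b e) = 1 := by
  have := det_eq k ζ H.prim b e 0 0 1
  rw [zero_pow H.k0.ne'] at this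
  refine this.trans ?_
  have hk := H.k0
  have hz : ∀ n i : ℕ, 0 < n → (0 : ℂ) ^ i * 0 ^ (n - i) = 0 := by
    intro n i hn
    rcases Nat.eq_zero_or_pos i with rfl | hi
    · simp [hn.ne']
    · simp [hi.ne']
  simp only [Gh, mul_zero, hz k _ hk, hz (2 * k) _ (by omega)]
  simp

open Polynomial in
lemma dGG (b e : ℂ[X]) (Y : ℂ) : ∃ q : ℂ[X], (∀ x, q.eval x = GG b e x Y) ∧
    (derivative q).eval 0 = -2 * (Y - b.coeff 0) * b.coeff 1 - e.coeff 1 := by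
  refine ⟨(Polynomial.C Y - b) ^ 2 - e, by simp [GG], ?_⟩
  have h0 : ∀ f : ℂ[X], (derivative f).eval 0 = f.coeff 1 := by
    intro f
    rw [← coeff_zero_eq_eval_zero, coeff_derivative]; simp
  simp [derivative_pow, h0, ← coeff_zero_eq_eval_zero]

lemma upd0 (a Y c t : ℂ) : Function.update ![a, Y, c] 0 t = ![t, Y, c] := by
  ext i; fin_cases i <;> simp [Function.update]
lemma upd2 (a Y c t : ℂ) : Function.update ![a, Y, c] 2 t = ![a, Y, t] := by
  ext i; fin_cases i <;> simp [Function.update]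

lemma Good.ns0 (H : Good k ζ b e) (Y : ℂ) : ¬ Sing3 (QQ k b e) ![0, Y, 1] := by
  intro hs
  have h0 := sing_zero H.k0 (QQ_hom k b e) hs
  rw [H.val0] at h0
  have h1 := pow_eq_zero_iff H.k0.ne' |>.1 h0
  obtain ⟨p, hp1, hp2⟩ := line_deriv 0 (QQ k b e) ![0, Y, 1]
  obtain ⟨q, hq1, hq2⟩ := dGG (cx b) (cx e) Y
  simp only [upd0] at hp1 hp2
  refine ram H.k0 (H.prim.ne_zero H.k0.ne') (p := p) (q := q) ?_ ?_ ?_ ?_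
  · intro u
    rw [hp1, H.hypQ.ev]
    exact Finset.prod_congr rfl fun j _ => (hq1 _).symm
  · rw [hq1]
    simpa only [GG, eval_cx_zero] using h1
  · rw [hq2]
    intro hc
    apply H.H0
    simp at hc
    have : (e.coeff 1 : ℂ) ^ 2 = 4 * (b.coeff 1) ^ 2 * e.coeff 0 := by
      linear_combination (4 * (b.coeff 1 : ℂ) ^ 2) * h1 + (2 * (Y - b.coeff 0) * b.coeff 1 - e.coeff 1) * hc
    exact_mod_cast this
  · rw [hp2]; exact hs 0

lemma Good.nsT (H : Good k ζ b e) (Y : ℂ) : ¬ Sing3 (QQ k b e) ![1, Y, 0] := by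
  intro hs
  have hk := H.k0
  have h0 := sing_zero H.k0 (QQ_hom k b e) hs
  rw [H.valT] at h0
  have h1 := pow_eq_zero_iff H.k0.ne' |>.1 h0
  obtain ⟨p, hp1, hp2⟩ := line_deriv 2 (QQ k b e) ![1, Y, 0]
  obtain ⟨q, hq1, hq2⟩ := dGG (cx (rvs k b)) (cx (rvs (2 * k) e)) Y
  simp only [upd2] at hp1 hp2
  refine ram H.k0 (inv_ne_zero (H.prim.ne_zero H.k0.ne')) (p := p) (q := q) ?_ ?_ ?_ ?_
  · intro u
    rw [hp1, H.evT]
    exact Finset.prod_congr rfl fun j _ => (hq1 _).symm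
  · rw [hq1]
    simpa only [GG, eval_cx_zero, rvs_coeff _ _ 0 (Nat.zero_le _), Nat.sub_zero] using h1
  · rw [hq2]
    intro hc
    apply H.HT
    simp only [Polynomial.coeff_map, rvs_coeff k b 0 (by omega), rvs_coeff k b 1 (by omega),
      rvs_coeff (2 * k) e 1 (by omega), Nat.sub_zero, Complex.coe_algebraMap] at hc
    have : (e.coeff (2 * k - 1) : ℂ) ^ 2 = 4 * (b.coeff (k - 1)) ^ 2 * e.coeff (2 * k) := by
      linear_combination (4 * (b.coeff (k - 1) : ℂ) ^ 2) * h1 + (2 * (Y - b.coeff k) * b.coeff (k - 1) - e.coeff (2 * k - 1)) * hc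
    exact_mod_cast this
  · rw [hp2]; exact hs 2

lemma Good.nsI (H : Good k ζ b e) : ¬ Sing3 (QQ k b e) ![0, 1, 0] := by
  intro hs
  have h0 := sing_zero H.k0 (QQ_hom k b e) hs
  rw [H.valI] at h0
  exact one_ne_zero h0

lemma sing_aff_iff (hk : 0 < k) {Q : MvPolynomial (Fin 3) ℂ} (h : Q.IsHomogeneous (2 * k)) (q : ℂ × ℂ) :
    Sing3 Q ![q.1, q.2, 1] ↔ (eval ![q.1, q.2, 1] Q = 0 ∧ Sg Q ![q.1, q.2, 1]) := by
  constructor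
  · intro hs
    exact ⟨sing_zero hk h hs, hs 0, hs 1⟩
  · rintro ⟨h0, h1, h2⟩
    have := euler_eval h ![q.1, q.2, 1]
    rw [h0, h1, h2] at this
    simp at this
    intro i
    fin_cases i
    · exact h1
    · exact h2
    · exact this

lemma Sing3_smul {n : ℕ} {Q : MvPolynomial (Fin 3) ℂ} (h : Q.IsHomogeneous n) (c : ℂ) (hc : c ≠ 0) (z) :
    Sing3 Q (c • z) ↔ Sing3 Q z := by
  unfold Sing3
  simp [eval_smul_hom h.pderiv, hc]

lemma Good.singSet (H : Good k ζ b e) : SingSet (QQ k b e) = cht '' SingAff (QQ k b e) := by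
  have := proj_image (K := ℂ) (Sing3 (QQ k b e)) (fun c hc z => Sing3_smul (QQ_hom k b e) c hc z)
    H.ns0 H.nsT H.nsI
  refine Eq.trans this ?_
  congr 1
  ext q
  simp only [Set.mem_setOf_eq, SingAff]
  rw [sing_aff_iff H.k0 (QQ_hom k b e)]

lemma Good.nodes (H : Good k ζ b e) (z : Fin 3 → ℂ) (hz : z ≠ 0) (hs : Sing3 (QQ k b e) z) :
    (Hes (QQ k b e) z).rank = 2 := by
  have hx : Projectivization.mk ℂ z hz ∈ SingSet (QQ k b e) := by
    obtain ⟨a, ha⟩ := Projectivization.exists_smul_eq_mk_rep ℂ z hz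
    change Sing3 _ _
    rw [← ha]
    exact (Sing3_smul (QQ_hom k b e) _ a.ne_zero z).2 hs
  rw [H.singSet] at hx
  obtain ⟨q, hq, hq2⟩ := hx
  unfold cht at hq2
  rw [Projectivization.mk_eq_mk_iff'] at hq2
  obtain ⟨a, ha⟩ := hq2
  have ha0 : a ≠ 0 := by
    rintro rfl
    have := congrFun ha 2
    simp at this
  have hr : (Hes (QQ k b e) ![q.1, q.2, 1]).rank = 2 := by
    apply node_rank (QQ_hom k b e)
    · intro h
      have := congrFun h 2
      simp at this
    · exact (sing_aff_iff H.k0 (QQ_hom k b e) q).2 hq.2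
    · exact SingAff_mnr H.hypQ hq
  rw [← ha, Hes_smul (QQ_hom k b e), rank_smul_ne (pow_ne_zero _ ha0)] at hr
  exact hr

end NC

open MvPolynomial
namespace NC
variable {k : ℕ} {ζ : ℂ} {b e : Polynomial ℝ}

def Dz (E : Polynomial ℂ) : Set ℂ := {x | E.eval x = 0 ∧ (Polynomial.derivative E).eval x = 0}

lemma Good.D1_eq (H : Good k ζ b e) : D1 (cx b) (cx e) = (fun x => (x, (cx b).eval x)) '' Dz (cx e) := by
  ext ⟨x, Y⟩
  constructor
  · rintro ⟨h1, h2, h3, h4⟩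
    exact ⟨x, ⟨h3, h4⟩, by simp only at h2; rw [h2]⟩
  · rintro ⟨x', ⟨h1, h2⟩, h3⟩
    simp only [Prod.mk.injEq] at h3
    obtain ⟨rfl, rfl⟩ := h3
    refine ⟨?_, rfl, h1, h2⟩
    simp only
    rintro rfl
    rw [eval_cx_zero] at h1
    exact H.e0.ne (by exact_mod_cast h1)

lemma Good.D1_ncard (H : Good k ζ b e) : (D1 (cx b) (cx e)).ncard = (Dz (cx e)).ncard := by
  rw [H.D1_eq, Set.ncard_image_of_injective]
  intro x y h
  exact (Prod.mk.inj h).1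

lemma Good.Dz_finite (H : Good k ζ b e) : (Dz (cx e)).Finite := by
  have hne : cx e ≠ 0 := by
    intro h
    have h1 := eval_cx_zero e
    rw [h] at h1
    simp at h1
    exact H.e0.ne (by exact_mod_cast h1.symm)
  refine ((cx e).roots.toFinset.finite_toSet).subset ?_
  rintro x ⟨hx, _⟩
  simp only [Finset.mem_coe, Multiset.mem_toFinset]
  exact (Polynomial.mem_roots hne).2 hx

lemma Good.D1_finite (H : Good k ζ b e) : (D1 (cx b) (cx e)).Finite := by
  rw [H.D1_eq]; exact H.Dz_finite.image _

/-- real affine zero set -/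
def RA (P : MvPolynomial (Fin 3) ℝ) : Set (ℝ × ℝ) := {q | q.1 ≠ 0 ∧ eval ![q.1, q.2, 1] P = 0}

lemma Good.rz (H : Good k ζ b e) : RZ (PP k b e) = cht '' RA (PP k b e) := by
  have hk := H.k0
  have hc : ∀ z : Fin 3 → ℝ, eval z (PP k b e) = 0 → eval (fun i => (z i : ℂ)) (QQ k b e) = 0 := by
    intro z hz
    rw [QQ_real, hz]; simp
  have := proj_image (K := ℝ) (fun z => eval z (PP k b e) = 0) ?_ ?_ ?_ ?_
  · exact this
  · intro c hc z
    rw [eval_smul_hom (PP_hom k b e)]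
    simp [hc]
  · intro Y h
    have h1 := hc _ h
    have h2 := H.val0 Y
    have h3 : (fun i => ((![0, Y, 1] : Fin 3 → ℝ) i : ℂ)) = ![0, (Y : ℂ), 1] := by
      ext i; fin_cases i <;> simp
    rw [h3, h2] at h1
    have h4 := pow_eq_zero_iff hk.ne' |>.1 h1
    have h5 : (Y - b.coeff 0) ^ 2 - e.coeff 0 = 0 := by exact_mod_cast h4
    nlinarith [H.e0, sq_nonneg (Y - b.coeff 0)]
  · intro Y h
    have h1 := hc _ h
    have h2 := H.valT Y
    have h3 : (fun i => ((![1, Y, 0] : Fin 3 → ℝ) i : ℂ)) = ![1, (Y : ℂ), 0] := by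
      ext i; fin_cases i <;> simp
    rw [h3, h2] at h1
    have h4 := pow_eq_zero_iff hk.ne' |>.1 h1
    have h5 : (Y - b.coeff k) ^ 2 - e.coeff (2 * k) = 0 := by exact_mod_cast h4
    nlinarith [H.eT, sq_nonneg (Y - b.coeff k)]
  · intro h
    have h1 := hc _ h
    have h3 : (fun i => ((![0, 1, 0] : Fin 3 → ℝ) i : ℂ)) = ![0, 1, 0] := by
      ext i; fin_cases i <;> simp
    rw [h3, H.valI] at h1
    exact one_ne_zero h1

def rcp (q : ℝ × ℝ) : ℂ × ℂ := ((q.1 : ℂ), (q.2 : ℂ))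

lemma rcp_inj : Function.Injective rcp := by
  intro p q h
  simp only [rcp, Prod.mk.injEq, Complex.ofReal_inj] at h
  exact Prod.ext h.1 h.2

lemma GG_conj (x Y : ℂ) : GG (cx b) (cx e) (starRingEnd ℂ x) (starRingEnd ℂ Y) =
    starRingEnd ℂ (GG (cx b) (cx e) x Y) := by
  rw [GG, GG, eval_cx_conj, eval_cx_conj]
  simp only [map_sub, map_pow]

lemma RA_ev (q : ℝ × ℝ) : eval ![q.1, q.2, 1] (PP k b e) = 0 ↔
    eval ![(q.1 : ℂ), (q.2 : ℂ), 1] (QQ k b e) = 0 := by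
  have h3 : (fun i => ((![q.1, q.2, 1] : Fin 3 → ℝ) i : ℂ)) = ![(q.1 : ℂ), (q.2 : ℂ), 1] := by
    ext i; fin_cases i <;> simp
  rw [← h3, QQ_real]
  simp

lemma Good.ra (H : Good k ζ b e) :
    rcp '' RA (PP k b e) = pj k '' D1 (cx b) (cx e) ∪ pj k '' N2r k ζ (cx b) (cx e) := by
  have HQ := H.hypQ
  have HS := H.toHypS
  ext p
  constructor
  · rintro ⟨⟨a, Y⟩, ⟨ha, h0⟩, rfl⟩
    simp only at ha h0
    have h0' := (RA_ev (a, Y)).1 h0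
    obtain ⟨x, hx⟩ := IsAlgClosed.exists_pow_nat_eq (a : ℂ) H.k0
    simp only at h0'
    rw [← hx, HQ.ev, Finset.prod_eq_zero_iff] at h0'
    obtain ⟨j, hj, h1⟩ := h0'
    have hx0 : x ≠ 0 := by
      rintro rfl
      rw [zero_pow H.k0.ne'] at hx
      exact ha (by exact_mod_cast hx.symm)
    set x' := ζ ^ j * x with hx'
    have hx'0 : x' ≠ 0 := zpow_ne HS hx0 j
    have hk : x' ^ k = a := by rw [← hx]; exact orb_pow HS x j
    have hcj : (starRingEnd ℂ x') ^ k = x' ^ k := by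
      rw [← map_pow, hk]; simp
    obtain ⟨i, hi, hi2⟩ := orb HS hx'0 hcj
    have hc2 : GG (cx b) (cx e) (ζ ^ i * x') Y = 0 := by
      rw [← hi2, ← Complex.conj_ofReal Y, GG_conj, h1]; simp
    rcases Nat.eq_zero_or_pos i with rfl | hi0
    · left
      rw [pow_zero, one_mul] at hi2
      obtain ⟨r, hr⟩ := Complex.conj_eq_iff_real.1 hi2
      have h2 := h1
      rw [hr, GG, eval_cx_real, eval_cx_real] at h2
      have h3 : (Y - b.eval r) ^ 2 - e.eval r = 0 := by exact_mod_cast h2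
      have h4 := H.enp r
      have h5 : e.eval r = 0 := by nlinarith [sq_nonneg (Y - b.eval r)]
      have h6 : Y - b.eval r = 0 := by
        rw [h5, sub_zero] at h3
        exact pow_eq_zero_iff two_ne_zero |>.1 h3
      refine ⟨(x', (Y : ℂ)), ⟨hx'0, ?_, ?_, ?_⟩, ?_⟩
      · simp only
        rw [hr, eval_cx_real]
        congr 1
        linarith
      · simp only
        rw [hr, eval_cx_real, h5]; simp
      · simp only
        rw [hr, cx, Polynomial.derivative_map]
        have := eval_cx_real (Polynomial.derivative e) r
        rw [cx] at this
        rw [this, H.edb r h5]; simp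
      · simp [pj, rcp, hk]
    · right
      refine ⟨(x', (Y : ℂ)), ⟨⟨hx'0, h1, i, hi0, hi, hc2⟩, ⟨hx'0, i, hi0, hi, HypS.R0 h1 hc2, hi2⟩⟩, ?_⟩
      simp [pj, rcp, hk]
  · have mem : ∀ x : ℂ, ∀ Y : ℂ, x ≠ 0 → starRingEnd ℂ (x ^ k) = x ^ k → starRingEnd ℂ Y = Y →
        GG (cx b) (cx e) x Y = 0 → pj k (x, Y) ∈ rcp '' RA (PP k b e) := by
      intro x Y hx hc hY hG
      obtain ⟨r, hr⟩ := Complex.conj_eq_iff_real.1 hc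
      obtain ⟨y, rfl⟩ := Complex.conj_eq_iff_real.1 hY
      refine ⟨(r, y), ⟨?_, ?_⟩, ?_⟩
      · simp only
        rintro rfl
        exact hx (pow_eq_zero_iff H.k0.ne' |>.1 (by rw [hr]; simp))
      · rw [RA_ev]
        simp only
        rw [← hr, HQ.ev]
        refine Finset.prod_eq_zero (i := 0) (by simp [H.k0]) ?_
        simpa using hG
      · simp [pj, rcp, hr]
    rintro (⟨⟨x, Y⟩, ⟨hx, hY, h3, h4⟩, rfl⟩ | ⟨⟨x, Y⟩, ⟨⟨hx, h0, i, hi, hi', h1⟩, _, j, hj, hj', hR, hc⟩, rfl⟩)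
    · simp only at hx hY h3 h4
      have hxc : starRingEnd ℂ x = x := Complex.conj_eq_iff_im.2 (H.Dre x h3 h4)
      refine mem x Y hx (by rw [map_pow, hxc]) ?_ ?_
      · rw [hY, ← eval_cx_conj, hxc]
      · rw [GG, hY, h3]; simp
    · simp only at *
      have := H.h1 x hx i j hi hi' hj hj' (HypS.R0 h0 h1) hR
      subst this
      refine mem x Y hx ?_ ?_ h0
      · rw [map_pow, hc, orb_pow HS]
      · have e1 : GG (cx b) (cx e) (ζ ^ i * x) (starRingEnd ℂ Y) = 0 := by
          rw [← hc, GG_conj, h0]; simp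
        have e2 : GG (cx b) (cx e) x (starRingEnd ℂ Y) = 0 := by
          have : x = starRingEnd ℂ (ζ ^ i * x) := by rw [← hc, Complex.conj_conj]
          rw [this, GG_conj, h1]; simp
        exact HS.uniqY hx hi hi' e2 e1 h0 h1

theorem abstract_main {g : ℕ} (hk : 3 ≤ k) (hg : g + 3 ≤ k) (H : Good k ζ b e)
    (hD : (Dz (cx e)).ncard + (g + 1) = k)
    (hT : (TT k ζ (cx b) (cx e)).ncard = 4 * (k - 1) ^ 2)
    (hR : (Tr k ζ (cx b) (cx e)).ncard + 2 * k = 2 * k ^ 2 + 4 * g + 4) :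
    ∃ P : MvPolynomial (Fin 3) ℝ,
      P ≠ 0 ∧ P.IsHomogeneous (2 * k) ∧
      Squarefree (MvPolynomial.map (algebraMap ℝ ℂ) P) ∧
      (∀ x ∈ SingSet (MvPolynomial.map (algebraMap ℝ ℂ) P),
        IsNodeAt (MvPolynomial.map (algebraMap ℝ ℂ) P) x) ∧
      ((SingSet (MvPolynomial.map (algebraMap ℝ ℂ) P)).ncard : ℤ)
        = (2 * (k : ℤ) - 1) * ((k : ℤ) - 1) - (g : ℤ) ∧
      (RZ P).Finite ∧ (RZ P).ncard = k ^ 2 + g + 1 := by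
  have HS := H.toHypS
  refine ⟨PP k b e, ?_, PP_hom k b e, sqfree_of_nodes H.nodes, ?_, ?_, ?_⟩
  · intro h
    have := H.valI
    rw [QQ, h] at this
    simp at this
  · intro x hx
    exact H.nodes _ x.rep_nonzero hx
  · have h1 := (SingAff_count H.hypQ H.Tfin H.D1_finite).2
    rw [hT, H.D1_ncard] at h1
    change ((SingSet (QQ k b e)).ncard : ℤ) = _
    rw [H.singSet, Set.ncard_image_of_injective _ cht_inj]
    have h2 : ((2 * (SingAff (QQ k b e)).ncard : ℕ) : ℤ) =
      2 * ((Dz (cx e)).ncard : ℤ) + 4 * ((k : ℤ) - 1) ^ 2 := by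
      rw [h1]; push_cast [Nat.cast_sub (show 1 ≤ k by omega)]; ring
    have h3 : ((Dz (cx e)).ncard : ℤ) = k - g - 1 := by omega
    rw [h3] at h2
    push_cast at h2
    nlinarith
  · have f1 := H.D1_finite.image (pj k)
    have f2 : (pj k '' N2r k ζ (cx b) (cx e)).Finite :=
      ((N2_finite HS H.Tfin).subset (fun p hp => hp.1)).image _
    have hfin : (RA (PP k b e)).Finite := by
      refine Set.Finite.of_finite_image ?_ rcp_inj.injOn
      rw [H.ra]; exact f1.union f2
    refine ⟨?_, ?_⟩
    · rw [H.rz]; exact hfin.image _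
    · rw [H.rz, Set.ncard_image_of_injective _ cht_inj, ← Set.ncard_image_of_injective _ rcp_inj,
        H.ra, Set.ncard_union_eq _ f1 f2, Set.InjOn.ncard_image (pj_injOn HS), H.D1_ncard]
      · have := N2r_count HS H.Tfin
        rw [this] at hR
        nlinarith
      · exact (pj_disj HS).mono_right (Set.image_mono (fun p hp => hp.1))
end NC

namespace Polynomial.PN
open NC

section ring
variable {A : Type*} [CommRing A] {A' : Type*} [CommRing A']

noncomputable def sc (c : A) (f : A[X]) : A[X] := f.comp (C c * X)

lemma sc_coeff (c : A) (f : A[X]) (n : ℕ) : (sc c f).coeff n = f.coeff n * c ^ n := by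
  rw [sc, comp_C_mul_X_coeff]

lemma sc_eval (c : A) (f : A[X]) (x : A) : (sc c f).eval x = f.eval (c * x) := by simp [sc]

noncomputable def dh (c : A) (f : A[X]) : A[X] := divX (sc c f - f)

lemma dh_coeff (c : A) (f : A[X]) (n : ℕ) : (dh c f).coeff n = f.coeff (n + 1) * (c ^ (n + 1) - 1) := by
  rw [dh, coeff_divX, coeff_sub, sc_coeff]; ring

lemma X_mul_dh (c : A) (f : A[X]) : X * dh c f = sc c f - f := by
  have := X_mul_divX_add (sc c f - f)
  rw [coeff_sub, sc_coeff] at this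
  simpa [dh] using this

noncomputable def Rh (c : A) (b e : A[X]) : A[X] :=
  X ^ 2 * dh c b ^ 4 - 2 * dh c b ^ 2 * (e + sc c e) + dh c e ^ 2

lemma sc_map (φ : A →+* A') (c : A) (f : A[X]) : (sc c f).map φ = sc (φ c) (f.map φ) := by
  ext n; simp [sc_coeff]

lemma dh_map (φ : A →+* A') (c : A) (f : A[X]) : (dh c f).map φ = dh (φ c) (f.map φ) := by
  ext n; simp [dh_coeff]

lemma Rh_map (φ : A →+* A') (c : A) (b e : A[X]) : (Rh c b e).map φ = Rh (φ c) (b.map φ) (e.map φ) := by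
  simp [Rh, dh_map, sc_map]

noncomputable def Psi (k : ℕ) (ζ : A) (b e : A[X]) : A[X] := ∏ j ∈ Finset.Ico 1 k, Rh (ζ ^ j) b e

lemma Psi_map (φ : A →+* A') (k : ℕ) (ζ : A) (b e : A[X]) :
    (Psi k ζ b e).map φ = Psi k (φ ζ) (b.map φ) (e.map φ) := by
  simp [Psi, Polynomial.map_prod, Rh_map]

lemma sc_deg (c : A) {f : A[X]} {n : ℕ} (h : f.natDegree ≤ n) : (sc c f).natDegree ≤ n := by
  rw [natDegree_le_iff_coeff_eq_zero] at *
  intro N hN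
  rw [sc_coeff, h N hN, zero_mul]

lemma dh_deg {c : A} {f : A[X]} {n : ℕ} (h : f.natDegree ≤ n) (hc : c ^ n = 1) :
    (dh c f).natDegree ≤ n - 2 := by
  rw [natDegree_le_iff_coeff_eq_zero] at *
  intro N hN
  rw [dh_coeff]
  rcases eq_or_ne (N + 1) n with h1 | h1
  · rw [h1, hc]; simp
  · rw [h (N + 1) (by omega)]; simp

lemma two_deg : (2 : A[X]).natDegree = 0 := natDegree_ofNat 2

variable {k : ℕ} {c : A} {b e : A[X]}

lemma Rh_deg (hk : 2 ≤ k) (hb : b.natDegree ≤ k) (he : e.natDegree ≤ 2 * k) (hc : c ^ k = 1) :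
    (Rh c b e).natDegree ≤ 4 * k - 4 := by
  have h1 := dh_deg hb hc
  have h2 := dh_deg he (by rw [mul_comm, pow_mul, hc, one_pow])
  have h3 := sc_deg c he
  have h4 : (e + sc c e).natDegree ≤ 2 * k := natDegree_add_le_of_degree_le he h3
  unfold Rh
  refine natDegree_add_le_of_degree_le ((natDegree_sub_le_of_le (?_ : _ ≤ 4 * k - 4) (?_ : _ ≤ 4 * k - 4)).trans (max_self _).le) ?_
  · refine (natDegree_mul_le_of_le (natDegree_X_pow_le 2) (natDegree_pow_le_of_le 4 h1)).trans ?_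
    omega
  · refine (natDegree_mul_le_of_le (natDegree_mul_le_of_le (two_deg.le) (natDegree_pow_le_of_le 2 h1)) h4).trans ?_
    omega
  · refine (natDegree_pow_le_of_le 2 h2).trans ?_
    omega

lemma Rh_zero : (Rh c b e).coeff 0 = (c - 1) ^ 2 * (e.coeff 1 ^ 2 - 4 * b.coeff 1 ^ 2 * e.coeff 0) := by
  rw [coeff_zero_eq_eval_zero]
  simp only [Rh, eval_add, eval_sub, eval_mul, eval_pow, eval_X, eval_ofNat, ← coeff_zero_eq_eval_zero,
    dh_coeff, sc_coeff]
  ring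

lemma Rh_top (hk : 2 ≤ k) (hb : b.natDegree ≤ k) (he : e.natDegree ≤ 2 * k) (hc : c ^ k = 1) :
    (Rh c b e).coeff (4 * k - 4) =
      (c ^ (k - 1) - 1) ^ 2 * (e.coeff (2 * k - 1) ^ 2 - 4 * b.coeff (k - 1) ^ 2 * e.coeff (2 * k)) := by
  have hc2 : c ^ (2 * k) = 1 := by rw [mul_comm, pow_mul, hc, one_pow]
  have h1 := dh_deg hb hc
  have h2 := dh_deg he hc2
  have h3 := sc_deg c he
  have h4 : (e + sc c e).natDegree ≤ 2 * k := natDegree_add_le_of_degree_le he h3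
  have e1 : (X ^ 2 * dh c b ^ 4).coeff (4 * k - 4) = 0 := by
    apply coeff_eq_zero_of_natDegree_lt
    refine (natDegree_mul_le_of_le (natDegree_X_pow_le 2) (natDegree_pow_le_of_le 4 h1)).trans_lt ?_
    omega
  have e2 : (2 * dh c b ^ 2 * (e + sc c e)).coeff (4 * k - 4) =
      2 * (dh c b).coeff (k - 2) ^ 2 * (e + sc c e).coeff (2 * k) := by
    have h5 : (2 * dh c b ^ 2).natDegree ≤ 2 * (k - 2) :=
      (natDegree_mul_le_of_le (two_deg.le) (natDegree_pow_le_of_le 2 h1)).trans (by omega)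
    rw [show 4 * k - 4 = 2 * (k - 2) + 2 * k by omega, coeff_mul_add_eq_of_natDegree_le h5 h4]
    congr 1
    rw [show (2 : A[X]) = C 2 from rfl, coeff_C_mul, coeff_pow_of_natDegree_le h1]
  have e3 : (dh c e ^ 2).coeff (4 * k - 4) = (dh c e).coeff (2 * k - 2) ^ 2 := by
    rw [show 4 * k - 4 = 2 * (2 * k - 2) by omega, coeff_pow_of_natDegree_le h2]
  rw [Rh, coeff_add, coeff_sub, e1, e2, e3, dh_coeff, dh_coeff, coeff_add, sc_coeff, hc2,
    show k - 2 + 1 = k - 1 by omega, show 2 * k - 2 + 1 = k + (k - 1) by omega, pow_add, hc,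
    show 2 * k - 1 = k + (k - 1) by omega]
  ring

lemma Psi_deg {ζ : A} (hk : 2 ≤ k) (hb : b.natDegree ≤ k) (he : e.natDegree ≤ 2 * k) (hc : ζ ^ k = 1) :
    (Psi k ζ b e).natDegree ≤ 4 * (k - 1) ^ 2 := by
  unfold Psi
  refine (natDegree_prod_le _ _).trans ?_
  refine (Finset.sum_le_card_nsmul _ _ (4 * k - 4) ?_).trans ?_
  · intro j _
    exact Rh_deg hk hb he (by rw [← pow_mul, mul_comm, pow_mul, hc, one_pow])
  · rw [Nat.card_Ico, smul_eq_mul]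
    obtain ⟨m, rfl⟩ : ∃ m, k = m + 1 := ⟨k - 1, by omega⟩
    simp
    have : 4 * (m + 1) - 4 = 4 * m := by omega
    rw [this]; nlinarith
end ring

variable {k : ℕ} {ζ : ℂ} {B E : ℂ[X]}

lemma Rj_eq (j : ℕ) : Rj ζ B E j = X ^ 2 * Rh (ζ ^ j) B E := by
  unfold Rj Rp
  have h1 : scl (ζ ^ j) B - B = X * dh (ζ ^ j) B := (X_mul_dh _ _).symm
  have h2 : E - scl (ζ ^ j) E = -(X * dh (ζ ^ j) E) := by
    rw [X_mul_dh]
    change _ = -(scl _ _ - _)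
    ring
  rw [h1, h2]
  change _ - _ * (E + sc (ζ ^ j) E) + _ = _
  rw [Rh]
  ring

/-- condition U -/
structure CU (k : ℕ) (ζ : ℂ) (B E : ℂ[X]) : Prop where
  hk : 3 ≤ k
  prim : IsPrimitiveRoot ζ k
  db : B.natDegree ≤ k
  de : E.natDegree ≤ 2 * k
  sep : (Psi k ζ B E).Separable
  deg : (Psi k ζ B E).natDegree = 4 * (k - 1) ^ 2

lemma CU.pw (H : CU k ζ B E) (j : ℕ) : (ζ ^ j) ^ k = 1 := by
  rw [← pow_mul, mul_comm, pow_mul, H.prim.pow_eq_one, one_pow]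

lemma CU.uniq (H : CU k ζ B E) {x : ℂ} {i j : ℕ} (hi : 0 < i) (hi' : i < k) (hj : 0 < j) (hj' : j < k)
    (h1 : (Rh (ζ ^ i) B E).eval x = 0) (h2 : (Rh (ζ ^ j) B E).eval x = 0) : i = j := by
  by_contra hne
  have hs := H.sep.squarefree
  have hd : (X - C x) * (X - C x) ∣ Psi k ζ B E := by
    have : Rh (ζ ^ i) B E * Rh (ζ ^ j) B E ∣ Psi k ζ B E := by
      rw [← Finset.prod_pair (f := fun j => Rh (ζ ^ j) B E) hne]
      apply Finset.prod_dvd_prod_of_subset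
      intro l hl
      simp at hl ⊢
      omega
    exact (mul_dvd_mul (dvd_iff_isRoot.2 h1) (dvd_iff_isRoot.2 h2)).trans this
  exact not_isUnit_X_sub_C x (hs _ hd)

lemma CU.simple (H : CU k ζ B E) {x : ℂ} {j : ℕ} (hj : 0 < j) (hj' : j < k)
    (h1 : (Rh (ζ ^ j) B E).eval x = 0) : (derivative (Rh (ζ ^ j) B E)).eval x ≠ 0 := by
  have hd : Rh (ζ ^ j) B E ∣ Psi k ζ B E :=
    Finset.dvd_prod_of_mem (fun j => Rh (ζ ^ j) B E) (by simp; omega)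
  have := H.sep.of_dvd hd
  intro h
  obtain ⟨a, b, hab⟩ := this
  have := congrArg (eval x) hab
  simp [h1, h] at this

lemma CU.ne0 (H : CU k ζ B E) : Psi k ζ B E ≠ 0 := H.sep.ne_zero

lemma CU.Rne0 (H : CU k ζ B E) {j : ℕ} (hj : 0 < j) (hj' : j < k) : Rh (ζ ^ j) B E ≠ 0 := by
  have := H.ne0
  rw [Psi, Finset.prod_ne_zero_iff] at this
  exact this j (by simp; omega)

lemma CU.Rdeg (H : CU k ζ B E) {j : ℕ} (hj : 0 < j) (hj' : j < k) :
    (Rh (ζ ^ j) B E).natDegree = 4 * k - 4 := by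
  have hk := H.hk
  by_contra hne
  have h1 : ∀ i ∈ Finset.Ico 1 k, (Rh (ζ ^ i) B E).natDegree ≤ 4 * k - 4 := fun i _ =>
    Rh_deg (by omega) H.db H.de (H.pw i)
  have h2 : ∑ i ∈ Finset.Ico 1 k, (Rh (ζ ^ i) B E).natDegree < ∑ i ∈ Finset.Ico 1 k, (4 * k - 4) :=
    Finset.sum_lt_sum h1 ⟨j, by simp; omega, lt_of_le_of_ne (h1 j (by simp; omega)) hne⟩
  have h3 := H.deg
  rw [Psi, natDegree_prod _ _ (fun i hi => by simp at hi; exact H.Rne0 (by omega) hi.2)] at h3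
  rw [h3] at h2
  simp only [Finset.sum_const, Nat.card_Ico, smul_eq_mul] at h2
  obtain ⟨m, rfl⟩ : ∃ m, k = m + 1 := ⟨k - 1, by omega⟩
  have : 4 * (m + 1) - 4 = 4 * m := by omega
  rw [this] at h2
  simp at h2
  nlinarith

lemma CU.zero (H : CU k ζ B E) : E.coeff 1 ^ 2 ≠ 4 * B.coeff 1 ^ 2 * E.coeff 0 := by
  intro h
  have hk := H.hk
  have : ∀ j : ℕ, (Rh (ζ ^ j) B E).eval 0 = 0 := by
    intro j
    rw [← coeff_zero_eq_eval_zero, Rh_zero, h]; ring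
  have := H.uniq (i := 1) (j := 2) (by omega) (by omega) (by omega) (by omega) (this 1) (this 2)
  omega

lemma CU.zeroR (H : CU k ζ B E) {j : ℕ} (hj : 0 < j) (hj' : j < k) : (Rh (ζ ^ j) B E).eval 0 ≠ 0 := by
  rw [← coeff_zero_eq_eval_zero, Rh_zero]
  refine mul_ne_zero (pow_ne_zero _ (sub_ne_zero.2 ?_)) (sub_ne_zero.2 H.zero)
  exact H.prim.pow_ne_one_of_pos_of_lt hj.ne' hj'

lemma CU.top (H : CU k ζ B E) :
    E.coeff (2 * k - 1) ^ 2 ≠ 4 * B.coeff (k - 1) ^ 2 * E.coeff (2 * k) := by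
  intro h
  have hk := H.hk
  have h1 := Rh_top (by omega) H.db H.de (H.pw 1)
  have h2 := H.Rdeg (j := 1) (by omega) (by omega)
  rw [h, sub_self, mul_zero, ← h2] at h1
  exact H.Rne0 (by omega) (by omega) (leadingCoeff_eq_zero.1 h1)

lemma CU.hypS (H : CU k ζ B E)
    (hE : ∀ x, E.eval x = 0 → (derivative E).eval x = 0 → (derivative (derivative E)).eval x ≠ 0) :
    HypS k ζ B E where
  k0 := by have := H.hk; omega
  prim := H.prim
  h1 := by
    intro x hx i j hi hi' hj hj' h1 h2
    rw [Rj_eq] at h1 h2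
    simp [hx] at h1 h2
    exact H.uniq hi hi' hj hj' h1 h2
  h2 := by
    intro x hx j hj hj' h1
    rw [Rj_eq] at h1 ⊢
    simp [hx] at h1
    have := H.simple hj hj' h1
    rw [derivative_mul]
    simp [h1, hx, this]
  hE := hE

lemma TT_eq (H : CU k ζ B E) : TT k ζ B E = ((Psi k ζ B E).roots.toFinset : Set ℂ) := by
  ext x
  simp only [Finset.mem_coe, Multiset.mem_toFinset]
  rw [mem_roots H.ne0, IsRoot, Psi, eval_prod, Finset.prod_eq_zero_iff]
  constructor
  · rintro ⟨hx, j, hj, hj', h⟩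
    rw [Rj_eq] at h
    simp [hx] at h
    exact ⟨j, by simp; omega, h⟩
  · rintro ⟨j, hj, h⟩
    simp at hj
    have hx : x ≠ 0 := by
      rintro rfl
      exact H.zeroR (by omega) hj.2 h
    exact ⟨hx, j, by omega, hj.2, by rw [Rj_eq]; simp [h]⟩

lemma CU.Tfin (H : CU k ζ B E) : (TT k ζ B E).Finite := by
  rw [TT_eq H]; exact Finset.finite_toSet _

lemma CU.Tcard (H : CU k ζ B E) : (TT k ζ B E).ncard = 4 * (k - 1) ^ 2 := by
  rw [TT_eq H, Set.ncard_coe_finset, Multiset.toFinset_card_of_nodup (nodup_roots H.sep),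
    ← H.deg]
  exact (IsAlgClosed.splits _).natDegree_eq_card_roots.symm

end Polynomial.PN

namespace Polynomial.PN
open NC

/-- twist the coefficients by a sequence -/
noncomputable def tw (s : ℕ → ℝ) (f : ℝ[X]) : ℝ[X] := ∑ n ∈ f.support, monomial n (f.coeff n * s n)

lemma tw_coeff (s : ℕ → ℝ) (f : ℝ[X]) (n : ℕ) : (tw s f).coeff n = f.coeff n * s n := by
  simp only [tw, finsetSum_coeff, coeff_monomial]
  rw [Finset.sum_ite_eq' f.support n]
  split_ifs with h
  · rfl
  · rw [notMem_support_iff.1 h, zero_mul]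

noncomputable def sn (θ : ℝ) (f : ℝ[X]) : ℝ[X] := tw (fun n => Real.sin (n * θ)) f
noncomputable def cs (θ : ℝ) (f : ℝ[X]) : ℝ[X] := tw (fun n => Real.cos (n * θ)) f
/-- sine part divided by the variable -/
noncomputable def sh (θ : ℝ) (f : ℝ[X]) : ℝ[X] := divX (sn θ f)

lemma sn_coeff (θ : ℝ) (f : ℝ[X]) (n : ℕ) : (sn θ f).coeff n = f.coeff n * Real.sin (n * θ) := tw_coeff _ _ _
lemma cs_coeff (θ : ℝ) (f : ℝ[X]) (n : ℕ) : (cs θ f).coeff n = f.coeff n * Real.cos (n * θ) := tw_coeff _ _ _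
lemma sh_coeff (θ : ℝ) (f : ℝ[X]) (n : ℕ) :
    (sh θ f).coeff n = f.coeff (n + 1) * Real.sin ((n + 1 : ℕ) * θ) := by
  rw [sh, coeff_divX, sn_coeff]

lemma X_mul_sh (θ : ℝ) (f : ℝ[X]) : X * sh θ f = sn θ f := by
  have := X_mul_divX_add (sn θ f)
  rw [sn_coeff] at this
  simpa [sh] using this

/-- the real polynomial governing the ray of angle θ -/
noncomputable def Fl (θ : ℝ) (b e : ℝ[X]) : ℝ[X] :=
  4 * X ^ 2 * sh θ b ^ 4 + 4 * cs θ e * sh θ b ^ 2 - sh θ e ^ 2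

noncomputable def ex (θ : ℝ) : ℂ := Complex.exp (θ * Complex.I)

lemma ex_pow (θ : ℝ) (n : ℕ) : ex θ ^ n = Real.cos (n * θ) + Real.sin (n * θ) * Complex.I := by
  rw [ex, ← Complex.exp_nat_mul, show (n : ℂ) * (θ * Complex.I) = ((n * θ : ℝ) : ℂ) * Complex.I by push_cast; ring,
    Complex.exp_mul_I]
  push_cast; ring

lemma ex_eq (θ : ℝ) : ex θ = Real.cos θ + Real.sin θ * Complex.I := by
  have := ex_pow θ 1
  simpa using this

lemma ex_ne (θ : ℝ) : ex θ ≠ 0 := Complex.exp_ne_zero _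

lemma ex_add (θ φ : ℝ) : ex (θ + φ) = ex θ * ex φ := by
  rw [ex, ex, ex, ← Complex.exp_add]; push_cast; ring_nf

lemma ex_zero : ex 0 = 1 := by simp [ex]

lemma ex_neg (θ : ℝ) : ex (-θ) = (ex θ)⁻¹ := by
  apply eq_inv_of_mul_eq_one_left
  rw [← ex_add]; simp [ex_zero]

lemma ex_nsmul (θ : ℝ) (n : ℕ) : ex (n * θ) = ex θ ^ n := by
  rw [ex, ex, ← Complex.exp_nat_mul]; push_cast; ring_nf

lemma ex_conj (θ : ℝ) : starRingEnd ℂ (ex θ) = ex (-θ) := by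
  rw [ex, ex, ← Complex.exp_conj]; simp

lemma dh_ex (θ : ℝ) (f : ℝ[X]) : sc (ex θ) (dh (ex (-(2 * θ))) (cx f)) =
    C (-2 * Complex.I * ex (-θ)) * cx (sh θ f) := by
  ext n
  rw [sc_coeff, dh_coeff, coeff_C_mul, coeff_map, coeff_map, sh_coeff]
  have h1 : ex (-(2 * θ)) ^ (n + 1) = ex (-((n + 1 : ℕ) * θ)) ^ 2 := by
    rw [← ex_nsmul, ← ex_nsmul]; congr 1; push_cast; ring
  have h2 : ex θ ^ n = ex (-θ) * ex ((n + 1 : ℕ) * θ) := by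
    rw [← ex_nsmul, ← ex_add]; congr 1; push_cast; ring
  have h3 : ex (-((n + 1 : ℕ) * θ)) * ex ((n + 1 : ℕ) * θ) = 1 := by
    rw [← ex_add, neg_add_cancel, ex_zero]
  have h4 : ex (-((n + 1 : ℕ) * θ)) - ex ((n + 1 : ℕ) * θ) = -2 * Complex.I * Real.sin ((n + 1 : ℕ) * θ) := by
    rw [ex_eq, ex_eq, Real.cos_neg, Real.sin_neg]; push_cast; ring
  rw [h1, h2]
  simp only [Complex.coe_algebraMap]
  push_cast at *
  linear_combination (f.coeff (n + 1) * ex (-θ) : ℂ) * h4 + (f.coeff (n + 1) * ex (-θ) * ex (-((n + 1) * θ)) : ℂ) * h3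

lemma cs_ex (θ : ℝ) (f : ℝ[X]) : sc (ex θ) (cx f + sc (ex (-(2 * θ))) (cx f)) = C 2 * cx (cs θ f) := by
  ext n
  rw [sc_coeff, coeff_add, sc_coeff, coeff_C_mul, coeff_map, coeff_map, cs_coeff]
  have h1 : ex (-(2 * θ)) ^ n * ex θ ^ n = ex (-(n * θ)) := by
    rw [← ex_nsmul, ← ex_nsmul, ← ex_add]; congr 1; ring
  have h2 : ex θ ^ n = ex (n * θ) := by rw [ex_nsmul]
  have h4 : ex (-(n * θ)) + ex (n * θ) = 2 * Real.cos (n * θ) := by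
    rw [ex_eq, ex_eq, Real.cos_neg, Real.sin_neg]; push_cast; ring
  simp only [Complex.coe_algebraMap]
  push_cast at *
  linear_combination (f.coeff n : ℂ) * h4 + (f.coeff n : ℂ) * h1 + (f.coeff n : ℂ) * h2

lemma Rh_ex (θ : ℝ) (b e : ℝ[X]) (r : ℝ) :
    (Rh (ex (-(2 * θ))) (cx b) (cx e)).eval (ex θ * r) = 4 * ex (-(2 * θ)) * ((Fl θ b e).eval r : ℝ) := by
  have h1 : ∀ f : ℝ[X], (dh (ex (-(2 * θ))) (cx f)).eval (ex θ * r) =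
      (-2 * Complex.I * ex (-θ)) * ((sh θ f).eval r : ℝ) := by
    intro f
    rw [← sc_eval, dh_ex, eval_C_mul, eval_cx_real]
  have h2 : (cx e + sc (ex (-(2 * θ))) (cx e)).eval (ex θ * r) = 2 * ((cs θ e).eval r : ℝ) := by
    rw [← sc_eval, cs_ex, eval_C_mul, eval_cx_real]
  have h3 : ex (-(2 * θ)) = ex (-θ) ^ 2 := by rw [← ex_nsmul]; congr 1; push_cast; ring
  have h4 : ex θ * ex (-θ) = 1 := by rw [← ex_add, add_neg_cancel, ex_zero]
  simp only [Rh, eval_add (p := _ - _), eval_sub, eval_mul, eval_pow, eval_X, eval_ofNat, h1, h2]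
  simp only [Fl, eval_add, eval_sub, eval_mul, eval_pow, eval_X, eval_ofNat]
  push_cast
  rw [h3]
  generalize (((sh θ b).eval r : ℝ) : ℂ) = β
  generalize (((sh θ e).eval r : ℝ) : ℂ) = ε
  generalize (((cs θ e).eval r : ℝ) : ℂ) = γ
  linear_combination (16 * (r : ℂ) ^ 2 * ex (-θ) ^ 2 * β ^ 4 * (ex θ * ex (-θ) + 1)) * h4
    + (16 * (ex θ) ^ 2 * r ^ 2 * ex (-θ) ^ 4 * β ^ 4 * (Complex.I ^ 2 - 1)
      + 4 * ex (-θ) ^ 2 * ε ^ 2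
      - 16 * ex (-θ) ^ 2 * β ^ 2 * γ) * Complex.I_sq

variable {k : ℕ} {b e : ℝ[X]}

noncomputable def zt (k : ℕ) : ℂ := Complex.exp (2 * Real.pi * Complex.I / k)
noncomputable def th (k l : ℕ) : ℝ := Real.pi * l / k

lemma zt_prim (hk : 0 < k) : IsPrimitiveRoot (zt k) k := Complex.isPrimitiveRoot_exp k hk.ne'

lemma zt_pow (hk : 0 < k) {l : ℕ} (hl : l ≤ k) : zt k ^ (k - l) = ex (-(2 * th k l)) := by
  have hk' : (k : ℂ) ≠ 0 := by exact_mod_cast hk.ne'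
  have h1 : zt k ^ l * ex (-(2 * th k l)) = 1 := by
    rw [zt, ← Complex.exp_nat_mul, ex, ← Complex.exp_add, th]
    convert Complex.exp_zero using 2
    push_cast
    field_simp
    ring
  have h2 : zt k ^ l * zt k ^ (k - l) = 1 := by
    rw [← pow_add, Nat.add_sub_cancel' hl, (zt_prim hk).pow_eq_one]
  have h3 : zt k ^ l ≠ 0 := pow_ne_zero _ ((zt_prim hk).ne_zero hk.ne')
  exact mul_left_cancel₀ h3 (by rw [h1, h2])

lemma Tr_iff (H : CU k (zt k) (cx b) (cx e)) (x : ℂ) : x ∈ Tr k (zt k) (cx b) (cx e) ↔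
    ∃ l, 0 < l ∧ l < k ∧ ∃ r : ℝ, (Fl (th k l) b e).eval r = 0 ∧ x = ex (th k l) * r := by
  have hk : 0 < k := by have := H.hk; omega
  have hk' : (k : ℂ) ≠ 0 := by exact_mod_cast hk.ne'
  constructor
  · rintro ⟨hx, j, hj, hj', hR, hc⟩
    refine ⟨k - j, by omega, by omega, ?_⟩
    have hz : zt k ^ j = ex (-(2 * th k (k - j))) := by
      rw [← zt_pow hk (by omega), show k - (k - j) = j by omega]
    rw [hz] at hc
    set θ := th k (k - j)
    have hre : starRingEnd ℂ (ex (-θ) * x) = ex (-θ) * x := by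
      rw [map_mul, hc, ex_conj, ← mul_assoc, ← ex_add]
      congr 2; ring
    obtain ⟨r, hr⟩ := Complex.conj_eq_iff_real.1 hre
    have hxr : x = ex θ * r := by
      rw [← hr, ← mul_assoc, ← ex_add, add_neg_cancel, ex_zero, one_mul]
    refine ⟨r, ?_, hxr⟩
    rw [Rj_eq, hz, hxr, eval_mul, Rh_ex] at hR
    rw [← hxr] at hR
    have h4 : (X ^ 2 : ℂ[X]).eval x ≠ 0 := by simp [hx]
    have h5 := (mul_eq_zero.1 hR).resolve_left h4
    have h6 := (mul_eq_zero.1 h5).resolve_left (mul_ne_zero (by norm_num) (ex_ne _))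
    exact_mod_cast h6
  · rintro ⟨l, hl, hl', r, hr, rfl⟩
    have hR : (Rh (zt k ^ (k - l)) (cx b) (cx e)).eval (ex (th k l) * r) = 0 := by
      rw [zt_pow hk hl'.le, Rh_ex, hr]; simp
    refine ⟨?_, k - l, by omega, by omega, ?_, ?_⟩
    · intro h0
      rw [h0] at hR
      exact H.zeroR (by omega) (by omega) hR
    · rw [Rj_eq, eval_mul, hR, mul_zero]
    · rw [zt_pow hk hl'.le, map_mul, ex_conj, Complex.conj_ofReal, ← mul_assoc, ← ex_add]
      congr 2; ring

lemma Fl_ne (H : CU k (zt k) (cx b) (cx e)) {l : ℕ} (hl : 0 < l) (hl' : l < k) : (Fl (th k l) b e).eval 0 ≠ 0 := by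
  intro h
  have hk : 0 < k := by omega
  have := Rh_ex (th k l) b e 0
  rw [h, ← zt_pow hk hl'.le] at this
  simp only [Complex.ofReal_zero, mul_zero] at this
  exact H.zeroR (by omega) (by omega) this

lemma Fl_ne' (H : CU k (zt k) (cx b) (cx e)) {l : ℕ} (hl : 0 < l) (hl' : l < k) : Fl (th k l) b e ≠ 0 := by
  intro h
  apply Fl_ne H hl hl'
  rw [h]; simp

lemma Tr_card (H : CU k (zt k) (cx b) (cx e)) : (Tr k (zt k) (cx b) (cx e)).ncard =
    ∑ l ∈ Finset.Ico 1 k, (Fl (th k l) b e).roots.toFinset.card := by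
  classical
  have hk : 0 < k := by have := H.hk; omega
  rw [← Finset.card_sigma, ← Set.ncard_coe_finset]
  have himg : Tr k (zt k) (cx b) (cx e) = (fun p : (_ : ℕ) × ℝ => ex (th k p.1) * (p.2 : ℂ)) ''
      (((Finset.Ico 1 k).sigma fun l => (Fl (th k l) b e).roots.toFinset : Finset _) : Set ((_ : ℕ) × ℝ)) := by
    ext x
    rw [Tr_iff H]
    constructor
    · rintro ⟨l, hl, hl', r, hr, rfl⟩
      refine ⟨⟨l, r⟩, ?_, rfl⟩
      simp only [Finset.coe_sigma, Set.mem_sigma_iff, Finset.mem_coe, Finset.mem_Ico, Multiset.mem_toFinset]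
      exact ⟨by omega, (mem_roots (Fl_ne' H hl hl')).2 hr⟩
    · rintro ⟨⟨l, r⟩, hm, rfl⟩
      simp only [Finset.coe_sigma, Set.mem_sigma_iff, Finset.mem_coe, Finset.mem_Ico, Multiset.mem_toFinset] at hm
      exact ⟨l, by omega, by omega, r, (mem_roots (Fl_ne' H (by omega) (by omega))).1 hm.2, rfl⟩
  rw [himg, Set.InjOn.ncard_image]
  rintro ⟨l, r⟩ h1 ⟨l', r'⟩ h2 heq
  simp only [Finset.coe_sigma, Set.mem_sigma_iff, Finset.mem_coe, Finset.mem_Ico, Multiset.mem_toFinset] at h1 h2 heq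
  have hr := (mem_roots (Fl_ne' H (by omega) (by omega))).1 h1.2
  have hr' := (mem_roots (Fl_ne' H (by omega) (by omega))).1 h2.2
  have hr0 : (r : ℂ) ≠ 0 := by
    intro h
    have : r = 0 := by exact_mod_cast h
    rw [this] at hr
    exact Fl_ne H (by omega) (by omega) hr
  have hx0 : ex (th k l) * (r : ℂ) ≠ 0 := mul_ne_zero (ex_ne _) hr0
  have c1 : ∀ l (r : ℝ), l ≤ k → starRingEnd ℂ (ex (th k l) * (r : ℂ)) = zt k ^ (k - l) * (ex (th k l) * r) := by
    intro l r hl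
    rw [zt_pow hk hl, map_mul, ex_conj, Complex.conj_ofReal, ← mul_assoc, ← ex_add]
    congr 2; ring
  have c2 := c1 l r (by omega)
  have c3 := c1 l' r' (by omega)
  rw [← heq, c2] at c3
  have c4 := mul_right_cancel₀ hx0 c3
  have c5 := (zt_prim hk).pow_inj (by omega) (by omega) c4
  have hll : l = l' := by omega
  subst hll
  have := mul_left_cancel₀ (ex_ne _) heq
  have hrr : r = r' := by exact_mod_cast this
  subst hrr; rfl

end Polynomial.PN

namespace Polynomial.PN
open NC

lemma generic_sep (F : ℂ[X][X]) (n : ℕ) (hn0 : 1 ≤ n) (hn : F.natDegree ≤ n) (ν₀ : ℂ)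
    (hs : (F.map (evalRingHom ν₀)).Separable) (hd : (F.map (evalRingHom ν₀)).natDegree = n) :
    {ν : ℂ | ¬ ((F.map (evalRingHom ν)).Separable ∧ (F.map (evalRingHom ν)).natDegree = n)}.Finite := by
  have hmn : ∀ ν, (F.map (evalRingHom ν)).natDegree ≤ n := fun ν => natDegree_map_le.trans hn
  have key : ∀ ν, (F.map (evalRingHom ν)).natDegree = n →
      ((F.map (evalRingHom ν)).Separable ↔ (resultant F (derivative F) n (n-1)).eval ν ≠ 0) := by
    intro ν hν
    have h1 : (resultant F (derivative F) n (n-1)).eval ν = resultant (F.map (evalRingHom ν)) (derivative (F.map (evalRingHom ν))) := by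
      rw [natDegree_derivative, hν, derivative_map]
      exact (resultant_map_map F (derivative F) n (n-1) (evalRingHom ν)).symm
    rw [h1, Ne, resultant_eq_zero_iff, separable_def]
    have : F.map (evalRingHom ν) ≠ 0 := by
      intro h; rw [h] at hν; simp at hν; omega
    simp [this]
  have hlead : F.coeff n ≠ 0 := by
    intro h
    have : (F.map (evalRingHom ν₀)).coeff n = 0 := by rw [coeff_map, h, map_zero]
    rw [← hd, coeff_natDegree, leadingCoeff_eq_zero] at this
    rw [this] at hd; simp at hd; omega
  have hres : resultant F (derivative F) n (n-1) ≠ 0 := by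
    intro h
    have := (key ν₀ hd).1 hs
    rw [h] at this; simp at this
  refine Set.Finite.subset ((finite_setOfPred_isRoot hlead).union (finite_setOfPred_isRoot hres)) ?_
  intro ν hν
  by_contra hc
  simp only [Set.mem_union, Set.mem_ofPred_eq, IsRoot, not_or] at hc
  have hd' : (F.map (evalRingHom ν)).natDegree = n := by
    apply le_antisymm (hmn ν)
    apply le_natDegree_of_ne_zero
    rw [coeff_map]; exact hc.1
  exact hν ⟨(key ν hd').2 hc.2, hd'⟩
end Polynomial.PN

namespace Polynomial.PN
open NC

lemma exists_notMem_closure (s : Set ℂ) (hs : s.Countable) : ∃ x : ℂ, x ∉ Subfield.closure s := by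
  by_contra hc
  push Not at hc
  have h1 := Subfield.cardinalMk_closure_le_max s
  have h2 : Cardinal.mk (Subfield.closure s) = Cardinal.mk ℂ := by
    have : Subfield.closure s = ⊤ := by
      rw [eq_top_iff]; intro x _; exact hc x
    rw [this]
    exact Cardinal.mk_congr (Equiv.Set.univ ℂ)
  rw [h2, Cardinal.mk_complex] at h1
  have h3 : max (Cardinal.mk s) Cardinal.aleph0 = Cardinal.aleph0 :=
    max_eq_right hs.le_aleph0
  rw [h3] at h1
  exact absurd h1 (not_le.2 Cardinal.aleph0_lt_continuum)

/-- generic parameters for the split example -/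
structure GB (k : ℕ) (ζ γ β : ℂ) (K₁ K₂ : Subfield ℂ) : Prop where
  hk : 3 ≤ k
  prim : IsPrimitiveRoot ζ k
  le : K₁ ≤ K₂
  z1 : ζ ∈ K₁
  g1 : γ ∉ K₁
  g2 : γ ∈ K₂
  b2 : β ∉ K₂

lemma exists_GB {k : ℕ} (hk : 3 ≤ k) : ∃ γ β K₁ K₂, GB k (zt k) γ β K₁ K₂ := by
  obtain ⟨γ, hγ⟩ := exists_notMem_closure {zt k} (Set.countable_singleton _)
  obtain ⟨β, hβ⟩ := exists_notMem_closure {γ, zt k} (Set.countable_insert.2 (Set.countable_singleton _))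
  refine ⟨γ, β, _, _, hk, zt_prim (by omega), ?_, Subfield.subset_closure (by simp), hγ,
    Subfield.subset_closure (by simp), hβ⟩
  apply Subfield.closure_mono; simp

section
variable {k : ℕ} {ζ γ β : ℂ} {K₁ K₂ : Subfield ℂ} (H : GB k ζ γ β K₁ K₂)
include H

lemma GB.lin {a b : ℂ} (ha : a ∈ K₂) (hb : b ∈ K₂) (h : a * β = b) : a = 0 ∧ b = 0 := by
  by_cases h0 : a = 0
  · subst h0; simp at h; exact ⟨rfl, h.symm⟩
  · exfalso; apply H.b2
    have : β = b / a := by field_simp; linear_combination h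
    rw [this]; exact div_mem hb ha

lemma GB.lin1 {a b : ℂ} (ha : a ∈ K₁) (hb : b ∈ K₁) (h : a * γ = b) : a = 0 ∧ b = 0 := by
  by_cases h0 : a = 0
  · subst h0; simp at h; exact ⟨rfl, h.symm⟩
  · exfalso; apply H.g1
    have : γ = b / a := by field_simp; linear_combination h
    rw [this]; exact div_mem hb ha

lemma GB.z2 (i : ℕ) : ζ ^ i ∈ K₂ := pow_mem (H.le H.z1) i
lemma GB.z1' (i : ℕ) : ζ ^ i ∈ K₁ := pow_mem H.z1 i
lemma GB.zne (i : ℕ) : ζ ^ i ≠ 0 := pow_ne_zero _ (H.prim.ne_zero (by have := H.hk; omega))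
lemma GB.gne : γ ≠ 0 := fun h => H.g1 (h ▸ zero_mem _)
lemma GB.bne : β ≠ 0 := fun h => H.b2 (h ▸ zero_mem _)
lemma GB.g1ne (i : ℕ) : γ * ζ ^ i - 1 ≠ 0 := by
  intro h
  have := (H.lin1 (H.z1' i) (one_mem _) (by linear_combination h)).2
  exact one_ne_zero this
lemma GB.d3 (i j : ℕ) : ζ ^ j - γ * ζ ^ i * β ≠ 0 := by
  intro h
  exact H.zne j (H.lin (mul_mem H.g2 (H.z2 i)) (H.z2 j) (by linear_combination -h)).2
lemma GB.d4 (i j : ℕ) : 1 - γ * ζ ^ i * β * ζ ^ j ≠ 0 := by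
  intro h
  exact one_ne_zero (H.lin (a := γ * ζ ^ i * ζ ^ j) (mul_mem (mul_mem H.g2 (H.z2 i)) (H.z2 j)) (one_mem _) (by linear_combination -h)).2
lemma GB.zinj {i j : ℕ} (hi : i < k) (hj : j < k) (h : ζ ^ i = ζ ^ j) : i = j := H.prim.pow_inj hi hj h
omit H

noncomputable def t1 (ζ : ℂ) (p : ℕ × ℕ) : ℂ := (ζ ^ p.2 - 1) / (ζ ^ p.1 - ζ ^ p.2)
noncomputable def t3 (ζ γ β : ℂ) (p : ℕ × ℕ) : ℂ := (γ * ζ ^ p.2 - 1) / (ζ ^ p.1 - γ * ζ ^ p.2 * β)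
noncomputable def t4 (ζ γ β : ℂ) (p : ℕ × ℕ) : ℂ := (γ * ζ ^ p.2 - 1) / (1 - γ * ζ ^ p.2 * β * ζ ^ p.1)

include H
lemma GB.t1_mem (p : ℕ × ℕ) : t1 ζ p ∈ K₂ :=
  div_mem (sub_mem (H.z2 _) (one_mem _)) (sub_mem (H.z2 _) (H.z2 _))

lemma GB.t1_ne {p : ℕ × ℕ} (hp : p ∈ (Finset.Ico 1 k).offDiag) : t1 ζ p ≠ 0 := by
  simp only [Finset.mem_offDiag, Finset.mem_Ico] at hp
  refine div_ne_zero (sub_ne_zero.2 ?_) (sub_ne_zero.2 ?_)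
  · exact H.prim.pow_ne_one_of_pos_of_lt (by omega) (by omega)
  · intro h; exact hp.2.2 (H.zinj (by omega) (by omega) h)

lemma GB.t1_eq {p : ℕ × ℕ} (hp : p ∈ (Finset.Ico 1 k).offDiag) :
    1 + ζ ^ p.1 * t1 ζ p = ζ ^ p.2 * (1 + t1 ζ p) := by
  simp only [Finset.mem_offDiag, Finset.mem_Ico] at hp
  have : ζ ^ p.1 - ζ ^ p.2 ≠ 0 := sub_ne_zero.2 (fun h => hp.2.2 (H.zinj (by omega) (by omega) h))
  rw [t1]; field_simp; ring

lemma GB.t3_ne (p : ℕ × ℕ) : t3 ζ γ β p ≠ 0 := div_ne_zero (H.g1ne _) (H.d3 _ _)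
lemma GB.t4_ne (p : ℕ × ℕ) : t4 ζ γ β p ≠ 0 := div_ne_zero (H.g1ne _) (H.d4 _ _)
lemma GB.t3_eq (p : ℕ × ℕ) : t3 ζ γ β p * (ζ ^ p.1 - γ * ζ ^ p.2 * β) = γ * ζ ^ p.2 - 1 := div_mul_cancel₀ _ (H.d3 _ _)
lemma GB.t4_eq (p : ℕ × ℕ) : t4 ζ γ β p * (1 - γ * ζ ^ p.2 * β * ζ ^ p.1) = γ * ζ ^ p.2 - 1 := div_mul_cancel₀ _ (H.d4 _ _)
omit H

lemma three_circle {x a b : ℂ} (hx : x ≠ 0) (ha : ‖a‖ = 1) (hb : ‖b‖ = 1) (ha1 : a ≠ 1) (hb1 : b ≠ 1)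
    (h1 : ‖1 + a * x‖ = ‖1 + x‖) (h2 : ‖1 + b * x‖ = ‖1 + x‖) : a = b := by
  have key : ∀ a : ℂ, ‖a‖ = 1 → a ≠ 1 → ‖1 + a * x‖ = ‖1 + x‖ → a * x = starRingEnd ℂ x := by
    intro a ha ha1 h
    have e1 : (1 + a * x) * starRingEnd ℂ (1 + a * x) = (1 + x) * starRingEnd ℂ (1 + x) := by
      rw [Complex.mul_conj, Complex.mul_conj, Complex.normSq_eq_norm_sq, Complex.normSq_eq_norm_sq, h]
    have e2 : a * starRingEnd ℂ a = 1 := by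
      rw [Complex.mul_conj, Complex.normSq_eq_norm_sq, ha]; simp
    simp only [map_add, map_mul, map_one] at e1
    have e3 : (a - 1) * (a * x - starRingEnd ℂ x) = 0 := by
      linear_combination a * e1 - (starRingEnd ℂ x + a * x * starRingEnd ℂ x) * e2
    rcases mul_eq_zero.1 e3 with h | h
    · exact absurd (sub_eq_zero.1 h) ha1
    · exact sub_eq_zero.1 h
  exact mul_right_cancel₀ hx ((key a ha ha1 h1).trans (key b hb hb1 h2).symm)

include H
lemma GB.nz (i : ℕ) : ‖ζ ^ i‖ = 1 := by
  rw [norm_pow, H.prim.norm'_eq_one (by have := H.hk; omega), one_pow]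

lemma GB.t1_inj : Set.InjOn (t1 ζ) ((Finset.Ico 1 k).offDiag : Finset _) := by
  intro p hp q hq h
  have e1 := H.t1_eq hp
  have e2 := H.t1_eq hq
  have hx := H.t1_ne hp
  simp only [Finset.mem_coe, Finset.mem_offDiag, Finset.mem_Ico] at hp hq
  rw [← h] at e2
  have n1 : ζ ^ p.1 ≠ 1 := H.prim.pow_ne_one_of_pos_of_lt (by omega) (by omega)
  have n2 : ζ ^ q.1 ≠ 1 := H.prim.pow_ne_one_of_pos_of_lt (by omega) (by omega)
  have h1 : ζ ^ p.1 = ζ ^ q.1 := three_circle hx (H.nz _) (H.nz _) n1 n2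
    (by rw [e1, norm_mul, H.nz, one_mul]) (by rw [e2, norm_mul, H.nz, one_mul])
  have h0 : 1 + t1 ζ p ≠ 0 := by
    intro h0
    rw [h0] at e1
    apply n1
    have : t1 ζ p = -1 := by linear_combination h0
    rw [this] at e1
    linear_combination -e1
  have h2 : ζ ^ p.2 = ζ ^ q.2 := mul_right_cancel₀ h0 (by rw [← e1, ← e2, h1])
  exact Prod.ext (H.zinj (by omega) (by omega) h1) (H.zinj (by omega) (by omega) h2)

lemma GB.t2_inj : Set.InjOn (fun p => t1 ζ p / β) ((Finset.Ico 1 k).offDiag : Finset _) := by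
  intro p hp q hq h
  exact H.t1_inj hp hq (by simpa [div_left_inj' H.bne] using h)

lemma GB.t3_inj : Set.InjOn (t3 ζ γ β) (Finset.Ico 1 k ×ˢ Finset.range k : Finset _) := by
  intro p hp q hq h
  simp only [Finset.mem_coe, Finset.mem_product, Finset.mem_Ico, Finset.mem_range] at hp hq
  have e : (γ * ζ ^ p.2 - 1) * (ζ ^ q.1 - γ * ζ ^ q.2 * β) = (γ * ζ ^ q.2 - 1) * (ζ ^ p.1 - γ * ζ ^ p.2 * β) := by
    rw [← H.t3_eq, ← H.t3_eq, h]; ring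
  have hz := H.z2
  have hg := H.g2
  have l := H.lin (a := γ * (ζ ^ q.2 - ζ ^ p.2)) (b := (γ * ζ ^ q.2 - 1) * ζ ^ p.1 - (γ * ζ ^ p.2 - 1) * ζ ^ q.1)
    (by apply_rules [mul_mem, sub_mem, one_mem]) (by apply_rules [mul_mem, sub_mem, one_mem]) (by linear_combination e)
  have h2 : ζ ^ q.2 = ζ ^ p.2 := sub_eq_zero.1 ((mul_eq_zero.1 l.1).resolve_left H.gne)
  have h1 : ζ ^ p.1 = ζ ^ q.1 := by
    have := l.2
    rw [h2, ← mul_sub] at this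
    exact sub_eq_zero.1 ((mul_eq_zero.1 this).resolve_left (H.g1ne _))
  exact Prod.ext (H.zinj (by omega) (by omega) h1) (H.zinj (by omega) (by omega) h2.symm)

lemma GB.t4_inj' {p q : ℕ × ℕ} (hp : p.1 < k) (hp' : p.2 < k) (hr : q.1 < k) (hr' : q.2 < k)
    (h : t4 ζ γ β p = t4 ζ γ β q) : p = q := by
  have e : (γ * ζ ^ p.2 - 1) * (1 - γ * ζ ^ q.2 * β * ζ ^ q.1) = (γ * ζ ^ q.2 - 1) * (1 - γ * ζ ^ p.2 * β * ζ ^ p.1) := by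
    rw [← H.t4_eq, ← H.t4_eq, h]; ring
  have hz := H.z2
  have hg := H.g2
  have l := H.lin (a := (γ * ζ ^ p.2 - 1) * (γ * ζ ^ q.2 * ζ ^ q.1) - (γ * ζ ^ q.2 - 1) * (γ * ζ ^ p.2 * ζ ^ p.1)) (b := γ * (ζ ^ p.2 - ζ ^ q.2))
    (by apply_rules [mul_mem, sub_mem, one_mem]) (by apply_rules [mul_mem, sub_mem, one_mem]) (by linear_combination -e)
  have h2 : ζ ^ p.2 = ζ ^ q.2 := sub_eq_zero.1 ((mul_eq_zero.1 l.2).resolve_left H.gne)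
  have h1 : ζ ^ q.1 = ζ ^ p.1 := by
    have := l.1
    rw [h2, ← mul_sub, ← mul_sub] at this
    have := (mul_eq_zero.1 this).resolve_left (H.g1ne _)
    exact sub_eq_zero.1 ((mul_eq_zero.1 this).resolve_left (mul_ne_zero H.gne (H.zne _)))
  exact Prod.ext (H.zinj (by omega) (by omega) h1.symm) (H.zinj (by omega) (by omega) h2)

lemma GB.t4_inj : Set.InjOn (t4 ζ γ β) (Finset.Ico 1 k ×ˢ Finset.range k : Finset _) := by
  intro p hp q hq h
  simp only [Finset.mem_coe, Finset.mem_product, Finset.mem_Ico, Finset.mem_range] at hp hq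
  exact H.t4_inj' (by omega) (by omega) (by omega) (by omega) h

lemma GB.t12 {p q : ℕ × ℕ} (hp : p ∈ (Finset.Ico 1 k).offDiag) (hq : q ∈ (Finset.Ico 1 k).offDiag) :
    t1 ζ p ≠ t1 ζ q / β := by
  intro h
  rw [eq_div_iff H.bne] at h
  exact H.t1_ne hp (H.lin (H.t1_mem _) (H.t1_mem _) h).1

lemma GB.t13 {p q : ℕ × ℕ} (hp : p ∈ (Finset.Ico 1 k).offDiag) : t1 ζ p ≠ t3 ζ γ β q := by
  intro h
  have e := H.t3_eq q
  rw [← h] at e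
  have hz := H.z2
  have hg := H.g2
  have ht := H.t1_mem p
  have l := H.lin (a := t1 ζ p * (γ * ζ ^ q.2)) (b := t1 ζ p * ζ ^ q.1 - (γ * ζ ^ q.2 - 1))
    (by apply_rules [mul_mem, sub_mem, one_mem]) (by apply_rules [mul_mem, sub_mem, one_mem]) (by linear_combination -e)
  exact mul_ne_zero (H.t1_ne hp) (mul_ne_zero H.gne (H.zne _)) l.1

lemma GB.t14 {p q : ℕ × ℕ} (hp : p ∈ (Finset.Ico 1 k).offDiag) : t1 ζ p ≠ t4 ζ γ β q := by
  intro h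
  have e := H.t4_eq q
  rw [← h] at e
  have hz := H.z2
  have hg := H.g2
  have ht := H.t1_mem p
  have l := H.lin (a := t1 ζ p * (γ * ζ ^ q.2 * ζ ^ q.1)) (b := t1 ζ p - (γ * ζ ^ q.2 - 1))
    (by apply_rules [mul_mem, sub_mem, one_mem]) (by apply_rules [mul_mem, sub_mem, one_mem]) (by linear_combination -e)
  exact mul_ne_zero (H.t1_ne hp) (mul_ne_zero (mul_ne_zero H.gne (H.zne _)) (H.zne _)) l.1

lemma GB.t23 {p q : ℕ × ℕ} (hp : p ∈ (Finset.Ico 1 k).offDiag) : t1 ζ p / β ≠ t3 ζ γ β q := by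
  intro h
  have e := H.t3_eq q
  rw [← h, div_mul_eq_mul_div, div_eq_iff H.bne] at e
  have hz := H.z2
  have hg := H.g2
  have ht := H.t1_mem p
  have l := H.lin (a := γ * ζ ^ q.2 - 1 + t1 ζ p * (γ * ζ ^ q.2)) (b := t1 ζ p * ζ ^ q.1)
    (by apply_rules [mul_mem, sub_mem, one_mem, add_mem]) (by apply_rules [mul_mem, sub_mem, one_mem]) (by linear_combination -e)
  exact mul_ne_zero (H.t1_ne hp) (H.zne _) l.2

lemma GB.t24 {p q : ℕ × ℕ} (hp : p ∈ (Finset.Ico 1 k).offDiag) : t1 ζ p / β ≠ t4 ζ γ β q := by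
  intro h
  have e := H.t4_eq q
  rw [← h, div_mul_eq_mul_div, div_eq_iff H.bne] at e
  have hz := H.z2
  have hg := H.g2
  have ht := H.t1_mem p
  have l := H.lin (a := γ * ζ ^ q.2 - 1 + t1 ζ p * (γ * ζ ^ q.2 * ζ ^ q.1)) (b := t1 ζ p)
    (by apply_rules [mul_mem, sub_mem, one_mem, add_mem]) (by apply_rules [mul_mem, sub_mem, one_mem]) (by linear_combination -e)
  exact H.t1_ne hp l.2

lemma GB.t34 {p q : ℕ × ℕ} (hp : p ∈ Finset.Ico 1 k ×ˢ Finset.range k) : t3 ζ γ β p ≠ t4 ζ γ β q := by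
  intro h
  simp only [Finset.mem_product, Finset.mem_Ico, Finset.mem_range] at hp
  have e : (γ * ζ ^ p.2 - 1) * (1 - γ * ζ ^ q.2 * β * ζ ^ q.1) = (γ * ζ ^ q.2 - 1) * (ζ ^ p.1 - γ * ζ ^ p.2 * β) := by
    rw [← H.t3_eq p, ← H.t4_eq q, h]; ring
  have hz := H.z2
  have hz' := H.z1'
  have hg := H.g2
  have l := H.lin (a := (γ * ζ ^ p.2 - 1) * (γ * ζ ^ q.2 * ζ ^ q.1) - (γ * ζ ^ q.2 - 1) * (γ * ζ ^ p.2)) (b := (γ * ζ ^ p.2 - 1) - (γ * ζ ^ q.2 - 1) * ζ ^ p.1)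
    (by apply_rules [mul_mem, sub_mem, one_mem]) (by apply_rules [mul_mem, sub_mem, one_mem]) (by linear_combination -e)
  have l1 := H.lin1 (a := ζ ^ p.2 - ζ ^ q.2 * ζ ^ p.1) (b := 1 - ζ ^ p.1)
    (by apply_rules [mul_mem, sub_mem, one_mem]) (by apply_rules [mul_mem, sub_mem, one_mem]) (by linear_combination l.2)
  exact H.prim.pow_ne_one_of_pos_of_lt (by omega : p.1 ≠ 0) (by omega) (sub_eq_zero.1 l1.2).symm
end
end Polynomial.PN

namespace Polynomial.PN
open NC

section
variable {k : ℕ} {ζ γ β : ℂ} {K₁ K₂ : Subfield ℂ}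

noncomputable def uB1 (k : ℕ) : ℂ[X] := (1 + X) ^ k
noncomputable def uB2 (k : ℕ) (γ β : ℂ) : ℂ[X] := C (γ ^ k) * (1 + C β * X) ^ k
noncomputable def ub (k : ℕ) (γ β : ℂ) : ℂ[X] := C (1/2) * (uB1 k + uB2 k γ β)
noncomputable def ud (k : ℕ) (γ β : ℂ) : ℂ[X] := C (1/2) * (uB1 k - uB2 k γ β)

lemma Rh_prod {c x : ℂ} (A B : ℂ[X]) :
    x ^ 2 * (Rh c (C (1/2) * (A + B)) ((C (1/2) * (A - B)) ^ 2)).eval x =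
      (A.eval (c * x) - A.eval x) * (B.eval (c * x) - B.eval x) *
      (A.eval (c * x) - B.eval x) * (B.eval (c * x) - A.eval x) := by
  have h : ∀ f : ℂ[X], x * (dh c f).eval x = f.eval (c * x) - f.eval x := by
    intro f
    have := congrArg (eval x) (X_mul_dh c f)
    simpa [sc_eval] using this
  set b := C (1/2) * (A + B) with hb
  set e := (C (1/2) * (A - B)) ^ 2 with he
  have h1 := h b
  have h2 := h e
  have : x ^ 2 * (Rh c b e).eval x = (x * (dh c b).eval x) ^ 4
     - 2 * (x * (dh c b).eval x) ^ 2 * (e.eval x + e.eval (c * x)) + (x * (dh c e).eval x) ^ 2 := by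
    simp only [Rh, eval_add, eval_sub, eval_mul, eval_pow, eval_X, eval_ofNat, sc_eval]; ring
  rw [this, h1, h2, hb, he]
  simp only [eval_add, eval_sub, eval_mul, eval_pow, eval_C]
  ring

lemma uB1_eval (k : ℕ) (x : ℂ) : (uB1 k).eval x = (1 + x) ^ k := by simp [uB1]
lemma uB2_eval (k : ℕ) (γ β x : ℂ) : (uB2 k γ β).eval x = (γ * (1 + β * x)) ^ k := by simp [uB2, mul_pow]

variable (H : GB k ζ γ β K₁ K₂)
include H

lemma GB.zk (i : ℕ) : (ζ ^ i) ^ k = 1 := by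
  rw [← pow_mul, mul_comm, pow_mul, H.prim.pow_eq_one, one_pow]

lemma GB.Rh0 {c x : ℂ} (hx : x ≠ 0)
    (h : (uB1 k).eval (c * x) = (uB1 k).eval x ∨ (uB2 k γ β).eval (c * x) = (uB2 k γ β).eval x ∨
      (uB1 k).eval (c * x) = (uB2 k γ β).eval x ∨ (uB2 k γ β).eval (c * x) = (uB1 k).eval x) :
    (Rh c (ub k γ β) (ud k γ β ^ 2)).eval x = 0 := by
  have := Rh_prod (c := c) (x := x) (uB1 k) (uB2 k γ β)
  have h2 : x ^ 2 ≠ 0 := pow_ne_zero _ hx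
  refine (mul_eq_zero.1 (?_ : x ^ 2 * _ = 0)).resolve_left h2
  rw [ub, ud, this]
  rcases h with h | h | h | h <;> rw [h] <;> ring

lemma GB.Psi0 {j : ℕ} (hj : j ∈ Finset.Ico 1 k) {x : ℂ} (h : (Rh (ζ ^ j) (ub k γ β) (ud k γ β ^ 2)).eval x = 0) :
    (Psi k ζ (ub k γ β) (ud k γ β ^ 2)).eval x = 0 := by
  rw [Psi, eval_prod]
  exact Finset.prod_eq_zero hj h

lemma GB.r1 {p : ℕ × ℕ} (hp : p ∈ (Finset.Ico 1 k).offDiag) :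
    (Psi k ζ (ub k γ β) (ud k γ β ^ 2)).eval (t1 ζ p) = 0 := by
  refine H.Psi0 (Finset.mem_offDiag.1 hp).1 (H.Rh0 (H.t1_ne hp) (Or.inl ?_))
  rw [uB1_eval, uB1_eval, H.t1_eq hp, mul_pow, H.zk, one_mul]

lemma GB.r2 {p : ℕ × ℕ} (hp : p ∈ (Finset.Ico 1 k).offDiag) :
    (Psi k ζ (ub k γ β) (ud k γ β ^ 2)).eval (t1 ζ p / β) = 0 := by
  refine H.Psi0 (Finset.mem_offDiag.1 hp).1 (H.Rh0 (div_ne_zero (H.t1_ne hp) H.bne) (Or.inr (Or.inl ?_)))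
  have hb := H.bne
  rw [uB2_eval, uB2_eval, show β * (ζ ^ p.1 * (t1 ζ p / β)) = ζ ^ p.1 * t1 ζ p by field_simp,
    show β * (t1 ζ p / β) = t1 ζ p by field_simp, H.t1_eq hp]
  rw [mul_left_comm, mul_pow, H.zk, one_mul]

lemma GB.r3 {p : ℕ × ℕ} (hp : p ∈ Finset.Ico 1 k ×ˢ Finset.range k) :
    (Psi k ζ (ub k γ β) (ud k γ β ^ 2)).eval (t3 ζ γ β p) = 0 := by
  refine H.Psi0 (Finset.mem_product.1 hp).1 (H.Rh0 (H.t3_ne p) (Or.inr (Or.inr (Or.inl ?_))))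
  rw [uB2_eval, uB1_eval, show 1 + ζ ^ p.1 * t3 ζ γ β p = ζ ^ p.2 * (γ * (1 + β * t3 ζ γ β p)) by
    linear_combination H.t3_eq p, mul_pow, H.zk, one_mul]

lemma GB.r4 {p : ℕ × ℕ} (hp : p ∈ Finset.Ico 1 k ×ˢ Finset.range k) :
    (Psi k ζ (ub k γ β) (ud k γ β ^ 2)).eval (t4 ζ γ β p) = 0 := by
  refine H.Psi0 (Finset.mem_product.1 hp).1 (H.Rh0 (H.t4_ne p) (Or.inr (Or.inr (Or.inr ?_))))
  rw [uB2_eval, uB1_eval, show 1 + t4 ζ γ β p = ζ ^ p.2 * (γ * (1 + β * (ζ ^ p.1 * t4 ζ γ β p))) by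
    linear_combination H.t4_eq p, mul_pow (ζ ^ p.2), H.zk, one_mul]

lemma GB.gk : γ ^ k ≠ 1 := by
  intro h
  have := H.hk
  have : NeZero k := ⟨by omega⟩
  obtain ⟨i, _, hi⟩ := H.prim.eq_pow_of_pow_eq_one h
  exact H.g1 (hi ▸ H.z1' i)

lemma GB.gbk : (γ * β) ^ k ≠ 1 := by
  intro h
  have := H.hk
  have : NeZero k := ⟨by omega⟩
  obtain ⟨i, _, hi⟩ := H.prim.eq_pow_of_pow_eq_one h
  exact H.gne (H.lin H.g2 (H.z2 i) hi.symm).1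

lemma GB.Psi_ne : Psi k ζ (ub k γ β) (ud k γ β ^ 2) ≠ 0 := by
  rw [Psi, Finset.prod_ne_zero_iff]
  intro j hj h0
  rw [Finset.mem_Ico] at hj
  have h1 := congrArg (coeff · 0) h0
  simp only [Rh_zero, coeff_zero, mul_eq_zero, sub_eq_zero, ne_eq, OfNat.ofNat_ne_zero, not_false_eq_true, pow_eq_zero_iff] at h1
  have h2 := h1.resolve_left (H.prim.pow_ne_one_of_pos_of_lt (by omega) (by omega))
  have hk := H.hk
  have c0 : ∀ f : ℂ[X], f.coeff 1 = (derivative f).eval 0 := by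
    intro f; rw [← coeff_zero_eq_eval_zero, coeff_derivative]; simp
  rw [c0, c0, coeff_zero_eq_eval_zero] at h2
  simp only [ub, ud, uB1, uB2, derivative_pow, derivative_mul, derivative_C, derivative_add, derivative_sub,
    eval_mul, eval_add, eval_sub, eval_C, eval_pow, eval_X, eval_one, eval_natCast, derivative_X, derivative_one,
    eval_zero] at h2
  norm_num at h2
  have h3 : (1 - γ ^ k) ^ 2 * (k : ℂ) ^ 2 * γ ^ k * β = 0 := by
    linear_combination -h2
  have hk0 : (k : ℂ) ≠ 0 := by exact_mod_cast (by omega : k ≠ 0)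
  exact mul_ne_zero (mul_ne_zero (mul_ne_zero (pow_ne_zero _ (sub_ne_zero.2 H.gk.symm)) (pow_ne_zero _ hk0)) (pow_ne_zero _ H.gne)) H.bne h3

omit H
lemma uB1_deg : (uB1 k).natDegree ≤ k := by
  rw [uB1]; refine natDegree_pow_le.trans ?_
  have : (1 + X : ℂ[X]).natDegree ≤ 1 := by compute_degree
  nlinarith
lemma uB2_deg : (uB2 k γ β).natDegree ≤ k := by
  rw [uB2]; refine (natDegree_C_mul_le _ _).trans (natDegree_pow_le.trans ?_)
  have : (1 + C β * X : ℂ[X]).natDegree ≤ 1 := by compute_degree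
  nlinarith
lemma ub_deg : (ub k γ β).natDegree ≤ k := by
  rw [ub]; exact (natDegree_C_mul_le _ _).trans (natDegree_add_le_of_degree_le uB1_deg uB2_deg)
lemma ud_deg : (ud k γ β).natDegree ≤ k := by
  rw [ud]; exact (natDegree_C_mul_le _ _).trans (natDegree_sub_le_of_le uB1_deg uB2_deg |>.trans (by simp))

lemma sep_of_roots {P : ℂ[X]} (S : Finset ℂ) (hP : P ≠ 0) (hd : P.natDegree ≤ S.card) (hS : ∀ x ∈ S, P.eval x = 0) :
    P.Separable ∧ P.natDegree = S.card ∧ P.roots = S.val := by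
  have h1 : S.val ≤ P.roots := (Multiset.le_iff_subset S.nodup).2 (fun x hx => (mem_roots hP).2 (hS x hx))
  have h2 : P.roots = S.val := by
    refine (Multiset.eq_of_le_of_card_le h1 ?_).symm
    exact (card_roots' P).trans hd
  have h3 : P.natDegree = S.card := by
    refine le_antisymm hd ?_
    have := card_roots' P
    rw [h2] at this; exact this
  refine ⟨?_, h3, h2⟩
  rw [← nodup_roots_iff_of_splits hP (IsAlgClosed.splits _), h2]
  exact S.nodup

include H
lemma GB.CU : CU k ζ (ub k γ β) (ud k γ β ^ 2) := by
  have hk := H.hk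
  have hde : (ud k γ β ^ 2).natDegree ≤ 2 * k := natDegree_pow_le.trans (by have := ud_deg (k := k) (γ := γ) (β := β); omega)
  have hdeg := Psi_deg (ζ := ζ) (by omega) (ub_deg (k := k) (γ := γ) (β := β)) hde (H.prim.pow_eq_one)
  classical
  let T1 := (Finset.Ico 1 k).offDiag.image (t1 ζ)
  let T2 := (Finset.Ico 1 k).offDiag.image (fun p => t1 ζ p / β)
  let T3 := (Finset.Ico 1 k ×ˢ Finset.range k).image (t3 ζ γ β)
  let T4 := (Finset.Ico 1 k ×ˢ Finset.range k).image (t4 ζ γ β)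
  have c1 : T1.card = (k - 1) * (k - 1) - (k - 1) := by
    rw [Finset.card_image_of_injOn H.t1_inj, Finset.offDiag_card, Nat.card_Ico]
  have c2 : T2.card = (k - 1) * (k - 1) - (k - 1) := by
    rw [Finset.card_image_of_injOn H.t2_inj, Finset.offDiag_card, Nat.card_Ico]
  have c3 : T3.card = (k - 1) * k := by
    rw [Finset.card_image_of_injOn H.t3_inj, Finset.card_product, Nat.card_Ico, Finset.card_range]
  have c4 : T4.card = (k - 1) * k := by
    rw [Finset.card_image_of_injOn H.t4_inj, Finset.card_product, Nat.card_Ico, Finset.card_range]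
  have d12 : Disjoint T1 T2 := by
    rw [Finset.disjoint_left]; intro x h1 h2
    obtain ⟨p, hp, rfl⟩ := Finset.mem_image.1 h1
    obtain ⟨q, hq, h⟩ := Finset.mem_image.1 h2
    exact H.t12 hp hq h.symm
  have d3 : Disjoint (T1 ∪ T2) T3 := by
    rw [Finset.disjoint_left]; intro x h1 h2
    obtain ⟨q, hq, rfl⟩ := Finset.mem_image.1 h2
    rcases Finset.mem_union.1 h1 with h1 | h1
    · obtain ⟨p, hp, h⟩ := Finset.mem_image.1 h1; exact H.t13 hp h
    · obtain ⟨p, hp, h⟩ := Finset.mem_image.1 h1; exact H.t23 hp h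
  have d4 : Disjoint (T1 ∪ T2 ∪ T3) T4 := by
    rw [Finset.disjoint_left]; intro x h1 h2
    obtain ⟨q, hq, rfl⟩ := Finset.mem_image.1 h2
    rcases Finset.mem_union.1 h1 with h1 | h1
    · rcases Finset.mem_union.1 h1 with h1 | h1
      · obtain ⟨p, hp, h⟩ := Finset.mem_image.1 h1; exact H.t14 hp h
      · obtain ⟨p, hp, h⟩ := Finset.mem_image.1 h1; exact H.t24 hp h
    · obtain ⟨p, hp, h⟩ := Finset.mem_image.1 h1; exact H.t34 hp h
  have hcard : (T1 ∪ T2 ∪ T3 ∪ T4).card = 4 * (k - 1) ^ 2 := by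
    rw [Finset.card_union_of_disjoint d4, Finset.card_union_of_disjoint d3, Finset.card_union_of_disjoint d12, c1, c2, c3, c4]
    obtain ⟨n, rfl⟩ : ∃ n, k = n + 2 := ⟨k - 2, by omega⟩
    have : (n + 2 - 1) * (n + 2 - 1) - (n + 2 - 1) = (n + 1) * n := by
      have : (n + 2 - 1) * (n + 2 - 1) = (n+1) * n + (n + 1) := by simp; ring
      omega
    rw [this]; simp; ring
  obtain ⟨s1, s2, -⟩ := sep_of_roots (T1 ∪ T2 ∪ T3 ∪ T4) H.Psi_ne (hcard ▸ hdeg) (by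
    intro x hx
    simp only [Finset.mem_union, T1, T2, T3, T4, Finset.mem_image] at hx
    rcases hx with ((⟨p, hp, rfl⟩ | ⟨p, hp, rfl⟩) | ⟨p, hp, rfl⟩) | ⟨p, hp, rfl⟩
    · exact H.r1 hp
    · exact H.r2 hp
    · exact H.r3 hp
    · exact H.r4 hp)
  exact ⟨hk, H.prim, ub_deg, hde, s1, hcard ▸ s2⟩

lemma GB.udfac {g : ℕ} (hg : g + 3 ≤ k) : ∃ q s : ℂ[X], ud k γ β = q * s ∧ q.natDegree ≤ g + 1 ∧
    s.natDegree = k - g - 1 ∧ s.Separable := by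
  have hk := H.hk
  have hne : ud k γ β ≠ 0 := by
    intro h
    have := congrArg (eval 0) h
    simp [ud, uB1, uB2] at this
    exact H.gk (sub_eq_zero.1 this).symm
  have hinj : Set.InjOn (fun i => t4 ζ γ β (0, i)) (Finset.range k : Finset ℕ) := by
    intro i hi j hj h
    simp only [Finset.coe_range, Set.mem_Iio] at hi hj
    have := H.t4_inj' (p := (0, i)) (q := (0, j)) (by simp; omega) hi (by simp; omega) hj h
    simpa using this
  classical
  have hc : ((Finset.range k).image (fun i => t4 ζ γ β (0, i))).card = k := by
    rw [Finset.card_image_of_injOn hinj, Finset.card_range]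
  obtain ⟨-, s2, s3⟩ := sep_of_roots ((Finset.range k).image (fun i => t4 ζ γ β (0, i))) hne
    (by rw [hc]; exact ud_deg) (by
      intro x hx
      obtain ⟨i, hi, rfl⟩ := Finset.mem_image.1 hx
      have h4 := H.t4_eq (0, i)
      simp only [pow_zero, mul_one] at h4
      simp only [ud, eval_mul, eval_C, eval_sub, uB1_eval, uB2_eval]
      rw [show 1 + t4 ζ γ β (0, i) = ζ ^ i * (γ * (1 + β * t4 ζ γ β (0, i))) by linear_combination h4,
        mul_pow (ζ ^ i), H.zk]
      ring)
  have s4 := C_leadingCoeff_mul_prod_multiset_X_sub_C (p := ud k γ β) (by rw [s2, s3]; rfl)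
  rw [s3] at s4
  have s5 : (((Finset.range k).image (fun i => t4 ζ γ β (0, i))).val.map (fun a => X - C a)).prod =
      ∏ i ∈ Finset.range k, (X - C (t4 ζ γ β (0, i))) := Finset.prod_image hinj
  rw [s5, ← Finset.prod_range_mul_prod_Ico _ (show g + 1 ≤ k by omega), ← mul_assoc] at s4
  refine ⟨_, _, s4.symm, ?_, ?_, ?_⟩
  · refine (natDegree_C_mul_le _ _).trans ?_
    rw [natDegree_prod_of_monic _ _ (fun i _ => monic_X_sub_C _)]
    simp
  · rw [natDegree_prod_of_monic _ _ (fun i _ => monic_X_sub_C _)]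
    simp; omega
  · rw [separable_prod_X_sub_C_iff']
    intro i hi j hj h
    rw [Finset.mem_Ico] at hi hj
    exact hinj (by simp; omega) (by simp; omega) h
end

lemma upoint {k g : ℕ} (hg : g + 3 ≤ k) : ∃ b s h : ℂ[X], b.natDegree ≤ k ∧ s.natDegree = k - g - 1 ∧
    s.Separable ∧ h.natDegree ≤ 2 * g + 2 ∧ CU k (zt k) b (-(h * s ^ 2)) := by
  obtain ⟨γ, β, K₁, K₂, H⟩ := exists_GB (k := k) (by omega)
  obtain ⟨q, s, h1, h2, h3, h4⟩ := H.udfac hg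
  refine ⟨ub k γ β, s, -(q ^ 2), ub_deg, h3, h4, ?_, ?_⟩
  · rw [natDegree_neg]; exact natDegree_pow_le.trans (by omega)
  · have : -(-(q ^ 2) * s ^ 2) = ud k γ β ^ 2 := by rw [h1]; ring
    rw [this]; exact H.CU
end Polynomial.PN

namespace Polynomial.PN
open NC Filter Topology

section UB
variable {α : Type*}

lemma eval_range {p : ℝ[X]} {d : ℕ} (h : p.natDegree ≤ d) (x : ℝ) :
    p.eval x = ∑ n ∈ Finset.range (d + 1), p.coeff n * x ^ n :=
  eval_eq_sum_range' (by omega) x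

lemma tendsto_eval {l : Filter α} {G : α → ℝ[X]} {G0 : ℝ[X]} {d : ℕ} {x : α → ℝ} {x0 : ℝ}
    (hd : ∀ᶠ ν in l, (G ν).natDegree ≤ d) (hd0 : G0.natDegree ≤ d)
    (ht : ∀ n, Tendsto (fun ν => (G ν).coeff n) l (𝓝 (G0.coeff n))) (hx : Tendsto x l (𝓝 x0)) :
    Tendsto (fun ν => (G ν).eval (x ν)) l (𝓝 (G0.eval x0)) := by
  rw [eval_range hd0]
  have : Tendsto (fun ν => ∑ n ∈ Finset.range (d + 1), (G ν).coeff n * x ν ^ n) l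
      (𝓝 (∑ n ∈ Finset.range (d + 1), G0.coeff n * x0 ^ n)) :=
    tendsto_finsetSum _ (fun n _ => (ht n).mul (hx.pow n))
  refine this.congr' ?_
  filter_upwards [hd] with ν hν
  rw [eval_range hν]

lemma lim_deg {l : Filter α} [l.NeBot] {G : α → ℝ[X]} {G0 : ℝ[X]} {d : ℕ}
    (hd : ∀ᶠ ν in l, (G ν).natDegree ≤ d)
    (ht : ∀ n, Tendsto (fun ν => (G ν).coeff n) l (𝓝 (G0.coeff n))) : G0.natDegree ≤ d := by
  rw [natDegree_le_iff_coeff_eq_zero]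
  intro N hN
  have h1 : Tendsto (fun ν => (G ν).coeff N) l (𝓝 0) := by
    refine tendsto_const_nhds.congr' ?_
    filter_upwards [hd] with ν hν
    exact (coeff_eq_zero_of_natDegree_lt (by omega)).symm
  exact tendsto_nhds_unique (ht N) h1

lemma ultra_lim {U : Ultrafilter α} {x : α → ℝ} (h : ∀ᶠ ν in (U : Filter α), |x ν| ≤ 1) :
    ∃ x0, Tendsto x U (𝓝 x0) := by
  have hc : IsCompact (Set.Icc (-1 : ℝ) 1) := isCompact_Icc
  obtain ⟨x0, _, h0⟩ := hc.ultrafilter_le_nhds (U.map x) (by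
    rw [le_principal_iff, Ultrafilter.coe_map, mem_map]
    filter_upwards [h] with ν hν
    exact abs_le.1 hν)
  exact ⟨x0, h0⟩

lemma ub_ultra (U : Ultrafilter α) (c : ℕ) : ∀ (d : ℕ) (G : α → ℝ[X]) (G0 : ℝ[X]), G0 ≠ 0 →
    (∀ᶠ ν in (U : Filter α), (G ν).natDegree ≤ d) →
    (∀ n, Tendsto (fun ν => (G ν).coeff n) U (𝓝 (G0.coeff n))) →
    (∀ᶠ ν in (U : Filter α), c ≤ Multiset.card (G ν).roots) →
    c ≤ Multiset.card G0.roots + (d - G0.natDegree) := by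
  induction c with
  | zero => intros; omega
  | succ c ih =>
    intro d G G0 h0 hd ht hc
    have hd0 := lim_deg hd ht
    have hex : ∀ ν, ∃ x : ℝ, (G ν).roots ≠ 0 → x ∈ (G ν).roots := by
      intro ν
      by_cases h : (G ν).roots = 0
      · exact ⟨0, fun h' => absurd h h'⟩
      · obtain ⟨x, hx⟩ := Multiset.exists_mem_of_ne_zero h; exact ⟨x, fun _ => hx⟩
    choose x hx using hex
    have hx' : ∀ᶠ ν in (U : Filter α), x ν ∈ (G ν).roots := by
      filter_upwards [hc] with ν hν
      apply hx
      intro h; rw [h] at hν; simp at hν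
    have hd1 : 1 ≤ d := by
      obtain ⟨ν, h1, h2⟩ := (hd.and hc).exists
      have := card_roots' (G ν); omega
    set Q : α → ℝ[X] := fun ν => G ν /ₘ (X - C (x ν)) with hQ
    have hGQ : ∀ᶠ ν in (U : Filter α), G ν = (X - C (x ν)) * Q ν := by
      filter_upwards [hx'] with ν hν
      exact (mul_divByMonic_eq_iff_isRoot.2 (isRoot_of_mem_roots hν)).symm
    have hQ0 : ∀ᶠ ν in (U : Filter α), Q ν ≠ 0 := by
      filter_upwards [hx', hGQ] with ν h1 h2 h3
      rw [h3, mul_zero] at h2; rw [h2] at h1; simp at h1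
    have hQd : ∀ᶠ ν in (U : Filter α), (Q ν).natDegree ≤ d - 1 := by
      filter_upwards [hGQ, hQ0, hd] with ν h1 h2 h3
      rw [h1, natDegree_mul (X_sub_C_ne_zero _) h2, natDegree_X_sub_C] at h3; omega
    have hQc : ∀ᶠ ν in (U : Filter α), c ≤ Multiset.card (Q ν).roots := by
      filter_upwards [hGQ, hQ0, hc] with ν h1 h2 h3
      rw [h1, roots_mul (mul_ne_zero (X_sub_C_ne_zero _) h2), roots_X_sub_C] at h3
      simp at h3; omega
    rcases U.eventually_or.1 (Eventually.of_forall (fun ν => le_or_gt |x ν| 1)) with hle | hgt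
    · obtain ⟨x0, hx0⟩ := ultra_lim hle
      have hroot : G0.eval x0 = 0 := by
        refine tendsto_nhds_unique (tendsto_eval hd hd0 ht hx0) ?_
        refine tendsto_const_nhds.congr' ?_
        filter_upwards [hx'] with ν hν
        exact (isRoot_of_mem_roots hν).symm
      set Q0 := G0 /ₘ (X - C x0)
      have hG0 : G0 = (X - C x0) * Q0 := (mul_divByMonic_eq_iff_isRoot.2 hroot).symm
      have hQ00 : Q0 ≠ 0 := by intro h; rw [h, mul_zero] at hG0; exact h0 hG0
      have cf : ∀ (p : ℝ[X]) (a : ℝ) (n : ℕ), p.natDegree ≤ d → (p /ₘ (X - C a)).coeff n =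
          ∑ i ∈ Finset.Icc (n + 1) d, a ^ (i - (n + 1)) * p.coeff i := by
        intro p a n hp
        rw [coeff_divByMonic_X_sub_C]
        apply Finset.sum_subset (Finset.Icc_subset_Icc_right hp)
        intro i h1 h2
        rw [Finset.mem_Icc] at h1 h2
        rw [coeff_eq_zero_of_natDegree_lt (by omega), mul_zero]
      have := ih (d - 1) Q Q0 hQ00 hQd (by
        intro n
        rw [cf _ _ _ hd0]
        have : Tendsto (fun ν => ∑ i ∈ Finset.Icc (n + 1) d, x ν ^ (i - (n + 1)) * (G ν).coeff i) U
            (𝓝 (∑ i ∈ Finset.Icc (n + 1) d, x0 ^ (i - (n + 1)) * G0.coeff i)) :=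
          tendsto_finsetSum _ (fun i _ => (hx0.pow _).mul (ht i))
        refine this.congr' ?_
        filter_upwards [hd] with ν hν
        rw [hQ]; exact (cf _ _ _ hν).symm) hQc
      rw [hG0, roots_mul (mul_ne_zero (X_sub_C_ne_zero _) hQ00), roots_X_sub_C, natDegree_mul (X_sub_C_ne_zero _) hQ00,
        natDegree_X_sub_C]
      simp; omega
    · set t : α → ℝ := fun ν => (x ν)⁻¹ with htd
      have ht1 : ∀ᶠ ν in (U : Filter α), |t ν| ≤ 1 := by
        filter_upwards [hgt] with ν hν
        rw [htd, abs_inv]; exact inv_le_one_of_one_le₀ hν.le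
      obtain ⟨t0, ht0⟩ := ultra_lim ht1
      set Q' : α → ℝ[X] := fun ν => C (-x ν) * Q ν with hQ'
      have hG' : ∀ᶠ ν in (U : Filter α), G ν = Q' ν - C (t ν) * (X * Q' ν) := by
        filter_upwards [hGQ, hgt] with ν h1 h2
        have hx0 : x ν ≠ 0 := by intro h; rw [h] at h2; simp at h2; linarith
        have h3 : C (t ν) * C (x ν) = 1 := by rw [← C_mul, htd]; simp [hx0]
        rw [h1, hQ']
        simp only [C_neg]
        linear_combination -(X * Q ν) * h3
      let q0 : ℕ → ℝ := fun n => Nat.rec (G0.coeff 0) (fun n q => G0.coeff (n + 1) + t0 * q) n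
      have hq : ∀ n, Tendsto (fun ν => (Q' ν).coeff n) U (𝓝 (q0 n)) := by
        intro n
        induction n with
        | zero =>
          refine (ht 0).congr' ?_
          filter_upwards [hG'] with ν hν
          conv_lhs => rw [hν]
          simp
        | succ n ihn =>
          refine ((ht (n + 1)).add (ht0.mul ihn)).congr' ?_
          filter_upwards [hG'] with ν hν
          have := congrArg (coeff · (n + 1)) hν
          simp only [coeff_sub, coeff_C_mul, coeff_X_mul] at this
          linarith
      have hx0 : ∀ᶠ ν in (U : Filter α), x ν ≠ 0 := by
        filter_upwards [hgt] with ν h2 h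
        rw [h] at h2; simp at h2; linarith
      have hq0 : ∀ n, d ≤ n → q0 n = 0 := by
        intro n hn
        refine tendsto_nhds_unique (hq n) ?_
        refine tendsto_const_nhds.congr' ?_
        filter_upwards [hQd] with ν hν
        rw [hQ', coeff_C_mul, coeff_eq_zero_of_natDegree_lt (by omega), mul_zero]
      let Q0 : ℝ[X] := ∑ n ∈ Finset.range d, monomial n (q0 n)
      have hQ0c : ∀ n, Q0.coeff n = q0 n := by
        intro n
        simp only [Q0, finsetSum_coeff, coeff_monomial]
        rw [Finset.sum_ite_eq' (Finset.range d) n]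
        split_ifs with h
        · rfl
        · exact (hq0 n (by simpa using h)).symm
      have hG0 : G0 = (1 - C t0 * X) * Q0 := by
        ext n
        rw [sub_mul, one_mul, coeff_sub, mul_assoc, coeff_C_mul]
        cases n with
        | zero => simp [hQ0c, q0]
        | succ n => rw [coeff_X_mul, hQ0c, hQ0c]; simp [q0]
      have hQ00 : Q0 ≠ 0 := by intro h; rw [h, mul_zero] at hG0; exact h0 hG0
      have hQ0d : Q0.natDegree ≤ d - 1 := by
        rw [natDegree_le_iff_coeff_eq_zero]
        intro N hN; rw [hQ0c]; exact hq0 N (by omega)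
      have := ih (d - 1) Q' Q0 hQ00 (by
        filter_upwards [hQd] with ν hν
        exact (natDegree_C_mul_le _ _).trans hν) (by intro n; rw [hQ0c]; exact hq n) (by
        filter_upwards [hQc, hx0] with ν h1 h2
        rw [hQ', roots_C_mul _ (neg_ne_zero.2 h2)]; exact h1)
      by_cases hz : t0 = 0
      · have : G0 = Q0 := by rw [hG0, hz]; simp
        rw [this]; omega
      · have e1 : (1 - C t0 * X : ℝ[X]) = C (-t0) * (X - C t0⁻¹) := by
          rw [mul_sub, ← C_mul]; simp [hz]; ring
        have e2 : G0 = C (-t0) * ((X - C t0⁻¹) * Q0) := by rw [hG0, e1, mul_assoc]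
        rw [e2, roots_C_mul _ (neg_ne_zero.2 hz), natDegree_C_mul (neg_ne_zero.2 hz),
          roots_mul (mul_ne_zero (X_sub_C_ne_zero _) hQ00), roots_X_sub_C, natDegree_mul (X_sub_C_ne_zero _) hQ00,
          natDegree_X_sub_C]
        simp; omega

lemma ub_roots {l : Filter α} {G : α → ℝ[X]} {G0 : ℝ[X]} {d : ℕ} (h0 : G0 ≠ 0)
    (hd : ∀ᶠ ν in l, (G ν).natDegree ≤ d)
    (ht : ∀ n, Tendsto (fun ν => (G ν).coeff n) l (𝓝 (G0.coeff n))) :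
    ∀ᶠ ν in l, Multiset.card (G ν).roots ≤ Multiset.card G0.roots + (d - G0.natDegree) := by
  by_contra hc
  rw [not_eventually] at hc
  have hne := frequently_iff_neBot.1 hc
  obtain ⟨U, hU⟩ := @Ultrafilter.exists_le _ _ hne
  have h1 : (U : Filter α) ≤ l := hU.trans inf_le_left
  have h2 := le_principal_iff.1 (hU.trans inf_le_right)
  have := ub_ultra U (Multiset.card G0.roots + (d - G0.natDegree) + 1) d G G0 h0 (hd.filter_mono h1)
    (fun n => (ht n).mono_left h1) (by
      filter_upwards [h2] with ν hν
      have : ¬ ((G ν).roots.card ≤ G0.roots.card + (d - G0.natDegree)) := hν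
      omega)
  omega

lemma lb_roots {l : Filter α} {ι : Type*} [Fintype ι] {G : α → ℝ[X]} (F : ι → Filter ℝ)
    (hF : Pairwise (Function.onFun Disjoint F))
    (h : ∀ i, ∀ U ∈ F i, ∀ᶠ ν in l, ∃ x ∈ U, (G ν).eval x = 0) (h0 : ∀ᶠ ν in l, G ν ≠ 0) :
    ∀ᶠ ν in l, Fintype.card ι ≤ (G ν).roots.toFinset.card := by
  obtain ⟨s, hs, hd⟩ := hF.exists_mem_filter_of_disjoint
  have : ∀ᶠ ν in l, ∀ i, ∃ x ∈ s i, (G ν).eval x = 0 := by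
    rw [eventually_all]; exact fun i => h i _ (hs i)
  filter_upwards [this, h0] with ν hν hν0
  choose x hx hx0 using hν
  rw [← Finset.card_univ]
  refine Finset.card_le_card_of_injOn x ?_ ?_
  · intro i _
    simp only [Finset.mem_coe, Multiset.mem_toFinset]
    exact (mem_roots hν0).2 (hx0 i)
  · intro i _ j _ hij
    by_contra hne
    have := hd hne
    exact Set.disjoint_left.1 this (hx i) (hij ▸ hx j)
end UB
end Polynomial.PN

namespace Polynomial.PN
open NC Filter Topology

lemma ivt {p : ℝ[X]} {a b : ℝ} (hab : a ≤ b) (h : p.eval a * p.eval b < 0) :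
    ∃ x ∈ Set.Ioo a b, p.eval x = 0 := by
  have hc : ContinuousOn (fun x => p.eval x) (Set.Icc a b) := p.continuous.continuousOn
  rcases mul_neg_iff.1 h with ⟨h1, h2⟩ | ⟨h1, h2⟩
  · obtain ⟨x, hx, h0⟩ := intermediate_value_Ioo' hab hc ⟨h2, h1⟩
    exact ⟨x, hx, h0⟩
  · obtain ⟨x, hx, h0⟩ := intermediate_value_Ioo hab hc ⟨h1, h2⟩
    exact ⟨x, hx, h0⟩

section tg
variable {α : Type*} {l : Filter α} {G : α → ℝ[X]} {G0 : ℝ[X]}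
  (hE : ∀ x, Tendsto (fun ν => (G ν).eval x) l (𝓝 (G0.eval x)))
include hE

lemma tg_simple {r : ℝ} (h0 : G0.eval r = 0) (h1 : (derivative G0).eval r ≠ 0) :
    ∀ U ∈ 𝓝 r, ∀ᶠ ν in l, ∃ x ∈ U, (G ν).eval x = 0 := by
  intro U hU
  set Q := G0 /ₘ (X - C r)
  have hG0 : G0 = (X - C r) * Q := (mul_divByMonic_eq_iff_isRoot.2 h0).symm
  have hQ : Q.eval r ≠ 0 := by
    rw [hG0] at h1
    simpa using h1
  have h2 : ∀ᶠ x in 𝓝 r, 0 < Q.eval x * Q.eval r := by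
    have : Tendsto (fun x => Q.eval x * Q.eval r) (𝓝 r) (𝓝 (Q.eval r * Q.eval r)) :=
      (Q.continuous.tendsto r).mul_const _
    exact this.eventually_const_lt (mul_self_pos.2 hQ)
  obtain ⟨ε, hε, hb⟩ := Metric.eventually_nhds_iff.1 (h2.and hU)
  have ha := hb (y := r - ε / 2) (by rw [Real.dist_eq]; rw [abs_lt]; constructor <;> linarith)
  have hb' := hb (y := r + ε / 2) (by rw [Real.dist_eq]; rw [abs_lt]; constructor <;> linarith)
  have hs : G0.eval (r - ε / 2) * G0.eval (r + ε / 2) < 0 := by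
    have hq : 0 < Q.eval (r - ε / 2) * Q.eval (r + ε / 2) := by
      have h3 := mul_pos ha.1 hb'.1
      have h4 := mul_self_pos.2 hQ
      have : 0 < (Q.eval (r - ε / 2) * Q.eval (r + ε / 2)) * (Q.eval r * Q.eval r) := by linarith
      exact (pos_iff_pos_of_mul_pos this).2 h4
    rw [hG0]; simp only [eval_mul, eval_sub, eval_X, eval_C]
    have : 0 < ε / 2 * (ε / 2) := by positivity
    nlinarith [mul_pos this hq]
  have ht := ((hE (r - ε / 2)).mul (hE (r + ε / 2))).eventually_lt_const hs
  filter_upwards [ht] with ν hν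
  obtain ⟨x, hx, h⟩ := ivt (by linarith) hν
  refine ⟨x, (hb (y := x) ?_).2, h⟩
  rw [Real.dist_eq, abs_lt]; constructor <;> linarith [hx.1, hx.2]

lemma tg_right (h0 : ∀ᶠ x in 𝓝[>] (0:ℝ), 0 < G0.eval x) (h1 : ∀ᶠ ν in l, (G ν).eval 0 < 0) :
    ∀ U ∈ 𝓝[>] (0:ℝ), ∀ᶠ ν in l, ∃ x ∈ U, (G ν).eval x = 0 := by
  intro U hU
  obtain ⟨u, hu, hs⟩ := mem_nhdsGT_iff_exists_Ioo_subset.1 (h0.and hU)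
  have hu : 0 < u := hu
  have hm := hs (show u / 2 ∈ Set.Ioo 0 u from ⟨by linarith, by linarith⟩)
  filter_upwards [h1, (hE (u / 2)).eventually_const_lt hm.1] with ν h2 h3
  obtain ⟨x, hx, h⟩ := ivt (a := 0) (b := u / 2) (by linarith) (mul_neg_of_neg_of_pos h2 h3)
  exact ⟨x, (hs ⟨hx.1, by linarith [hx.2]⟩).2, h⟩

lemma tg_left (h0 : ∀ᶠ x in 𝓝[<] (0:ℝ), 0 < G0.eval x) (h1 : ∀ᶠ ν in l, (G ν).eval 0 < 0) :
    ∀ U ∈ 𝓝[<] (0:ℝ), ∀ᶠ ν in l, ∃ x ∈ U, (G ν).eval x = 0 := by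
  intro U hU
  obtain ⟨u, hu, hs⟩ := mem_nhdsLT_iff_exists_Ioo_subset.1 (h0.and hU)
  have hu : u < 0 := hu
  have hm := hs (show u / 2 ∈ Set.Ioo u 0 from ⟨by linarith, by linarith⟩)
  filter_upwards [h1, (hE (u / 2)).eventually_const_lt hm.1] with ν h2 h3
  obtain ⟨x, hx, h⟩ := ivt (a := u / 2) (b := 0) (by linarith) (mul_neg_of_pos_of_neg h3 h2)
  exact ⟨x, (hs ⟨by linarith [hx.1], hx.2⟩).2, h⟩

lemma tg_top (h0 : ∀ᶠ x in atTop, 0 < G0.eval x) (h1 : ∀ᶠ ν in l, ∀ᶠ x in atTop, (G ν).eval x < 0) :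
    ∀ U ∈ (atTop : Filter ℝ), ∀ᶠ ν in l, ∃ x ∈ U, (G ν).eval x = 0 := by
  intro U hU
  obtain ⟨u, hs⟩ := mem_atTop_sets.1 (h0.and hU)
  filter_upwards [h1, (hE u).eventually_const_lt (hs u le_rfl).1] with ν h2 h3
  obtain ⟨v, h4, h5⟩ := (h2.and (eventually_ge_atTop u)).exists
  obtain ⟨x, hx, h⟩ := ivt h5 (mul_neg_of_pos_of_neg h3 h4)
  exact ⟨x, (hs x hx.1.le).2, h⟩

lemma tg_bot (h0 : ∀ᶠ x in atBot, 0 < G0.eval x) (h1 : ∀ᶠ ν in l, ∀ᶠ x in atBot, (G ν).eval x < 0) :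
    ∀ U ∈ (atBot : Filter ℝ), ∀ᶠ ν in l, ∃ x ∈ U, (G ν).eval x = 0 := by
  intro U hU
  obtain ⟨u, hs⟩ := mem_atBot_sets.1 (h0.and hU)
  filter_upwards [h1, (hE u).eventually_const_lt (hs u le_rfl).1] with ν h2 h3
  obtain ⟨v, h4, h5⟩ := (h2.and (eventually_le_atBot u)).exists
  obtain ⟨x, hx, h⟩ := ivt h5 (mul_neg_of_neg_of_pos h4 h3)
  exact ⟨x, (hs x hx.2.le).2, h⟩
end tg

lemma sign_top {p : ℝ[X]} (h : 0 < p.leadingCoeff) : ∀ᶠ x in atTop, 0 < p.eval x := by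
  by_cases hd : 0 < p.degree
  · exact (p.tendsto_atTop_of_leadingCoeff_nonneg hd h.le).eventually_gt_atTop 0
  · rw [eq_C_of_degree_le_zero (not_lt.1 hd)] at h ⊢
    simp at h ⊢; exact ⟨0, fun _ _ => h⟩

lemma sign_bot {p : ℝ[X]} (h : 0 < p.leadingCoeff * (-1) ^ p.natDegree) : ∀ᶠ x in atBot, 0 < p.eval x := by
  have h1 : 0 < (p.comp (-X)).leadingCoeff := by
    rw [leadingCoeff_comp (by simp)]; simpa using h
  have h2 := sign_top h1
  have := tendsto_neg_atBot_atTop.eventually h2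
  simpa using this

lemma sign_top' {p : ℝ[X]} (h : p.leadingCoeff < 0) : ∀ᶠ x in atTop, p.eval x < 0 := by
  have := sign_top (p := -p) (by simpa using h)
  simpa using this

lemma sign_bot' {p : ℝ[X]} (h : p.leadingCoeff * (-1) ^ p.natDegree < 0) : ∀ᶠ x in atBot, p.eval x < 0 := by
  have := sign_bot (p := -p) (by simpa using h)
  simpa using this

/-- real-rooted with simple roots -/
structure RS (A : ℝ[X]) : Prop where
  ne : A ≠ 0
  re : ∀ z : ℂ, (cx A).eval z = 0 → z.im = 0
  si : ∀ x : ℝ, A.eval x = 0 → (derivative A).eval x ≠ 0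

lemma RS.card {A : ℝ[X]} (H : RS A) : Multiset.card A.roots = A.natDegree ∧ A.roots.Nodup := by
  constructor
  · obtain ⟨q, h1, h2, h3⟩ := exists_prod_multiset_X_sub_C_mul A
    by_contra hc
    have hq : (cx q).degree ≠ 0 := by
      rw [degree_map]; intro h
      have : q.natDegree = 0 := natDegree_eq_of_degree_eq_some h
      omega
    obtain ⟨z, hz⟩ := IsAlgClosed.exists_root (cx q) hq
    have hz' : (cx q).eval z = 0 := hz
    have hzA : (cx A).eval z = 0 := by
      rw [← h1, cx, Polynomial.map_mul, eval_mul]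
      exact mul_eq_zero_of_right _ hz'
    have hre : (z.re : ℂ) = z := Complex.ext rfl (by simp [H.re z hzA])
    rw [← hre, eval_cx_real] at hz'
    have hq0 : q ≠ 0 := by rintro rfl; rw [mul_zero] at h1; exact H.ne h1.symm
    have : z.re ∈ q.roots := (mem_roots hq0).2 (by exact_mod_cast hz')
    rw [h3] at this; simp at this
  · rw [Multiset.nodup_iff_count_le_one]
    intro x
    rw [count_roots]
    by_contra hc
    have := (one_lt_rootMultiplicity_iff_isRoot H.ne).1 (not_le.1 hc)
    exact H.si x this.1 this.2

lemma RS.card' {A : ℝ[X]} (H : RS A) : A.roots.toFinset.card = A.natDegree := by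
  rw [Multiset.toFinset_card_of_nodup H.card.2, H.card.1]

lemma norm_half {z a : ℂ} (hz : 0 < z.im) (ha : a.im < 0) : ‖starRingEnd ℂ z - a‖ < ‖z - a‖ := by
  rw [← sq_lt_sq₀ (norm_nonneg _) (norm_nonneg _), ← Complex.normSq_eq_norm_sq, ← Complex.normSq_eq_norm_sq,
    Complex.normSq_apply, Complex.normSq_apply]
  simp; nlinarith

lemma norm_prod_half {z : ℂ} (hz : 0 < z.im) (s : Multiset ℂ) (hs : ∀ a ∈ s, a.im < 0) :
    s = 0 ∨ ‖(s.map (fun a => starRingEnd ℂ z - a)).prod‖ < ‖(s.map (fun a => z - a)).prod‖ := by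
  induction s using Multiset.induction with
  | empty => left; rfl
  | cons a s ih =>
    right
    have h1 := norm_half hz (hs a (by simp))
    simp only [Multiset.map_cons, Multiset.prod_cons, norm_mul]
    rcases ih (fun b hb => hs b (by simp [hb])) with h | h
    · subst h; simpa using h1
    · exact mul_lt_mul'' h1 h (norm_nonneg _) (norm_nonneg _)

lemma HB {A : ℝ[X]} {G : ℂ[X]} (hA : ∀ x : ℝ, A.eval x = (G.eval (x : ℂ)).re) (hd : 1 ≤ G.natDegree)
    (hr : ∀ z, G.eval z = 0 → z.im < 0) : RS A := by
  have hG : G ≠ 0 := by rintro rfl; simp at hd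
  have hsp := IsAlgClosed.splits G
  have hcard := hsp.natDegree_eq_card_roots
  have hr0 : G.roots ≠ 0 := by intro h; rw [h] at hcard; simp at hcard; omega
  have hrr : ∀ a ∈ G.roots, a.im < 0 := fun a ha => hr a (isRoot_of_mem_roots ha)
  have hev : ∀ w, G.eval w = G.leadingCoeff * (G.roots.map (fun a => w - a)).prod := by
    intro w
    have := congrArg (eval w) hsp.eq_prod_roots
    rw [eval_mul, eval_C, eval_multiset_prod, Multiset.map_map] at this
    simpa using this
  have hlt : ∀ z : ℂ, 0 < z.im → ‖G.eval (starRingEnd ℂ z)‖ < ‖G.eval z‖ := by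
    intro z hz
    rw [hev, hev, norm_mul, norm_mul]
    exact mul_lt_mul_of_pos_left ((norm_prod_half hz _ hrr).resolve_left hr0)
      (norm_pos_iff.2 (leadingCoeff_ne_zero.2 hG))
  have hcx : ∀ z, 2 * (cx A).eval z = G.eval z + starRingEnd ℂ (G.eval (starRingEnd ℂ z)) := by
    have hp : C 2 * cx A = G + G.map (starRingEnd ℂ) := by
      apply Polynomial.eq_of_infinite_eval_eq
      apply Set.Infinite.mono (s := Set.range (fun x : ℝ => (x : ℂ)))
      · rintro _ ⟨x, rfl⟩
        show eval (x : ℂ) _ = eval (x : ℂ) _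
        rw [eval_mul, eval_C, eval_cx_real, hA, eval_add]
        have : (G.map (starRingEnd ℂ)).eval (x : ℂ) = starRingEnd ℂ (G.eval (x : ℂ)) := by
          conv_lhs => rw [← Complex.conj_ofReal x]
          rw [eval_map_apply]
        rw [this, Complex.add_conj]; push_cast; ring
      · exact Set.infinite_range_of_injective Complex.ofReal_injective
    intro z
    have := congrArg (eval z) hp
    rw [eval_mul, eval_C, eval_add] at this
    rw [this]
    congr 1
    conv_lhs => rw [← Complex.conj_conj z]
    rw [eval_map_apply]
  have hne : ∀ z : ℂ, 0 < z.im → (cx A).eval z ≠ 0 := by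
    intro z hz h0
    have h1 := hcx z
    rw [h0, mul_zero] at h1
    have h2 := hlt z hz
    have h3 : G.eval z = - starRingEnd ℂ (G.eval (starRingEnd ℂ z)) := by linear_combination -h1
    rw [h3, norm_neg, Complex.norm_conj] at h2
    exact lt_irrefl _ h2
  refine ⟨?_, ?_, ?_⟩
  · rintro rfl
    exact hne Complex.I (by simp) (by simp [cx])
  · intro z hz
    rcases lt_trichotomy z.im 0 with h | h | h
    · exfalso
      refine hne (starRingEnd ℂ z) (by simpa using h) ?_
      rw [eval_cx_conj, hz, map_zero]
    · exact h
    · exact absurd hz (hne z h)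
  · intro x h0 h1
    have hGx : G.eval (x : ℂ) ≠ 0 := by
      intro h; have := hr _ h; simp at this
    have e1 : (G.eval (x : ℂ)).re = 0 := by rw [← hA, h0]
    have e2 : ((derivative G).eval (x : ℂ)).re = 0 := by
      have d1 : HasDerivAt (fun x : ℝ => A.eval x) ((derivative A).eval x) x := A.hasDerivAt x
      have d2 : HasDerivAt (fun x : ℝ => (G.eval (x : ℂ)).re) ((derivative G).eval (x : ℂ)).re x :=
        (G.hasDerivAt (x : ℂ)).real_of_complex
      have : (fun x : ℝ => A.eval x) = fun x : ℝ => (G.eval (x : ℂ)).re := _root_.funext hA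
      rw [this] at d1
      rw [← h1]; exact d2.unique d1
    have e3 := hsp.eval_derivative_div_eval_of_ne_zero hGx
    have e4 : ((derivative G).eval (x : ℂ) / G.eval (x : ℂ)).im = 0 := by
      rw [Complex.div_im, e1, e2]; ring
    rw [e3] at e4
    have key : ∀ s : Multiset ℂ, (∀ a ∈ s, a.im < 0) → s = 0 ∨ ((s.map (fun a => 1 / ((x : ℂ) - a))).sum).im < 0 := by
      intro s
      induction s using Multiset.induction with
      | empty => intro _; left; rfl
      | cons a s ih =>
        intro hs
        right
        have ha := hs a (by simp)
        have h1 : (1 / ((x : ℂ) - a)).im < 0 := by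
          rw [one_div, Complex.inv_im]
          have hne : (x : ℂ) - a ≠ 0 := by
            intro h
            have : a = x := by linear_combination -h
            rw [this] at ha; simp at ha
          have := Complex.normSq_pos.2 hne
          apply div_neg_of_neg_of_pos _ this
          simpa using ha
        rw [Multiset.map_cons, Multiset.sum_cons, Complex.add_im]
        rcases ih (fun b hb => hs b (by simp [hb])) with h | h
        · subst h; simpa using h1
        · linarith
    have := (key G.roots hrr).resolve_left hr0
    linarith
end Polynomial.PN

namespace Polynomial.PN
open NC Filter Topology

/-- coefficientwise continuous family -/
def CP (G : ℝ → ℝ[X]) : Prop := ∀ n, Continuous (fun ν => (G ν).coeff n)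

lemma CP.const (p : ℝ[X]) : CP (fun _ => p) := fun _ => continuous_const
lemma CP.add {F G : ℝ → ℝ[X]} (hF : CP F) (hG : CP G) : CP (fun ν => F ν + G ν) := by
  intro n; simp only [coeff_add]; exact (hF n).add (hG n)
lemma CP.sub {F G : ℝ → ℝ[X]} (hF : CP F) (hG : CP G) : CP (fun ν => F ν - G ν) := by
  intro n; simp only [coeff_sub]; exact (hF n).sub (hG n)
lemma CP.neg {F : ℝ → ℝ[X]} (hF : CP F) : CP (fun ν => -F ν) := by
  intro n; simp only [coeff_neg]; exact (hF n).neg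
lemma CP.mul {F G : ℝ → ℝ[X]} (hF : CP F) (hG : CP G) : CP (fun ν => F ν * G ν) := by
  intro n; simp only [coeff_mul]
  exact continuous_finsetSum _ (fun i _ => (hF _).mul (hG _))
lemma CP.pow {F : ℝ → ℝ[X]} (hF : CP F) (m : ℕ) : CP (fun ν => F ν ^ m) := by
  induction m with
  | zero => simpa using CP.const 1
  | succ m ih => simp only [pow_succ]; exact ih.mul hF
lemma CP.C {f : ℝ → ℝ} (hf : Continuous f) : CP (fun ν => Polynomial.C (f ν)) := by
  intro n; simp only [coeff_C]
  split_ifs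
  · exact hf
  · exact continuous_const
lemma CP.sn {F : ℝ → ℝ[X]} (hF : CP F) (θ : ℝ) : CP (fun ν => PN.sn θ (F ν)) := by
  intro n; simp only [sn_coeff]; exact (hF n).mul continuous_const
lemma CP.cs {F : ℝ → ℝ[X]} (hF : CP F) (θ : ℝ) : CP (fun ν => PN.cs θ (F ν)) := by
  intro n; simp only [cs_coeff]; exact (hF n).mul continuous_const
lemma CP.sh {F : ℝ → ℝ[X]} (hF : CP F) (θ : ℝ) : CP (fun ν => PN.sh θ (F ν)) := by
  intro n; simp only [sh_coeff]; exact (hF _).mul continuous_const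
lemma CP.Fl {b e : ℝ → ℝ[X]} (hb : CP b) (he : CP e) (θ : ℝ) : CP (fun ν => PN.Fl θ (b ν) (e ν)) := by
  unfold PN.Fl
  exact (((CP.const _).mul ((hb.sh θ).pow 4)).add (((CP.const _).mul (he.cs θ)).mul ((hb.sh θ).pow 2))).sub ((he.sh θ).pow 2)

noncomputable def twc (φ : ℂ → ℝ) (p : ℂ[X]) : ℝ[X] := ∑ n ∈ p.support, monomial n (φ (p.coeff n))
lemma twc_coeff {φ : ℂ → ℝ} (h0 : φ 0 = 0) (p : ℂ[X]) (n : ℕ) : (twc φ p).coeff n = φ (p.coeff n) := by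
  simp only [twc, finsetSum_coeff, coeff_monomial]
  rw [Finset.sum_ite_eq' p.support n]
  split_ifs with h
  · rfl
  · rw [notMem_support_iff.1 h, h0]
noncomputable def reP (p : ℂ[X]) : ℝ[X] := twc Complex.re p
noncomputable def imP (p : ℂ[X]) : ℝ[X] := twc Complex.im p
lemma reP_imP (p : ℂ[X]) : cx (reP p) + C Complex.I * cx (imP p) = p := by
  ext n
  simp only [cx, coeff_add, coeff_map, coeff_C_mul, reP, imP]
  rw [twc_coeff (by simp), twc_coeff (by simp)]
  simp only [Complex.coe_algebraMap]
  rw [mul_comm]; exact Complex.re_add_im _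
lemma reP_deg {p : ℂ[X]} {n : ℕ} (h : p.natDegree ≤ n) : (reP p).natDegree ≤ n := by
  rw [natDegree_le_iff_coeff_eq_zero] at *
  intro N hN; rw [reP, twc_coeff (by simp), h N hN]; simp
lemma imP_deg {p : ℂ[X]} {n : ℕ} (h : p.natDegree ≤ n) : (imP p).natDegree ≤ n := by
  rw [natDegree_le_iff_coeff_eq_zero] at *
  intro N hN; rw [imP, twc_coeff (by simp), h N hN]; simp

/-- a real polynomial seen as a family constant in the parameter -/
noncomputable abbrev lf (p : ℝ[X]) : ℂ[X][X] := (cx p).map Polynomial.C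
lemma lf_map (p : ℝ[X]) (ν : ℂ) : (lf p).map (evalRingHom ν) = cx p := by
  rw [lf, Polynomial.map_map]
  have : (evalRingHom ν).comp (Polynomial.C : ℂ →+* ℂ[X]) = RingHom.id ℂ := by ext; simp
  rw [this, Polynomial.map_id]
lemma lf_deg {p : ℝ[X]} {n : ℕ} (h : p.natDegree ≤ n) : (lf p).natDegree ≤ n :=
  natDegree_map_le.trans (natDegree_map_le.trans h)

lemma add_deg {A : Type*} [CommRing A] {p q : A[X]} {n : ℕ} (hp : p.natDegree ≤ n) (hq : q.natDegree ≤ n) : (p + q).natDegree ≤ n :=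
  natDegree_add_le_of_degree_le hp hq
lemma sub_deg {A : Type*} [CommRing A] {p q : A[X]} {n : ℕ} (hp : p.natDegree ≤ n) (hq : q.natDegree ≤ n) : (p - q).natDegree ≤ n :=
  (natDegree_sub_le_of_le hp hq).trans (by simp)
lemma Cmul_deg {A : Type*} [CommRing A] {p : A[X]} {c : A} {n : ℕ} (hp : p.natDegree ≤ n) : (C c * p).natDegree ≤ n :=
  (natDegree_C_mul_le _ _).trans hp

lemma finite_real {P : ℂ → Prop} (h : {ν : ℂ | P ν}.Finite) : {ν : ℝ | P (ν : ℂ)}.Finite :=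
  Set.Finite.preimage (Complex.ofReal_injective.injOn) h

/-- value at parameter value ν of the quartic family -/
noncomputable def fam (p0 p1 p2 p3 p4 : ℝ[X]) : ℂ[X][X] :=
  lf p0 + C X * lf p1 + C (X ^ 2) * lf p2 + C (X ^ 3) * lf p3 + C (X ^ 4) * lf p4
lemma fam_map (p0 p1 p2 p3 p4 : ℝ[X]) (ν : ℂ) : (fam p0 p1 p2 p3 p4).map (evalRingHom ν) =
    cx p0 + C ν * cx p1 + C (ν ^ 2) * cx p2 + C (ν ^ 3) * cx p3 + C (ν ^ 4) * cx p4 := by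
  simp only [fam, Polynomial.map_add, Polynomial.map_mul, map_C, lf_map, coe_evalRingHom, eval_pow, eval_X]
lemma fam_real (p0 p1 p2 p3 p4 : ℝ[X]) (ν : ℝ) : (fam p0 p1 p2 p3 p4).map (evalRingHom (ν : ℂ)) =
    cx (p0 + C ν * p1 + C (ν ^ 2) * (p2 + C ν * p3 + C (ν ^ 2) * p4)) := by
  rw [fam_map]
  simp only [cx, Polynomial.map_add, Polynomial.map_mul, map_C, Complex.coe_algebraMap, Complex.ofReal_pow, C_pow, Polynomial.map_pow]
  ring
lemma fam_deg {p0 p1 p2 p3 p4 : ℝ[X]} {n : ℕ} (h0 : p0.natDegree ≤ n) (h1 : p1.natDegree ≤ n) (h2 : p2.natDegree ≤ n)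
    (h3 : p3.natDegree ≤ n) (h4 : p4.natDegree ≤ n) : (fam p0 p1 p2 p3 p4).natDegree ≤ n :=
  add_deg (add_deg (add_deg (add_deg (lf_deg h0) (Cmul_deg (lf_deg h1))) (Cmul_deg (lf_deg h2))) (Cmul_deg (lf_deg h3))) (Cmul_deg (lf_deg h4))

lemma tail_CP (p2 p3 p4 : ℝ[X]) : CP (fun ν => p2 + C ν * p3 + C (ν ^ 2) * p4) :=
  ((CP.const _).add ((CP.C continuous_id).mul (CP.const _))).add ((CP.C (continuous_id.pow 2)).mul (CP.const _))

lemma family {k g : ℕ} (hg : g + 3 ≤ k) {b0 s0 h0 s1 h1 : ℝ[X]} (hb0 : b0.natDegree ≤ k)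
    (hs0 : s0.natDegree ≤ k - g - 1) (hs1 : s1.natDegree ≤ k - g - 1)
    (hh0 : h0.natDegree ≤ 2 * g + 2) (hh1 : h1.natDegree ≤ 2 * g + 2) :
    ∃ b2 s2 h2 : ℝ → ℝ[X], CP b2 ∧ CP s2 ∧ CP h2 ∧ (∀ ν, (s2 ν).natDegree ≤ k - g - 1) ∧
      (∀ ν, (h2 ν).natDegree ≤ 2 * g + 2) ∧
      {ν : ℝ | ¬ (CU k (zt k) (cx (b0 + C (ν ^ 2) * b2 ν))
          (cx (-((h0 + C ν * h1 + C (ν ^ 2) * h2 ν) * (s0 + C ν * s1 + C (ν ^ 2) * s2 ν) ^ 2))) ∧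
        (cx (s0 + C ν * s1 + C (ν ^ 2) * s2 ν)).Separable ∧
        (s0 + C ν * s1 + C (ν ^ 2) * s2 ν).natDegree = k - g - 1 ∧
        (cx (h0 + C ν * h1 + C (ν ^ 2) * h2 ν)).Separable ∧
        (h0 + C ν * h1 + C (ν ^ 2) * h2 ν).natDegree = 2 * g + 2)}.Finite := by
  obtain ⟨bu, su, hu, hbu, hsu, hsus, hhu, HU⟩ := upoint hg
  -- second and higher order coefficients
  set bA := b0 - reP bu with hbA
  set bB := - imP bu with hbB
  set sA := s0 - reP su with hsA
  set sB := s1 - imP su with hsB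
  set hA := h0 - reP hu with hhA
  set hB := h1 - imP hu with hhB
  set hC := C (1 / 2) * (X ^ (2 * g + 2) + 1 - h0 - h1 - hA - hB) with hhC
  have dbA : bA.natDegree ≤ k := sub_deg hb0 (reP_deg hbu)
  have dbB : bB.natDegree ≤ k := by rw [hbB, natDegree_neg]; exact imP_deg hbu
  have dsA : sA.natDegree ≤ k - g - 1 := sub_deg hs0 (reP_deg hsu.le)
  have dsB : sB.natDegree ≤ k - g - 1 := sub_deg hs1 (imP_deg hsu.le)
  have dhA : hA.natDegree ≤ 2 * g + 2 := sub_deg hh0 (reP_deg hhu)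
  have dhB : hB.natDegree ≤ 2 * g + 2 := sub_deg hh1 (imP_deg hhu)
  have dhC : hC.natDegree ≤ 2 * g + 2 := by
    refine Cmul_deg (sub_deg (sub_deg (sub_deg (sub_deg (add_deg ?_ ?_) hh0) hh1) dhA) dhB)
    · simp
    · simp
  have z0 : ∀ n : ℕ, (0 : ℝ[X]).natDegree ≤ n := fun n => by simp
  let Fb := fam b0 0 bA bB 0
  let Fs := fam s0 s1 sA sB 0
  let Fh := fam h0 h1 (hA + hC) hB hC
  have DFb : Fb.natDegree ≤ k := fam_deg hb0 (z0 _) dbA dbB (z0 _)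
  have DFs : Fs.natDegree ≤ k - g - 1 := fam_deg hs0 hs1 dsA dsB (z0 _)
  have DFh : Fh.natDegree ≤ 2 * g + 2 := fam_deg hh0 hh1 (add_deg dhA dhC) dhB dhC
  have I3 : Complex.I ^ 3 = -Complex.I := by rw [pow_succ, Complex.I_sq]; ring
  have I4 : Complex.I ^ 4 = 1 := Complex.I_pow_four
  have EFb : Fb.map (evalRingHom Complex.I) = bu := by
    rw [fam_map, Complex.I_sq, I3, I4, hbA, hbB]
    conv_rhs => rw [← reP_imP bu]
    simp only [cx, Polynomial.map_sub, Polynomial.map_neg, Polynomial.map_zero, C_neg, C_1]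
    ring
  have EFs : Fs.map (evalRingHom Complex.I) = su := by
    rw [fam_map, Complex.I_sq, I3, I4, hsA, hsB]
    conv_rhs => rw [← reP_imP su]
    simp only [cx, Polynomial.map_sub, Polynomial.map_zero, C_neg, C_1]
    ring
  have EFh : Fh.map (evalRingHom Complex.I) = hu := by
    rw [fam_map, Complex.I_sq, I3, I4, hhA, hhB]
    conv_rhs => rw [← reP_imP hu]
    simp only [cx, Polynomial.map_sub, Polynomial.map_add, C_neg, C_1]
    ring
  have EFh1 : Fh.map (evalRingHom 1) = X ^ (2 * g + 2) + 1 := by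
    have h2 : (C (1 / 2 : ℝ) : ℝ[X]) * 2 = 1 := by
      rw [show (2 : ℝ[X]) = C 2 from rfl, ← C_mul]; norm_num
    have : h0 + h1 + (hA + hC) + hB + hC = X ^ (2 * g + 2) + 1 := by
      rw [hhC]; linear_combination (X ^ (2 * g + 2) + 1 - h0 - h1 - hA - hB) * h2
    rw [fam_map]
    have h3 := congrArg cx this
    simp only [cx, Polynomial.map_add, Polynomial.map_pow, map_X, Polynomial.map_one] at h3
    simp only [one_pow, C_1, one_mul, cx, Polynomial.map_add]
    exact h3
  -- the discriminant family
  let FP : ℂ[X][X] := Psi k (C (zt k)) Fb (-(Fh * Fs ^ 2))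
  have hztk : (C (zt k) : ℂ[X]) ^ k = 1 := by
    rw [← C_pow, (zt_prim (by omega)).pow_eq_one, C_1]
  have DE : (-(Fh * Fs ^ 2)).natDegree ≤ 2 * k := by
    rw [natDegree_neg]
    refine natDegree_mul_le.trans ?_
    have := natDegree_pow_le (p := Fs) (n := 2)
    omega
  have DFP : FP.natDegree ≤ 4 * (k - 1) ^ 2 := Psi_deg (by omega) DFb DE hztk
  have EFP : ∀ ν : ℂ, FP.map (evalRingHom ν) = Psi k (zt k) (Fb.map (evalRingHom ν))
      (-(Fh.map (evalRingHom ν) * Fs.map (evalRingHom ν) ^ 2)) := by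
    intro ν
    rw [Psi_map]; simp
  have G1 := generic_sep FP (4 * (k - 1) ^ 2) (by
      have : 0 < (k - 1) ^ 2 := by apply pow_pos; omega
      omega) DFP Complex.I
    (by rw [EFP, EFb, EFs, EFh]; exact HU.sep) (by rw [EFP, EFb, EFs, EFh]; exact HU.deg)
  have G2 := generic_sep Fs (k - g - 1) (by omega) DFs Complex.I (by rw [EFs]; exact hsus) (by rw [EFs]; exact hsu)
  have G3 := generic_sep Fh (2 * g + 2) (by omega) DFh 1
    (by
      rw [EFh1]
      have := (separable_X_pow_sub_C (F := ℂ) (n := 2 * g + 2) (-1) (by exact_mod_cast (by omega : 2 * g + 2 ≠ 0)) (by norm_num))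
      simpa using this)
    (by
      rw [EFh1]
      have := natDegree_X_pow_add_C (R := ℂ) (n := 2 * g + 2) (r := 1)
      simpa using this)
  have G := ((finite_real G1).union (finite_real G2)).union (finite_real G3)
  refine ⟨fun ν => bA + C ν * bB + C (ν ^ 2) * 0, fun ν => sA + C ν * sB + C (ν ^ 2) * 0,
    fun ν => (hA + hC) + C ν * hB + C (ν ^ 2) * hC, tail_CP _ _ _, tail_CP _ _ _, tail_CP _ _ _, ?_, ?_, ?_⟩
  · intro ν; exact add_deg (add_deg dsA (Cmul_deg dsB)) (Cmul_deg (z0 _))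
  · intro ν; exact add_deg (add_deg (add_deg dhA dhC) (Cmul_deg dhB)) (Cmul_deg dhC)
  refine G.subset ?_
  intro ν hν
  by_contra hc
  simp only [Set.mem_union, Set.mem_ofPred_eq, not_or, not_not] at hc
  apply hν
  obtain ⟨⟨⟨c1, c2⟩, c3, c4⟩, c5, c6⟩ := hc
  have eb : Fb.map (evalRingHom (ν : ℂ)) = cx (b0 + C (ν ^ 2) * (bA + C ν * bB + C (ν ^ 2) * 0)) := by
    have := fam_real b0 0 bA bB 0 ν
    rw [mul_zero, add_zero] at this
    exact this
  rw [EFP, eb, show Fs.map (evalRingHom (ν : ℂ)) = _ from fam_real _ _ _ _ _ ν,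
    show Fh.map (evalRingHom (ν : ℂ)) = _ from fam_real _ _ _ _ _ ν] at c1 c2
  rw [show Fs.map (evalRingHom (ν : ℂ)) = _ from fam_real _ _ _ _ _ ν] at c3 c4
  rw [show Fh.map (evalRingHom (ν : ℂ)) = _ from fam_real _ _ _ _ _ ν] at c5 c6
  have inj : Function.Injective (algebraMap ℝ ℂ) := Complex.ofReal_injective
  have dz : ∀ p : ℝ[X], (cx p).natDegree = p.natDegree := fun p => natDegree_map_eq_of_injective inj p
  refine ⟨⟨by omega, zt_prim (by omega), ?_, ?_, ?_, ?_⟩, c3, (dz _).symm.trans c4, c5, (dz _).symm.trans c6⟩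
  · rw [← eb]; exact natDegree_map_le.trans DFb
  · have : cx (-((h0 + C ν * h1 + C (ν ^ 2) * ((hA + hC) + C ν * hB + C (ν ^ 2) * hC)) * (s0 + C ν * s1 + C (ν ^ 2) * (sA + C ν * sB + C (ν ^ 2) * 0)) ^ 2))
      = (-(Fh * Fs ^ 2)).map (evalRingHom (ν : ℂ)) := by
      rw [Polynomial.map_neg, Polynomial.map_mul, Polynomial.map_pow, show Fs.map (evalRingHom (ν : ℂ)) = _ from fam_real _ _ _ _ _ ν,
        show Fh.map (evalRingHom (ν : ℂ)) = _ from fam_real _ _ _ _ _ ν, ← Polynomial.map_pow, ← Polynomial.map_mul, ← Polynomial.map_neg]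
    rw [this]
    exact natDegree_map_le.trans DE
  · rw [← Polynomial.map_pow, ← Polynomial.map_mul, ← Polynomial.map_neg] at c1
    exact c1
  · rw [← Polynomial.map_pow, ← Polynomial.map_mul, ← Polynomial.map_neg] at c2
    exact c2
end Polynomial.PN

namespace Polynomial.PN
open NC Filter Topology

lemma sc_ex (θ : ℝ) (f : ℝ[X]) : sc (ex θ) (cx f) = cx (cs θ f) + C Complex.I * cx (sn θ f) := by
  ext n
  rw [sc_coeff, coeff_add, coeff_C_mul, coeff_map, coeff_map, coeff_map, cs_coeff, sn_coeff, ex_pow]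
  simp only [Complex.coe_algebraMap]
  push_cast; ring

lemma ev_ex (θ : ℝ) (f : ℝ[X]) (r : ℝ) :
    (cx f).eval (ex θ * r) = ((cs θ f).eval r : ℝ) + ((sn θ f).eval r : ℝ) * Complex.I := by
  rw [← sc_eval, sc_ex, eval_add, eval_mul, eval_C, eval_cx_real, eval_cx_real]; ring

lemma ev_re (θ : ℝ) (f : ℝ[X]) (r : ℝ) : ((cx f).eval (ex θ * r)).re = (cs θ f).eval r := by
  rw [ev_ex]; simp
lemma ev_im (θ : ℝ) (f : ℝ[X]) (r : ℝ) : ((cx f).eval (ex θ * r)).im = (sn θ f).eval r := by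
  rw [ev_ex]; simp
lemma ev_nsq (θ : ℝ) (f : ℝ[X]) (r : ℝ) : (cs θ f).eval r ^ 2 + (sn θ f).eval r ^ 2 = ‖(cx f).eval (ex θ * r)‖ ^ 2 := by
  rw [← Complex.normSq_eq_norm_sq, Complex.normSq_apply, ev_re, ev_im]; ring

lemma cs_mul (θ : ℝ) (f h : ℝ[X]) : cs θ (f * h) = cs θ f * cs θ h - sn θ f * sn θ h := by
  refine Polynomial.funext fun r => ?_
  rw [← ev_re, cx, Polynomial.map_mul, eval_mul, Complex.mul_re]
  simp only [eval_sub, eval_mul, ← ev_re, ← ev_im]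
lemma sn_mul (θ : ℝ) (f h : ℝ[X]) : sn θ (f * h) = cs θ f * sn θ h + sn θ f * cs θ h := by
  refine Polynomial.funext fun r => ?_
  rw [← ev_im, cx, Polynomial.map_mul, eval_mul, Complex.mul_im]
  simp only [eval_add, eval_mul, ← ev_re, ← ev_im]

lemma cs_add (θ : ℝ) (f h : ℝ[X]) : cs θ (f + h) = cs θ f + cs θ h := by
  ext n; simp only [cs_coeff, coeff_add]; ring
lemma sn_add (θ : ℝ) (f h : ℝ[X]) : sn θ (f + h) = sn θ f + sn θ h := by
  ext n; simp only [sn_coeff, coeff_add]; ring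
lemma sh_add (θ : ℝ) (f h : ℝ[X]) : sh θ (f + h) = sh θ f + sh θ h := by
  ext n; simp only [sh_coeff, coeff_add]; ring
lemma cs_C (θ c : ℝ) (f : ℝ[X]) : cs θ (C c * f) = C c * cs θ f := by
  ext n; simp only [cs_coeff, coeff_C_mul]; ring
lemma sn_C (θ c : ℝ) (f : ℝ[X]) : sn θ (C c * f) = C c * sn θ f := by
  ext n; simp only [sn_coeff, coeff_C_mul]; ring
lemma sh_C (θ c : ℝ) (f : ℝ[X]) : sh θ (C c * f) = C c * sh θ f := by
  ext n; simp only [sh_coeff, coeff_C_mul]; ring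
lemma cs_neg (θ : ℝ) (f : ℝ[X]) : cs θ (-f) = -cs θ f := by
  ext n; simp only [cs_coeff, coeff_neg]; ring
lemma sn_neg (θ : ℝ) (f : ℝ[X]) : sn θ (-f) = -sn θ f := by
  ext n; simp only [sn_coeff, coeff_neg]; ring

lemma tri_add (θ φ : ℝ) (R : ℝ[X]) : sn θ (cs φ R) + cs θ (sn φ R) = sn (θ + φ) R := by
  ext n; simp only [sn_coeff, cs_coeff, coeff_add]; rw [mul_add (n : ℝ) θ φ, Real.sin_add]; ring
lemma tri_sub (θ φ : ℝ) (R : ℝ[X]) : sn θ (cs φ R) - cs θ (sn φ R) = sn (θ - φ) R := by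
  ext n; simp only [sn_coeff, cs_coeff, coeff_sub]; rw [mul_sub (n : ℝ) θ φ, Real.sin_sub]; ring

lemma Xc {p q : ℝ[X]} (h : X * p = X * q) : p = q := mul_left_cancel₀ X_ne_zero h

lemma sh_nsq (θ : ℝ) (f : ℝ[X]) : sh θ (-(f ^ 2)) = -2 * sh θ f * cs θ f := by
  apply Xc
  rw [X_mul_sh, sn_neg, pow_two, sn_mul, ← X_mul_sh θ f]; ring

lemma Fl_base (θ φ : ℝ) (R : ℝ[X]) : Fl θ (cs φ R) (-(sn φ R) ^ 2) =
    X ^ 2 * (sh (θ - φ) R * sh (θ + φ) R) * (4 * (sh θ (cs φ R) ^ 2 + sh θ (sn φ R) ^ 2)) := by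
  have h1 := tri_add θ φ R
  have h2 := tri_sub θ φ R
  have h3 : cs θ (-(sn φ R) ^ 2) = -(cs θ (sn φ R)) ^ 2 + X ^ 2 * sh θ (sn φ R) ^ 2 := by
    rw [cs_neg, pow_two (sn φ R), cs_mul, ← X_mul_sh θ (sn φ R)]; ring
  rw [← X_mul_sh θ, ← X_mul_sh (θ + φ)] at h1
  rw [← X_mul_sh θ, ← X_mul_sh (θ - φ)] at h2
  rw [Fl, sh_nsq, h3]
  have h4 : X ^ 2 * (sh (θ - φ) R * sh (θ + φ) R) = (X * sh (θ - φ) R) * (X * sh (θ + φ) R) := by ring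
  rw [h4, ← h1, ← h2]; ring

lemma C2 : (C (-2 : ℝ) : ℝ[X]) = -2 := by
  rw [C_neg]; rfl

/-- first variation on the first ray -/
lemma L1_eq {θ : ℝ} {R q0 s m : ℝ[X]} (h : q0 * (X * s) = sn θ R) :
    4 * cs θ (-2 * (X * s) * m) * sh θ (cs θ R) ^ 2 - 2 * sh θ (-(sn θ R) ^ 2) * sh θ (-2 * (X * s) * m) =
    X * (sh (2 * θ) R * (cs θ q0 * cs θ m + sn θ q0 * sn θ m)) * (-4 * ((cs θ s) ^ 2 + (sn θ s) ^ 2)) := by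
  have h1 := tri_add θ θ R
  have h2 := tri_sub θ θ R
  have h20 : sn (θ - θ) R = 0 := by ext n; simp [sn_coeff]
  rw [h20] at h2
  rw [← two_mul] at h1
  rw [← X_mul_sh] at h1 h2
  rw [← X_mul_sh (2 * θ)] at h1
  have hb : 2 * sh θ (cs θ R) = sh (2 * θ) R := by
    apply Xc; linear_combination h1 + h2
  have hc : 2 * cs θ (sn θ R) = X * sh (2 * θ) R := by linear_combination h1 - h2
  apply Xc
  have e1 : (-2 * (X * s) * m : ℝ[X]) = C (-2) * ((X * s) * m) := by
    rw [C2]; ring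
  have hx := X_mul_sh θ (-2 * (X * s) * m)
  have hf := X_mul_sh θ (sn θ R)
  rw [sh_nsq]
  set D := sh θ (-2 * (X * s) * m)
  set E := sh θ (sn θ R)
  rw [e1, sn_C, sn_mul θ (X * s) m] at hx
  rw [e1, cs_C, cs_mul θ (X * s) m]
  rw [← h] at hf hc ⊢
  rw [sn_mul θ q0 (X * s)] at hf
  rw [cs_mul θ q0 (X * s)] at hc ⊢
  have hN1 : cs θ (X * s) = X * (C (Real.cos θ) * cs θ s - C (Real.sin θ) * sn θ s) := by
    rw [cs_mul, show cs θ X = C (Real.cos θ) * X by ext n; rw [cs_coeff, coeff_C_mul, coeff_X]; rcases eq_or_ne 1 n with hh | hh <;> [subst hh; skip] <;> simp [*],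
      show sn θ X = C (Real.sin θ) * X by ext n; rw [sn_coeff, coeff_C_mul, coeff_X]; rcases eq_or_ne 1 n with hh | hh <;> [subst hh; skip] <;> simp [*]]
    ring
  have hN2 : sn θ (X * s) = X * (C (Real.cos θ) * sn θ s + C (Real.sin θ) * cs θ s) := by
    rw [sn_mul, show cs θ X = C (Real.cos θ) * X by ext n; rw [cs_coeff, coeff_C_mul, coeff_X]; rcases eq_or_ne 1 n with hh | hh <;> [subst hh; skip] <;> simp [*],
      show sn θ X = C (Real.sin θ) * X by ext n; rw [sn_coeff, coeff_C_mul, coeff_X]; rcases eq_or_ne 1 n with hh | hh <;> [subst hh; skip] <;> simp [*]]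
    ring
  have hu : (C (Real.cos θ) : ℝ[X]) ^ 2 + C (Real.sin θ) ^ 2 = 1 := by
    rw [← C_pow, ← C_pow, ← C_add, Real.cos_sq_add_sin_sq, C_1]
  have hN : cs θ (X * s) ^ 2 + sn θ (X * s) ^ 2 = X ^ 2 * (cs θ s ^ 2 + sn θ s ^ 2) := by
    rw [hN1, hN2]; linear_combination X ^ 2 * (cs θ s ^ 2 + sn θ s ^ 2) * hu
  rw [C2] at hx ⊢
  linear_combination (-2 * X * (cs θ (X * s) * cs θ m - sn θ (X * s) * sn θ m) * (2 * sh θ (cs θ R) + sh (2 * θ) R)) * hb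
    + (2 * sh (2 * θ) R * (cs θ (X * s) * cs θ m - sn θ (X * s) * sn θ m) + 2 * X * E * D) * hc
    + 2 * sh (2 * θ) R * (X * D) * hf
    + 2 * sh (2 * θ) R * (cs θ q0 * sn θ (X * s) + sn θ q0 * cs θ (X * s)) * hx
    - 4 * sh (2 * θ) R * (cs θ q0 * cs θ m + sn θ q0 * sn θ m) * hN
end Polynomial.PN

namespace Polynomial.PN
open NC Filter Topology

section count
variable {α : Type*} {l : Filter α} {G : α → ℝ[X]} {A N : ℝ[X]} {D : ℕ}

lemma roots_nonvan (hN : ∀ x : ℝ, N.eval x ≠ 0) : N.roots = 0 := by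
  rw [Multiset.eq_zero_iff_forall_notMem]
  intro a ha
  exact hN a (isRoot_of_mem_roots ha)

lemma lc_pos (hN : ∀ x : ℝ, 0 < N.eval x) : 0 < N.leadingCoeff := by
  have h0 : N ≠ 0 := by rintro rfl; simpa using hN 0
  by_contra hc
  have h1 : N.leadingCoeff < 0 := lt_of_le_of_ne (not_lt.1 hc) (leadingCoeff_ne_zero.2 h0)
  obtain ⟨x, hx⟩ := (sign_top' h1).exists
  exact absurd (hN x) (not_lt.2 hx.le)

lemma lc_of (hd : ∀ᶠ ν in l, (G ν).natDegree ≤ D) (hT : ∀ᶠ ν in l, (G ν).coeff D < 0) :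
    ∀ᶠ ν in l, (G ν).natDegree = D ∧ (G ν).leadingCoeff < 0 := by
  filter_upwards [hd, hT] with ν h1 h2
  have h3 : (G ν).natDegree = D := le_antisymm h1 (le_natDegree_of_ne_zero h2.ne)
  refine ⟨h3, ?_⟩
  rw [leadingCoeff, h3]; exact h2

lemma dj_nhds {a b : ℝ} (h : a ≠ b) : Disjoint (𝓝 a) (𝓝 b) := disjoint_nhds_nhds.2 h

lemma count_mid [l.NeBot] (hD : Even D) (hd : ∀ᶠ ν in l, (G ν).natDegree ≤ D)
    (ht : ∀ n, Tendsto (fun ν => (G ν).coeff n) l (𝓝 ((X ^ 2 * A * N).coeff n)))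
    (hA : RS A) (hA0 : 0 < A.eval 0) (hAl : 0 < A.leadingCoeff) (hN : ∀ x : ℝ, 0 < N.eval x)
    (hdeg : A.natDegree + N.natDegree + 4 = D) (h0 : ∀ᶠ ν in l, (G ν).eval 0 < 0)
    (hT : ∀ᶠ ν in l, (G ν).coeff D < 0) :
    ∀ᶠ ν in l, (G ν).roots.toFinset.card = A.natDegree + 4 := by
  classical
  have hN0 : N ≠ 0 := by rintro rfl; simpa using hN 0
  have hX : (X ^ 2 : ℝ[X]) ≠ 0 := pow_ne_zero _ X_ne_zero
  have hG0 : X ^ 2 * A * N ≠ 0 := mul_ne_zero (mul_ne_zero hX hA.ne) hN0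
  have hdG : (X ^ 2 * A * N).natDegree = D - 2 := by
    rw [natDegree_mul (mul_ne_zero hX hA.ne) hN0, natDegree_mul hX hA.ne, natDegree_X_pow]; omega
  have hrG : Multiset.card (X ^ 2 * A * N).roots = A.natDegree + 2 := by
    rw [roots_mul hG0, roots_mul (mul_ne_zero hX hA.ne), roots_nonvan (fun x => (hN x).ne'), roots_X_pow]
    simp [hA.card.1]; omega
  have hlG : 0 < (X ^ 2 * A * N).leadingCoeff := by
    rw [leadingCoeff_mul, leadingCoeff_mul, leadingCoeff_X_pow, one_mul]
    exact mul_pos hAl (lc_pos hN)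
  have UB := ub_roots hG0 hd ht
  have hE : ∀ x, Tendsto (fun ν => (G ν).eval x) l (𝓝 ((X ^ 2 * A * N).eval x)) := fun x =>
    tendsto_eval hd (lim_deg hd ht) ht tendsto_const_nhds
  have hlc := lc_of hd hT
  have near : ∀ᶠ x in 𝓝 (0 : ℝ), x ≠ 0 → 0 < (X ^ 2 * A * N).eval x := by
    have : ∀ᶠ x in 𝓝 (0 : ℝ), 0 < A.eval x := (A.continuous.tendsto 0).eventually_const_lt hA0
    filter_upwards [this] with x hx hx0
    simp only [eval_mul, eval_pow, eval_X]
    have := hN x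
    positivity
  have even1 : (-1 : ℝ) ^ (D - 2) = 1 := Even.neg_one_pow (by rw [Nat.even_sub (by omega)]; simp [hD])
  have even2 : (-1 : ℝ) ^ D = 1 := Even.neg_one_pow hD
  have hnz : ∀ r ∈ A.roots.toFinset, r ≠ 0 := by
    rintro r hr rfl
    have : A.eval 0 = 0 := isRoot_of_mem_roots (Multiset.mem_toFinset.1 hr)
    rw [this] at hA0; exact lt_irrefl _ hA0
  have LB := lb_roots (l := l) (G := G) (ι := A.roots.toFinset ⊕ Fin 4)
    (Sum.elim (fun r => 𝓝 (r : ℝ)) ![𝓝[>] 0, 𝓝[<] 0, atTop, atBot]) ?_ ?_ ?_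
  · filter_upwards [UB, LB] with ν h1 h2
    have h3 := Multiset.toFinset_card_le (G ν).roots
    rw [hrG, hdG] at h1
    rw [Fintype.card_sum, Fintype.card_coe, hA.card', Fintype.card_fin] at h2
    omega
  · have key : ∀ (a : A.roots.toFinset) (j : Fin 4), Disjoint (𝓝 (a : ℝ)) ((![𝓝[>] 0, 𝓝[<] 0, atTop, atBot] : Fin 4 → Filter ℝ) j) := by
      intro a j
      fin_cases j
      · exact (dj_nhds (hnz _ a.2)).mono_right nhdsWithin_le_nhds
      · exact (dj_nhds (hnz _ a.2)).mono_right nhdsWithin_le_nhds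
      · exact disjoint_nhds_atTop _
      · exact disjoint_nhds_atBot _
    have d01 : Disjoint (𝓝[>] (0 : ℝ)) (𝓝[<] 0) :=
      disjoint_of_disjoint_of_mem (Set.disjoint_left.2 fun x (h1 : 0 < x) (h2 : x < 0) => lt_asymm h1 h2) self_mem_nhdsWithin self_mem_nhdsWithin
    have d02 : Disjoint (𝓝[>] (0 : ℝ)) atTop := (disjoint_nhds_atTop 0).mono_left nhdsWithin_le_nhds
    have d03 : Disjoint (𝓝[>] (0 : ℝ)) atBot := (disjoint_nhds_atBot 0).mono_left nhdsWithin_le_nhds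
    have d12 : Disjoint (𝓝[<] (0 : ℝ)) atTop := (disjoint_nhds_atTop 0).mono_left nhdsWithin_le_nhds
    have d13 : Disjoint (𝓝[<] (0 : ℝ)) atBot := (disjoint_nhds_atBot 0).mono_left nhdsWithin_le_nhds
    have d23 : Disjoint (atTop : Filter ℝ) atBot := disjoint_atTop_atBot
    rintro (a | i) (b | j) hne
    · exact dj_nhds (fun h => hne (by rw [Subtype.ext h]))
    · exact key a j
    · exact (key b i).symm
    · have hij : i ≠ j := fun h => hne (by rw [h])
      change Disjoint ((![𝓝[>] 0, 𝓝[<] 0, atTop, atBot] : Fin 4 → Filter ℝ) i) ((![𝓝[>] 0, 𝓝[<] 0, atTop, atBot] : Fin 4 → Filter ℝ) j)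
      fin_cases i <;> fin_cases j <;> first | exact absurd rfl hij | assumption | (apply Disjoint.symm; assumption)
  · rintro (a | j)
    · have ha : A.eval (a : ℝ) = 0 := isRoot_of_mem_roots (Multiset.mem_toFinset.1 a.2)
      refine tg_simple hE (by simp [ha]) ?_
      simp only [derivative_mul, eval_add, eval_mul, ha, mul_zero, zero_mul, add_zero, zero_add]
      refine mul_ne_zero (mul_ne_zero ?_ (hA.si _ ha)) (hN _).ne'
      simpa using hnz _ a.2
    · fin_cases j
      · exact tg_right hE (by
          filter_upwards [near.filter_mono nhdsWithin_le_nhds, self_mem_nhdsWithin] with x h1 h2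
          exact h1 (ne_of_gt h2)) h0
      · exact tg_left hE (by
          filter_upwards [near.filter_mono nhdsWithin_le_nhds, self_mem_nhdsWithin] with x h1 h2
          exact h1 (ne_of_lt h2)) h0
      · exact tg_top hE (sign_top hlG) (hlc.mono fun ν h => sign_top' h.2)
      · exact tg_bot hE (sign_bot (by rw [hdG, even1, mul_one]; exact hlG))
          (hlc.mono fun ν h => sign_bot' (by rw [h.1, even2, mul_one]; exact h.2))
  · filter_upwards [h0] with ν h h'
    rw [h'] at h; simp at h

lemma count_one [l.NeBot] (hD : Even D) (hd : ∀ᶠ ν in l, (G ν).natDegree ≤ D)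
    (ht : ∀ n, Tendsto (fun ν => (G ν).coeff n) l (𝓝 ((A * N).coeff n)))
    (hA : RS A) (hN : ∀ x : ℝ, N.eval x ≠ 0)
    (hdeg : A.natDegree + N.natDegree + 1 = D)
    (hT : ∀ᶠ ν in l, (G ν).coeff D < 0) :
    ∀ᶠ ν in l, (G ν).roots.toFinset.card = A.natDegree + 1 := by
  classical
  have hN0 : N ≠ 0 := by rintro rfl; simpa using hN 0
  have hG0 : A * N ≠ 0 := mul_ne_zero hA.ne hN0
  have hdG : (A * N).natDegree = D - 1 := by
    rw [natDegree_mul hA.ne hN0]; omega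
  have hrG : Multiset.card (A * N).roots = A.natDegree := by
    rw [roots_mul hG0, roots_nonvan hN]
    simp [hA.card.1]
  have UB := ub_roots hG0 hd ht
  have hE : ∀ x, Tendsto (fun ν => (G ν).eval x) l (𝓝 ((A * N).eval x)) := fun x =>
    tendsto_eval hd (lim_deg hd ht) ht tendsto_const_nhds
  have hlc := lc_of hd hT
  have even2 : (-1 : ℝ) ^ D = 1 := Even.neg_one_pow hD
  have odd1 : (-1 : ℝ) ^ (D - 1) = -1 := Odd.neg_one_pow (by rw [Nat.odd_sub (by omega)]; simp [hD])
  obtain ⟨F, hF1, hF2⟩ : ∃ F : Filter ℝ, (∀ a : ℝ, Disjoint (𝓝 a) F) ∧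
      ∀ U ∈ F, ∀ᶠ ν in l, ∃ x ∈ U, (G ν).eval x = 0 := by
    rcases lt_or_gt_of_ne (leadingCoeff_ne_zero.2 hG0) with h | h
    · refine ⟨atBot, disjoint_nhds_atBot, tg_bot hE (sign_bot ?_) (hlc.mono fun ν h => sign_bot' (by rw [h.1, even2, mul_one]; exact h.2))⟩
      rw [hdG, odd1]; linarith
    · exact ⟨atTop, disjoint_nhds_atTop, tg_top hE (sign_top h) (hlc.mono fun ν h => sign_top' h.2)⟩
  have LB := lb_roots (l := l) (G := G) (ι := Option A.roots.toFinset)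
    (fun o => o.elim F (fun r => 𝓝 (r : ℝ))) ?_ ?_ ?_
  · filter_upwards [UB, LB] with ν h1 h2
    have h3 := Multiset.toFinset_card_le (G ν).roots
    rw [hrG, hdG] at h1
    rw [Fintype.card_option, Fintype.card_coe, hA.card'] at h2
    omega
  · rintro (_ | a) (_ | b) hne
    · exact absurd rfl hne
    · exact (hF1 b).symm
    · exact hF1 a
    · exact dj_nhds (fun h => hne (by rw [Subtype.ext h]))
  · rintro (_ | a)
    · exact hF2
    · have ha : A.eval (a : ℝ) = 0 := isRoot_of_mem_roots (Multiset.mem_toFinset.1 a.2)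
      refine tg_simple hE (by simp [ha]) ?_
      simp only [derivative_mul, eval_add, eval_mul, ha, zero_mul, add_zero]
      exact mul_ne_zero (hA.si _ ha) (hN _)
  · filter_upwards [hT] with ν h h'
    rw [h'] at h; simp at h
end count
end Polynomial.PN

namespace Polynomial.PN
open NC Filter Topology

lemma sh_refl (θ : ℝ) (f : ℝ[X]) : sh (Real.pi - θ) f = (sh θ f).comp (-X) := by
  ext n
  rw [show (-X : ℝ[X]) = C (-1) * X by simp, comp_C_mul_X_coeff, sh_coeff, sh_coeff, mul_sub, Real.sin_nat_mul_pi_sub]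
  rw [pow_succ]; ring
lemma cs_refl (θ : ℝ) (f : ℝ[X]) : cs (Real.pi - θ) f = (cs θ f).comp (-X) := by
  ext n
  rw [show (-X : ℝ[X]) = C (-1) * X by simp, comp_C_mul_X_coeff, cs_coeff, cs_coeff, mul_sub, Real.cos_nat_mul_pi_sub]
  ring
lemma Fl_refl (θ : ℝ) (b e : ℝ[X]) : Fl (Real.pi - θ) b e = (Fl θ b e).comp (-X) := by
  rw [Fl, Fl, sh_refl, sh_refl, cs_refl]
  simp
lemma Fl_refl_card (θ : ℝ) (b e : ℝ[X]) :
    (Fl (Real.pi - θ) b e).roots.toFinset.card = (Fl θ b e).roots.toFinset.card := by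
  classical
  rw [Fl_refl, roots_comp_neg_X, Multiset.toFinset_map]
  exact Finset.card_image_of_injective _ neg_injective

section size
variable {k l : ℕ} {b e : ℝ[X]} {θ : ℝ}

lemma sin_k (hk : 0 < k) : Real.sin ((k : ℝ) * th k l) = 0 := by
  have hk' : (k : ℝ) ≠ 0 := by exact_mod_cast hk.ne'
  rw [th, mul_div_cancel₀ _ hk', mul_comm]; exact Real.sin_nat_mul_pi l
lemma th_pos (hk : l < k) (hl : 0 < l) : 0 < Real.sin (th k l) := by
  have hk' : (0 : ℝ) < k := by exact_mod_cast (by omega : 0 < k)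
  have hl' : (0 : ℝ) < l := by exact_mod_cast hl
  apply Real.sin_pos_of_pos_of_lt_pi
  · rw [th]; positivity
  · rw [th, div_lt_iff₀ hk']
    have : (l : ℝ) < k := by exact_mod_cast hk
    nlinarith [Real.pi_pos]

/-- abstract angle conditions -/
structure Ang (k : ℕ) (θ : ℝ) : Prop where
  s1 : Real.sin ((k : ℝ) * θ) = 0
  s0 : Real.sin θ ≠ 0

lemma th_ang (hl : 0 < l) (hk : l < k) : Ang k (th k l) := ⟨sin_k (by omega), (th_pos hk hl).ne'⟩

lemma Ang.s2 (H : Ang k θ) : Real.sin ((2 * k : ℕ) * θ) = 0 := by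
  rw [show ((2 * k : ℕ) : ℝ) * θ = 2 * (k * θ) by push_cast; ring, Real.sin_two_mul, H.s1]; ring
lemma Ang.c1 (H : Ang k θ) : Real.cos ((k : ℝ) * θ) ^ 2 = 1 := by
  have := Real.sin_sq_add_cos_sq ((k : ℝ) * θ)
  rw [H.s1] at this; linarith
lemma Ang.c2 (H : Ang k θ) : Real.cos ((2 * k : ℕ) * θ) = 1 := by
  rw [show ((2 * k : ℕ) : ℝ) * θ = 2 * (k * θ) by push_cast; ring, Real.cos_two_mul, H.c1]; ring
lemma Ang.sk1 (H : Ang k θ) (hk : 1 ≤ k) : Real.sin ((k - 1 : ℕ) * θ) = - Real.cos (k * θ) * Real.sin θ := by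
  rw [Nat.cast_sub hk, sub_mul, Real.sin_sub, H.s1]; simp
lemma Ang.sk2 (H : Ang k θ) (hk : 1 ≤ k) : Real.sin ((2 * k - 1 : ℕ) * θ) = - Real.sin θ := by
  rw [Nat.cast_sub (by omega), sub_mul, Real.sin_sub, H.s2, H.c2]; simp

lemma sh_deg (H : Ang k θ) (hb : b.natDegree ≤ k) : (sh θ b).natDegree ≤ k - 2 := by
  rw [natDegree_le_iff_coeff_eq_zero] at *
  intro N hN
  rw [sh_coeff]
  rcases eq_or_ne (N + 1) k with h | h
  · rw [h, H.s1, mul_zero]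
  · rw [hb (N + 1) (by omega), zero_mul]
lemma sh_deg2 (H : Ang k θ) (hb : e.natDegree ≤ 2 * k) : (sh θ e).natDegree ≤ 2 * k - 2 := by
  rw [natDegree_le_iff_coeff_eq_zero] at *
  intro N hN
  rw [sh_coeff]
  rcases eq_or_ne (N + 1) (2 * k) with h | h
  · rw [h, H.s2, mul_zero]
  · rw [hb (N + 1) (by omega), zero_mul]
lemma cs_deg {n : ℕ} (hb : e.natDegree ≤ n) : (cs θ e).natDegree ≤ n := by
  rw [natDegree_le_iff_coeff_eq_zero] at *
  intro N hN
  rw [cs_coeff, hb N hN, zero_mul]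
lemma sn_deg {n : ℕ} (hb : e.natDegree ≤ n) : (sn θ e).natDegree ≤ n := by
  rw [natDegree_le_iff_coeff_eq_zero] at *
  intro N hN
  rw [sn_coeff, hb N hN, zero_mul]
lemma cs_deg_eq (hc : Real.cos (e.natDegree * θ) ≠ 0 ) : (cs θ e).natDegree = e.natDegree := by
  rcases eq_or_ne e 0 with rfl | h
  · apply le_antisymm (cs_deg le_rfl); simp
  · apply le_antisymm (cs_deg le_rfl)
    apply le_natDegree_of_ne_zero
    rw [cs_coeff]
    exact mul_ne_zero (leadingCoeff_ne_zero.2 h) hc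

lemma four_deg : (4 : ℝ[X]).natDegree = 0 := natDegree_ofNat 4

lemma Fl_deg (H : Ang k θ) (hk : 2 ≤ k) (hb : b.natDegree ≤ k) (he : e.natDegree ≤ 2 * k) :
    (Fl θ b e).natDegree ≤ 4 * k - 4 ∧ (Fl θ b e).coeff (4 * k - 4) =
      Real.sin θ ^ 2 * (4 * b.coeff (k - 1) ^ 2 * e.coeff (2 * k) - e.coeff (2 * k - 1) ^ 2) := by
  have h1 := sh_deg H hb
  have h2 := sh_deg2 H he
  have h3 := cs_deg (θ := θ) he
  have t1 : (4 * X ^ 2 * sh θ b ^ 4).natDegree < 4 * k - 4 := by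
    have a1 := natDegree_mul_le (p := 4 * X ^ 2) (q := sh θ b ^ 4)
    have a2 := natDegree_mul_le (p := (4 : ℝ[X])) (q := X ^ 2)
    have a3 := natDegree_pow_le (p := sh θ b) (n := 4)
    rw [natDegree_X_pow, four_deg] at a2
    omega
  have t2 : (sh θ b ^ 2).natDegree ≤ 2 * (k - 2) := natDegree_pow_le_of_le 2 h1
  have t3 : (4 * cs θ e).natDegree ≤ 2 * k := by
    have a2 := natDegree_mul_le (p := (4 : ℝ[X])) (q := cs θ e)
    rw [four_deg] at a2; omega
  have t4 : (4 * cs θ e * sh θ b ^ 2).natDegree ≤ 4 * k - 4 := by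
    have := natDegree_mul_le (p := 4 * cs θ e) (q := sh θ b ^ 2); omega
  have t5 : (sh θ e ^ 2).natDegree ≤ 4 * k - 4 := (natDegree_pow_le_of_le 2 h2).trans (by omega)
  refine ⟨sub_deg (add_deg t1.le t4) t5, ?_⟩
  rw [Fl, coeff_sub, coeff_add, coeff_eq_zero_of_natDegree_lt t1]
  have c1 : (4 * cs θ e * sh θ b ^ 2).coeff (4 * k - 4) = 4 * e.coeff (2 * k) * (b.coeff (k - 1) ^ 2 * Real.sin θ ^ 2) := by
    rw [show 4 * k - 4 = 2 * k + 2 * (k - 2) by omega, coeff_mul_add_eq_of_natDegree_le t3 t2,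
      coeff_pow_of_natDegree_le h1, sh_coeff, show k - 2 + 1 = k - 1 by omega, H.sk1 (by omega),
      show (4 : ℝ[X]) = C 4 from rfl, coeff_C_mul, cs_coeff, H.c2]
    linear_combination (4 * e.coeff (2 * k) * (b.coeff (k - 1) ^ 2 * Real.sin θ ^ 2)) * H.c1
  have c2 : (sh θ e ^ 2).coeff (4 * k - 4) = e.coeff (2 * k - 1) ^ 2 * Real.sin θ ^ 2 := by
    rw [show 4 * k - 4 = 2 * (2 * k - 2) by omega, coeff_pow_of_natDegree_le h2, sh_coeff,
      show 2 * k - 2 + 1 = 2 * k - 1 by omega, H.sk2 (by omega)]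
    ring
  rw [c1, c2]; ring

lemma Fl_zero (b e : ℝ[X]) : (Fl θ b e).eval 0 = Real.sin θ ^ 2 * (4 * b.coeff 1 ^ 2 * e.coeff 0 - e.coeff 1 ^ 2) := by
  simp only [Fl, eval_sub, eval_add, eval_mul, eval_pow, eval_X, eval_ofNat, ← coeff_zero_eq_eval_zero, sh_coeff, cs_coeff]
  simp; ring

lemma Fl_top_neg (H : CU k (zt k) (cx b) (cx e)) (hl : 0 < l) (hlk : l < k) (heT : e.coeff (2 * k) ≤ 0) :
    (Fl (th k l) b e).natDegree ≤ 4 * k - 4 ∧ (Fl (th k l) b e).coeff (4 * k - 4) < 0 := by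
  have inj : Function.Injective (algebraMap ℝ ℂ) := Complex.ofReal_injective
  have hb : b.natDegree ≤ k := by rw [← natDegree_map_eq_of_injective inj b]; exact H.db
  have he : e.natDegree ≤ 2 * k := by rw [← natDegree_map_eq_of_injective inj e]; exact H.de
  obtain ⟨h1, h2⟩ := Fl_deg (th_ang hl hlk) (by have := H.hk; omega) hb he
  refine ⟨h1, ?_⟩
  rw [h2]
  apply mul_neg_of_pos_of_neg (pow_pos (th_pos hlk hl) 2)
  have h3 := H.top
  simp only [cx, coeff_map, Complex.coe_algebraMap] at h3
  have h4 : e.coeff (2 * k - 1) ^ 2 ≠ 4 * b.coeff (k - 1) ^ 2 * e.coeff (2 * k) := by exact_mod_cast h3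
  have h5 : 4 * b.coeff (k - 1) ^ 2 * e.coeff (2 * k) ≤ 0 := mul_nonpos_of_nonneg_of_nonpos (by positivity) heT
  have h6 := sq_nonneg (e.coeff (2 * k - 1))
  exact lt_of_le_of_ne (by linarith) (fun h => h4 (by linarith))

lemma Fl_zero_neg (H : CU k (zt k) (cx b) (cx e)) (hl : 0 < l) (hlk : l < k) (he0 : e.coeff 0 ≤ 0) :
    (Fl (th k l) b e).eval 0 < 0 := by
  refine lt_of_le_of_ne ?_ (Fl_ne H hl hlk)
  rw [Fl_zero]
  apply mul_nonpos_of_nonneg_of_nonpos (by positivity)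
  have h5 : 4 * b.coeff 1 ^ 2 * e.coeff 0 ≤ 0 := mul_nonpos_of_nonneg_of_nonpos (by positivity) he0
  have h6 := sq_nonneg (e.coeff 1)
  linarith
end size

lemma RS.mul {A B : ℝ[X]} (hA : RS A) (hB : RS B) (h : ∀ x : ℝ, A.eval x = 0 → B.eval x ≠ 0) : RS (A * B) := by
  refine ⟨mul_ne_zero hA.ne hB.ne, ?_, ?_⟩
  · intro z hz
    rw [cx, Polynomial.map_mul, eval_mul] at hz
    rcases mul_eq_zero.1 hz with h1 | h1
    · exact hA.re z h1
    · exact hB.re z h1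
  · intro x hx
    rw [eval_mul] at hx
    rw [derivative_mul, eval_add, eval_mul, eval_mul]
    rcases mul_eq_zero.1 hx with h1 | h1
    · rw [h1, zero_mul, add_zero]; exact mul_ne_zero (hA.si x h1) (h x h1)
    · rw [h1, mul_zero, zero_add]
      exact mul_ne_zero (fun h2 => h x h2 h1) (hB.si x h1)

lemma RS.X : RS (X : ℝ[X]) := by
  refine ⟨X_ne_zero, ?_, ?_⟩
  · intro z hz; simp at hz; simp [hz]
  · intro x _; simp

/-- expansion of the ray polynomial along the family -/
lemma Fl_expand (θ : ℝ) {b0 e0 e1 : ℝ[X]} {b2 e2 : ℝ → ℝ[X]} (hb2 : CP b2) (he2 : CP e2)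
    (h0 : Fl θ b0 e0 = 0) : ∃ W : ℝ → ℝ[X], CP W ∧ ∀ ν, Fl θ (b0 + C (ν ^ 2) * b2 ν) (e0 + C ν * e1 + C (ν ^ 2) * e2 ν) =
      C ν * ((4 * cs θ e1 * sh θ b0 ^ 2 - 2 * sh θ e0 * sh θ e1) + C ν * W ν) := by
  let B2 : ℝ → ℝ[X] := fun ν => 2 * sh θ b0 * sh θ (b2 ν) + C (ν ^ 2) * sh θ (b2 ν) ^ 2
  let B4 : ℝ → ℝ[X] := fun ν => 2 * sh θ b0 ^ 2 * B2 ν + C (ν ^ 2) * B2 ν ^ 2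
  have cν2 : CP (fun ν => C (ν ^ 2)) := CP.C (continuous_id.pow 2)
  have cν : CP (fun ν => C ν) := CP.C continuous_id
  have hB2 : CP B2 := ((CP.const _).mul (hb2.sh θ)).add (cν2.mul ((hb2.sh θ).pow 2))
  have hB4 : CP B4 := ((CP.const _).mul hB2).add (cν2.mul (hB2.pow 2))
  refine ⟨fun ν => 4 * X ^ 2 * B4 ν + 4 * cs θ (e2 ν) * (sh θ b0 ^ 2 + C (ν ^ 2) * B2 ν) + 4 * (cs θ e0 + C ν * cs θ e1) * B2 ν
    - (sh θ e1 ^ 2 + 2 * sh θ e0 * sh θ (e2 ν) + 2 * sh θ e1 * C ν * sh θ (e2 ν) + C (ν ^ 2) * sh θ (e2 ν) ^ 2), ?_, ?_⟩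
  · refine CP.sub (CP.add (CP.add ((CP.const _).mul hB4) (((CP.const _).mul (he2.cs θ)).mul ((CP.const _).add (cν2.mul hB2))))
      (((CP.const _).mul ((CP.const _).add (cν.mul (CP.const _)))).mul hB2)) ?_
    exact (((CP.const _).add ((CP.const _).mul (he2.sh θ))).add (((CP.const _).mul cν).mul (he2.sh θ))).add (cν2.mul ((he2.sh θ).pow 2))
  · intro ν
    rw [Fl] at h0 ⊢
    simp only [sh_add, cs_add, sh_C, cs_C, B4, B2]
    simp only [C_pow]
    linear_combination h0

lemma CP.tend {G : ℝ → ℝ[X]} (h : CP G) (n : ℕ) : Tendsto (fun ν => (G ν).coeff n) (𝓝[>] 0) (𝓝 ((G 0).coeff n)) :=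
  ((h n).tendsto 0).mono_left nhdsWithin_le_nhds

end Polynomial.PN

namespace Polynomial.PN
open NC Filter Topology

lemma sep_ne {p : ℂ[X]} (h : p.Separable) {x : ℂ} (hx : p.eval x = 0) : (derivative p).eval x ≠ 0 := by
  have := h.eval₂_derivative_ne_zero (RingHom.id ℂ) (x := x) (by rw [eval₂_id]; exact hx)
  rwa [eval₂_id] at this

lemma all_real {s : ℝ[X]} {n : ℕ} (hsd : s.natDegree = n) (hsr : s.roots.toFinset.card = n) (hs0 : s ≠ 0) (z : ℂ)
    (hz : (cx s).eval z = 0) : ∃ r ∈ s.roots.toFinset, (r : ℂ) = z := by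
  obtain ⟨q, h1, h2, h3⟩ := exists_prod_multiset_X_sub_C_mul s
  have h4 := Multiset.toFinset_card_le s.roots
  have hq : q.natDegree = 0 := by omega
  have hq0 : q ≠ 0 := by rintro rfl; rw [mul_zero] at h1; exact hs0 h1.symm
  rw [eq_C_of_natDegree_eq_zero hq] at h1 hq0
  rw [← h1, cx, Polynomial.map_mul, eval_mul, map_C, eval_C] at hz
  rcases mul_eq_zero.1 hz with h | h
  · rw [Polynomial.map_multiset_prod, eval_multiset_prod, Multiset.map_map, Multiset.map_map] at h
    rw [Multiset.prod_eq_zero_iff, Multiset.mem_map] at h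
    obtain ⟨r, hr, h⟩ := h
    refine ⟨r, Multiset.mem_toFinset.2 hr, ?_⟩
    simp [sub_eq_zero] at h
    exact h.symm
  · exfalso
    apply hq0
    have : q.coeff 0 = 0 := by simpa using h
    rw [this, C_0]

theorem final {k g : ℕ} (hk : 3 ≤ k) (hg : g + 3 ≤ k) {b s h : ℝ[X]}
    (H : CU k (zt k) (cx b) (cx (-(h * s ^ 2)))) (hs : (cx s).Separable) (hsd : s.natDegree = k - g - 1)
    (hsr : s.roots.toFinset.card = k - g - 1) (hh : (cx h).Separable) (hhd : h.natDegree = 2 * g + 2)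
    (hp : ∀ x : ℝ, 0 < h.eval x)
    (hcount : ∑ l ∈ Finset.Ico 1 k, (Fl (th k l) b (-(h * s ^ 2))).roots.toFinset.card + 2 * k = 2 * k ^ 2 + 4 * g + 4) :
    ∃ P : MvPolynomial (Fin 3) ℝ,
      P ≠ 0 ∧ P.IsHomogeneous (2 * k) ∧
      Squarefree (MvPolynomial.map (algebraMap ℝ ℂ) P) ∧
      (∀ x ∈ SingSet (MvPolynomial.map (algebraMap ℝ ℂ) P),
        IsNodeAt (MvPolynomial.map (algebraMap ℝ ℂ) P) x) ∧
      ((SingSet (MvPolynomial.map (algebraMap ℝ ℂ) P)).ncard : ℤ)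
        = (2 * (k : ℤ) - 1) * ((k : ℤ) - 1) - (g : ℤ) ∧
      (RZ P).Finite ∧ (RZ P).ncard = k ^ 2 + g + 1 := by
  have inj : Function.Injective (algebraMap ℝ ℂ) := Complex.ofReal_injective
  have hs0 : s ≠ 0 := by rintro rfl; simp at hsd; omega
  have hEe : cx (-(h * s ^ 2)) = -(cx h * cx s ^ 2) := by simp [cx]
  have hval : ∀ x : ℂ, (cx (-(h * s ^ 2))).eval x = -((cx h).eval x * (cx s).eval x ^ 2) := by
    intro x; rw [hEe]; simp
  have hder : ∀ x : ℂ, (derivative (cx (-(h * s ^ 2)))).eval x =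
      -((derivative (cx h)).eval x * (cx s).eval x ^ 2 + 2 * (cx h).eval x * (cx s).eval x * (derivative (cx s)).eval x) := by
    intro x; rw [hEe]; simp only [derivative_neg, derivative_mul, derivative_pow, eval_neg, eval_add, eval_mul, eval_pow, eval_C]
    push_cast; ring
  have key : ∀ x : ℂ, (cx (-(h * s ^ 2))).eval x = 0 → (derivative (cx (-(h * s ^ 2)))).eval x = 0 → (cx s).eval x = 0 := by
    intro x h1 h2
    by_contra hc
    rw [hval] at h1
    have h3 : (cx h).eval x = 0 := by
      rcases mul_eq_zero.1 (neg_eq_zero.1 h1) with h | h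
      · exact h
      · exact absurd (pow_eq_zero_iff (two_ne_zero) |>.1 h) hc
    rw [hder, h3] at h2
    have h4 : (derivative (cx h)).eval x * (cx s).eval x ^ 2 = 0 := by linear_combination -h2
    rcases mul_eq_zero.1 h4 with h | h
    · exact sep_ne hh h3 h
    · exact hc (pow_eq_zero_iff (two_ne_zero) |>.1 h)
  have key' : ∀ x : ℂ, (cx s).eval x = 0 → (cx (-(h * s ^ 2))).eval x = 0 ∧ (derivative (cx (-(h * s ^ 2)))).eval x = 0 := by
    intro x hx
    rw [hval, hder, hx]; simp
  have hE : ∀ x, (cx (-(h * s ^ 2))).eval x = 0 → (derivative (cx (-(h * s ^ 2)))).eval x = 0 →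
      (derivative (derivative (cx (-(h * s ^ 2))))).eval x ≠ 0 := by
    intro x h1 h2
    have h3 := key x h1 h2
    obtain ⟨r, hr, hrx⟩ := all_real hsd hsr hs0 x h3
    have h4 : (derivative (derivative (cx (-(h * s ^ 2))))).eval x = -2 * (cx h).eval x * (derivative (cx s)).eval x ^ 2 := by
      rw [hEe]
      simp only [derivative_neg, derivative_mul, derivative_pow, derivative_add, derivative_C, eval_neg, eval_add, eval_mul, eval_pow, eval_C, h3]
      simp; ring
    rw [h4]
    refine mul_ne_zero (mul_ne_zero (by norm_num) ?_) (pow_ne_zero _ (sep_ne hs h3))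
    rw [← hrx, eval_cx_real]
    exact_mod_cast (hp r).ne'
  have hH0 : (-(h * s ^ 2)).coeff 1 ^ 2 ≠ 4 * b.coeff 1 ^ 2 * (-(h * s ^ 2)).coeff 0 := by
    have h3 := H.zero
    simp only [cx, coeff_map, Complex.coe_algebraMap] at h3
    exact_mod_cast h3
  have hHT : (-(h * s ^ 2)).coeff (2 * k - 1) ^ 2 ≠ 4 * b.coeff (k - 1) ^ 2 * (-(h * s ^ 2)).coeff (2 * k) := by
    have h3 := H.top
    simp only [cx, coeff_map, Complex.coe_algebraMap] at h3
    exact_mod_cast h3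
  have hlh := lc_pos hp
  have hls : s.leadingCoeff ≠ 0 := leadingCoeff_ne_zero.2 hs0
  have G : Good k (zt k) b (-(h * s ^ 2)) :=
    { toHypS := H.hypS hE
      db := by rw [← natDegree_map_eq_of_injective inj b]; exact H.db
      de := by rw [← natDegree_map_eq_of_injective inj]; exact H.de
      e0 := by
        have e1 : (-(h * s ^ 2)).coeff 0 = -(h.eval 0 * s.eval 0 ^ 2) := by
          rw [coeff_zero_eq_eval_zero]; simp
        rcases eq_or_ne (s.eval 0) 0 with h0 | h0
        · exfalso
          apply hH0
          have e2 : (-(h * s ^ 2)).coeff 1 = 0 := by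
            have : (derivative (-(h * s ^ 2))).eval 0 = 0 := by
              simp [derivative_mul, derivative_pow, h0]
            rw [← coeff_zero_eq_eval_zero, coeff_derivative] at this
            simpa using this
          rw [e1, e2, h0]; simp
        · rw [e1]
          have := hp 0
          have : 0 < h.eval 0 * s.eval 0 ^ 2 := by positivity
          linarith
      eT := by
        have : (h * s ^ 2).coeff (2 * k) = h.leadingCoeff * s.leadingCoeff ^ 2 := by
          rw [← leadingCoeff_pow, ← leadingCoeff_mul, leadingCoeff]
          congr 1
          rw [natDegree_mul (by rintro rfl; simp at hhd) (pow_ne_zero _ hs0), natDegree_pow]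
          omega
        rw [coeff_neg, this]
        have : 0 < h.leadingCoeff * s.leadingCoeff ^ 2 := by positivity
        linarith
      enp := by
        intro x
        have := hp x
        have : 0 ≤ h.eval x * s.eval x ^ 2 := by positivity
        simp only [eval_neg, eval_mul, eval_pow]; linarith
      edb := by
        intro x hx
        have hsx : s.eval x = 0 := by
          simp only [eval_neg, eval_mul, eval_pow] at hx
          rcases mul_eq_zero.1 (neg_eq_zero.1 hx) with h | h
          · exact absurd h (hp x).ne'
          · exact pow_eq_zero_iff (two_ne_zero) |>.1 h
        simp [derivative_mul, derivative_pow, hsx]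
      Dre := by
        intro x h1 h2
        obtain ⟨r, hr, hrx⟩ := all_real hsd hsr hs0 x (key x h1 h2)
        rw [← hrx]; simp
      H0 := hH0
      HT := hHT
      Tfin := H.Tfin }
  refine abstract_main hk hg G ?_ H.Tcard ?_
  · have : Dz (cx (-(h * s ^ 2))) = (fun r : ℝ => (r : ℂ)) '' (s.roots.toFinset : Set ℝ) := by
      ext x
      constructor
      · rintro ⟨h1, h2⟩
        obtain ⟨r, hr, hrx⟩ := all_real hsd hsr hs0 x (key x h1 h2)
        exact ⟨r, hr, hrx⟩
      · rintro ⟨r, hr, rfl⟩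
        apply key'
        rw [eval_cx_real]
        have : s.eval r = 0 := isRoot_of_mem_roots (Multiset.mem_toFinset.1 hr)
        rw [this]; simp
    rw [this, Set.InjOn.ncard_image (Complex.ofReal_injective.injOn), Set.ncard_coe_finset, hsr]
    omega
  · rw [Tr_card H]; exact hcount
end Polynomial.PN

namespace Polynomial.PN
open NC Filter Topology

/-- the base polynomial -/
noncomputable def RR (k : ℕ) (y : ℝ) : ℝ[X] := (1 + X) ^ (k - 1) * (1 + C y * X)

lemma ex_im (θ : ℝ) : (ex θ).im = Real.sin θ := by rw [ex, Complex.exp_ofReal_mul_I_im]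
lemma ex_re (θ : ℝ) : (ex θ).re = Real.cos θ := by rw [ex, Complex.exp_ofReal_mul_I_re]

section
variable {k : ℕ} {y : ℝ}

lemma RR_eq : RR k y = (1 + X) ^ (k - 1) + C y * (X * (1 + X) ^ (k - 1)) := by rw [RR]; ring

lemma RR_coeff_zero : (RR k y).coeff 0 = 1 := by
  rw [coeff_zero_eq_eval_zero, RR]; simp

lemma RR_coeff_succ (n : ℕ) : (RR k y).coeff (n + 1) = ((k - 1).choose (n + 1) : ℝ) + y * ((k - 1).choose n : ℝ) := by
  rw [RR_eq, coeff_add, coeff_C_mul, coeff_X_mul, coeff_one_add_X_pow, coeff_one_add_X_pow]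

lemma RR_pos (hk : 1 ≤ k) (hy : 0 < y) {n : ℕ} (hn : n ≤ k) : 0 < (RR k y).coeff n := by
  rcases n with _ | n
  · rw [RR_coeff_zero]; norm_num
  · rw [RR_coeff_succ]
    have : (0 : ℝ) < ((k - 1).choose n : ℝ) := by exact_mod_cast Nat.choose_pos (by omega)
    positivity

lemma RR_deg (hk : 1 ≤ k) : (RR k y).natDegree ≤ k := by
  rw [natDegree_le_iff_coeff_eq_zero]
  intro n hn
  rcases n with _ | n
  · omega
  · rw [RR_coeff_succ, Nat.choose_eq_zero_of_lt (by omega), Nat.choose_eq_zero_of_lt (by omega)]; simp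

lemma RR_cx (z : ℂ) : (cx (RR k y)).eval z = (1 + z) ^ (k - 1) * (1 + y * z) := by
  simp [RR, cx]

lemma RS.of_mul {A B : ℝ[X]} (H : RS (A * B)) : RS B := by
  refine ⟨right_ne_zero_of_mul H.ne, fun z hz => H.re z ?_, fun x hx h => H.si x ?_ ?_⟩
  · rw [cx, Polynomial.map_mul, eval_mul]; rw [cx] at hz; rw [hz, mul_zero]
  · rw [eval_mul, hx, mul_zero]
  · rw [derivative_mul, eval_add, eval_mul, eval_mul, hx, h]; ring

lemma RR_RS (hk : 1 ≤ k) (hy : 0 < y) {φ : ℝ} (hφ : 0 < Real.sin φ) : RS (sh φ (RR k y)) := by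
  apply RS.of_mul (A := X)
  rw [X_mul_sh]
  apply HB (G := C Complex.I * sc (ex (-φ)) (cx (RR k y)))
  · intro x
    rw [eval_mul, eval_C, sc_eval, Complex.mul_re, ev_im, Complex.I_re, Complex.I_im, zero_mul, zero_sub, one_mul,
      ← eval_neg]
    congr 1; ext n; rw [coeff_neg, sn_coeff, sn_coeff, mul_neg, Real.sin_neg]; ring
  · refine le_trans hk (le_natDegree_of_ne_zero ?_)
    rw [coeff_C_mul, sc_coeff, cx, coeff_map]
    have := (RR_pos hk hy (le_refl k)).ne'
    have h2 := ex_ne (-φ)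
    simp [this, h2]
  · intro z hz
    rw [eval_mul, eval_C, sc_eval, RR_cx] at hz
    have hw : ∀ c : ℝ, 0 < c → 1 + c * (ex (-φ) * z) = 0 → z.im < 0 := by
      intro c hc h
      have h1 : ex φ * ex (-φ) = 1 := by rw [← ex_add, add_neg_cancel, ex_zero]
      have h2 : ex φ + c * z = 0 := by linear_combination (ex φ) * h - c * z * h1
      have h3 := congrArg Complex.im h2
      simp [ex_im] at h3
      by_contra h4
      nlinarith [mul_nonneg hc.le (not_lt.1 h4)]
    rcases mul_eq_zero.1 hz with h | h
    · exact absurd h Complex.I_ne_zero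
    rcases mul_eq_zero.1 h with h | h
    · exact hw 1 one_pos (by have := eq_zero_of_pow_eq_zero h; simpa using this)
    · exact hw y hy h

lemma th_cos (hk : 0 < k) (m : ℕ) : Real.cos (k * th k m) = (-1) ^ m := by
  have hk' : (k : ℝ) ≠ 0 := by exact_mod_cast hk.ne'
  rw [th, mul_div_cancel₀ _ hk', mul_comm]; exact Real.cos_nat_mul_pi m

lemma p_top {m : ℕ} (hk : 2 ≤ k) (hm : 0 < m) (hmk : m < k) :
    (sh (th k m) (RR k y)).coeff (k - 2) = (RR k y).coeff (k - 1) * Real.sin (th k m) * (-1) ^ (m + 1) := by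
  rw [sh_coeff, show k - 2 + 1 = k - 1 by omega, (th_ang hm hmk).sk1 (by omega), th_cos (by omega)]; ring

lemma p_deg {m : ℕ} (hk : 2 ≤ k) (hy : 0 < y) (hm : 0 < m) (hmk : m < k) :
    (sh (th k m) (RR k y)).natDegree = k - 2 := by
  apply le_antisymm (sh_deg (th_ang hm hmk) (RR_deg (by omega)))
  apply le_natDegree_of_ne_zero
  rw [p_top hk hm hmk]
  have := RR_pos (y := y) (k := k) (n := k - 1) (by omega) hy (by omega)
  have := th_pos hmk hm
  positivity

lemma p_zero {φ : ℝ} : (sh φ (RR k y)).eval 0 = (RR k y).coeff 1 * Real.sin φ := by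
  rw [← coeff_zero_eq_eval_zero, sh_coeff]; simp

/-- finiteness of the bad parameters for coprimality -/
lemma cop_fin {A1 B1 A2 B2 : ℝ[X]} (hQ : A1 * B2 - A2 * B1 ≠ 0) (h : ∀ x, B1.eval x = 0 → A1.eval x ≠ 0) :
    {y : ℝ | ∃ x, (A1 + C y * B1).eval x = 0 ∧ (A2 + C y * B2).eval x = 0}.Finite := by
  apply ((A1 * B2 - A2 * B1).roots.toFinset.finite_toSet.image (fun x => - A1.eval x / B1.eval x)).subset
  rintro y ⟨x, h1, h2⟩
  simp only [eval_add, eval_mul, eval_C] at h1 h2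
  have hb : B1.eval x ≠ 0 := fun hb => h x hb (by rw [hb] at h1; simpa using h1)
  refine ⟨x, ?_, ?_⟩
  · simp only [Finset.mem_coe, Multiset.mem_toFinset, mem_roots hQ, IsRoot, eval_sub, eval_mul]
    linear_combination (B2.eval x) * h1 - (B1.eval x) * h2
  · simp only
    rw [div_eq_iff hb]; linarith

lemma p_cop (hk : 3 ≤ k) {m n : ℕ} (hm : 0 < m) (hmn : m < n) (hn : n < k) :
    {y : ℝ | ∃ x, (sh (th k m) (RR k y)).eval x = 0 ∧ (sh (th k n) (RR k y)).eval x = 0}.Finite := by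
  have e : ∀ φ y, sh φ (RR k y) = sh φ ((1 + X) ^ (k - 1)) + C y * sh φ (X * (1 + X) ^ (k - 1)) := by
    intro φ y; rw [RR_eq, sh_add, sh_C]
  simp only [e]
  have a0 : ∀ φ, (sh φ ((1 + X) ^ (k - 1))).coeff 0 = ((k - 1 : ℕ) : ℝ) * Real.sin φ := by
    intro φ; rw [sh_coeff, coeff_one_add_X_pow]; simp
  have a1 : ∀ φ, (sh φ ((1 + X) ^ (k - 1))).coeff 1 = ((k - 1).choose 2 : ℝ) * (2 * Real.sin φ * Real.cos φ) := by
    intro φ; rw [sh_coeff, coeff_one_add_X_pow, ← Real.sin_two_mul]; simp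
  have b0 : ∀ φ, (sh φ (X * (1 + X) ^ (k - 1))).coeff 0 = Real.sin φ := by
    intro φ; rw [sh_coeff, coeff_X_mul, coeff_one_add_X_pow]; simp
  have b1 : ∀ φ, (sh φ (X * (1 + X) ^ (k - 1))).coeff 1 = ((k - 1 : ℕ) : ℝ) * (2 * Real.sin φ * Real.cos φ) := by
    intro φ; rw [sh_coeff, coeff_X_mul, coeff_one_add_X_pow, ← Real.sin_two_mul]; simp
  have sm := th_pos (hmn.trans hn) hm
  have sn' := th_pos hn (hm.trans hmn)
  have hk' : (0 : ℝ) < k := by exact_mod_cast (by omega : 0 < k)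
  have hc : Real.cos (th k n) < Real.cos (th k m) := by
    apply Real.cos_lt_cos_of_nonneg_of_le_pi
    · rw [th]; positivity
    · rw [th, div_le_iff₀ hk']
      have : (n : ℝ) ≤ k := by exact_mod_cast hn.le
      nlinarith [Real.pi_pos]
    · rw [th, th]
      have : (m : ℝ) < n := by exact_mod_cast hmn
      gcongr
  apply cop_fin
  · intro h
    have h1 := congrArg (fun p => coeff p 1) h
    simp only [coeff_sub, coeff_zero] at h1
    rw [mul_coeff_one, mul_coeff_one, a0, a0, a1, a1, b0, b0, b1, b1] at h1
    have hpos : (0 : ℝ) < ((k - 1 : ℕ) : ℝ) ^ 2 - ((k - 1).choose 2 : ℝ) := by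
      rw [Nat.cast_choose_two]
      have : (2 : ℝ) ≤ ((k - 1 : ℕ) : ℝ) := by exact_mod_cast (by omega : 2 ≤ k - 1)
      nlinarith
    have h2 : (((k - 1 : ℕ) : ℝ) ^ 2 - ((k - 1).choose 2 : ℝ)) * (2 * Real.sin (th k m) * Real.sin (th k n) *
      (Real.cos (th k m) - Real.cos (th k n))) = 0 := by linear_combination -h1
    have : 0 < Real.cos (th k m) - Real.cos (th k n) := by linarith
    have := (show 0 < (((k - 1 : ℕ) : ℝ) ^ 2 - ((k - 1).choose 2 : ℝ)) * (2 * Real.sin (th k m) * Real.sin (th k n) *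
      (Real.cos (th k m) - Real.cos (th k n))) by positivity)
    linarith
  · intro x hB hA
    have hx : x ≠ 0 := by
      rintro rfl
      rw [← coeff_zero_eq_eval_zero, b0] at hB
      linarith
    have hA' : (sn (th k m) ((1 + X) ^ (k - 1))).eval x = 0 := by rw [← X_mul_sh, eval_mul, hA, mul_zero]
    have hB' : (sn (th k m) (X * (1 + X) ^ (k - 1))).eval x = 0 := by rw [← X_mul_sh, eval_mul, hB, mul_zero]
    rw [← ev_im] at hA' hB'
    have : cx (X * (1 + X) ^ (k - 1)) = X * cx ((1 + X) ^ (k - 1)) := by simp [cx]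
    rw [this, eval_mul, eval_X, Complex.mul_im, hA'] at hB'
    simp [ex_im] at hB'
    rcases hB' with h | h
    · rcases h with h | h
      · linarith
      · exact hx h
    · have h2 : (cx ((1 + X) ^ (k - 1))).eval (ex (th k m) * x) = 0 := by
        apply Complex.ext
        · simpa using h
        · rw [hA']; rfl
      simp [cx] at h2
      have h3 := congrArg Complex.im h2.1
      simp [ex_im] at h3
      rcases h3 with h | h
      · linarith
      · exact hx h
end
end Polynomial.PN

namespace Polynomial.PN
open NC Filter Topology

section
variable {k : ℕ} {y : ℝ}

lemma nsq_lin (ψ c : ℝ) : ‖1 + (c : ℂ) * ex ψ‖ ^ 2 = 1 + 2 * c * Real.cos ψ + c ^ 2 := by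
  rw [← Complex.normSq_eq_norm_sq, Complex.normSq_apply]
  simp [ex_im, ex_re]
  linear_combination c ^ 2 * Real.sin_sq_add_cos_sq ψ

lemma RR_lt (hk : 2 ≤ k) (hy : 0 < y) {ψ χ r : ℝ} (h : r * Real.cos ψ < r * Real.cos χ) :
    ‖(cx (RR k y)).eval (ex ψ * r)‖ < ‖(cx (RR k y)).eval (ex χ * r)‖ := by
  have key : ∀ c : ℝ, 0 < c → ‖1 + c * (ex ψ * r)‖ < ‖1 + c * (ex χ * r)‖ := by
    intro c hc
    rw [← sq_lt_sq₀ (norm_nonneg _) (norm_nonneg _)]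
    have e : ∀ ψ, (1 : ℂ) + c * (ex ψ * r) = 1 + ((c * r : ℝ) : ℂ) * ex ψ := by intro ψ; push_cast; ring
    rw [e, e, nsq_lin, nsq_lin]
    nlinarith [mul_lt_mul_of_pos_left h hc]
  rw [RR_cx, RR_cx, norm_mul, norm_mul, norm_pow, norm_pow]
  have h1 := key 1 one_pos
  rw [Complex.ofReal_one, one_mul, one_mul] at h1
  have h2 := key y hy
  apply mul_lt_mul'' _ h2 (by positivity) (by positivity)
  exact pow_lt_pow_left₀ h1 (norm_nonneg _) (by omega)

lemma cs_tri (θ φ : ℝ) (R : ℝ[X]) : 2 * sn θ (sn φ R) = cs (θ - φ) R - cs (θ + φ) R := by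
  ext n
  rw [show (2 : ℝ[X]) = C 2 from rfl, coeff_C_mul, coeff_sub, sn_coeff, sn_coeff, cs_coeff, cs_coeff,
    mul_add (n : ℝ) θ φ, mul_sub (n : ℝ) θ φ, Real.cos_add, Real.cos_sub]; ring

lemma N_pos (hk : 2 ≤ k) (hy : 0 < y) {θ φ : ℝ} (h1 : 0 < Real.sin θ) (h2 : 0 < Real.sin φ) (r : ℝ) :
    0 < (4 * (sh θ (cs φ (RR k y)) ^ 2 + sh θ (sn φ (RR k y)) ^ 2)).eval r := by
  rw [eval_mul, eval_ofNat, eval_add, eval_pow, eval_pow]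
  by_contra hc
  have a1 : (sh θ (cs φ (RR k y))).eval r = 0 := by
    nlinarith [sq_nonneg ((sh θ (cs φ (RR k y))).eval r), sq_nonneg ((sh θ (sn φ (RR k y))).eval r)]
  have a2 : (sh θ (sn φ (RR k y))).eval r = 0 := by
    nlinarith [sq_nonneg ((sh θ (cs φ (RR k y))).eval r), sq_nonneg ((sh θ (sn φ (RR k y))).eval r)]
  rcases eq_or_ne r 0 with rfl | hr
  · rw [← coeff_zero_eq_eval_zero, sh_coeff, cs_coeff] at a1
    rw [← coeff_zero_eq_eval_zero, sh_coeff, sn_coeff] at a2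
    have h3 := RR_pos (k := k) (n := 1) (by omega) hy (by omega)
    simp [h3.ne', h1.ne'] at a2
    linarith
  · have b1 : (sn θ (cs φ (RR k y))).eval r = 0 := by rw [← X_mul_sh, eval_mul, a1, mul_zero]
    have b2 : (sn θ (sn φ (RR k y))).eval r = 0 := by rw [← X_mul_sh, eval_mul, a2, mul_zero]
    have c1 := congrArg (eval r) (tri_add θ φ (RR k y))
    have c2 := congrArg (eval r) (tri_sub θ φ (RR k y))
    have c3 := congrArg (eval r) (cs_tri θ φ (RR k y))
    rw [eval_add, b1] at c1
    rw [eval_sub, b1] at c2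
    rw [eval_sub, eval_mul, b2] at c3
    have n1 := ev_nsq (θ + φ) (RR k y) r
    have n2 := ev_nsq (θ - φ) (RR k y) r
    have e : ‖(cx (RR k y)).eval (ex (θ + φ) * r)‖ ^ 2 = ‖(cx (RR k y)).eval (ex (θ - φ) * r)‖ ^ 2 := by
      rw [← n1, ← n2, ← c1, ← c2, show (cs (θ - φ) (RR k y)).eval r = (cs (θ + φ) (RR k y)).eval r by linarith]; ring
    have e' := (sq_eq_sq₀ (norm_nonneg _) (norm_nonneg _)).1 e
    have hcos : Real.cos (θ + φ) < Real.cos (θ - φ) := by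
      rw [Real.cos_add, Real.cos_sub]; nlinarith [mul_pos h1 h2]
    rcases lt_or_gt_of_ne hr with h | h
    · exact (RR_lt hk hy (mul_lt_mul_of_neg_left hcos h)).ne' e'
    · exact (RR_lt hk hy (mul_lt_mul_of_pos_left hcos h)).ne e'

lemma N_deg {l : ℕ} (hk : 2 ≤ k) (hy : 0 < y) (hl : 0 < l) (hlk : l < k) (φ : ℝ) :
    (4 * (sh (th k l) (cs φ (RR k y)) ^ 2 + sh (th k l) (sn φ (RR k y)) ^ 2)).natDegree = 2 * (k - 2) := by
  have d1 := sh_deg (th_ang hl hlk) (cs_deg (θ := φ) (RR_deg (k := k) (y := y) (by omega)))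
  have d2 := sh_deg (th_ang hl hlk) (sn_deg (θ := φ) (RR_deg (k := k) (y := y) (by omega)))
  apply le_antisymm
  · refine natDegree_mul_le.trans ?_
    rw [four_deg, zero_add]
    exact add_deg (natDegree_pow_le_of_le 2 d1) (natDegree_pow_le_of_le 2 d2)
  · apply le_natDegree_of_ne_zero
    rw [show (4 : ℝ[X]) = C 4 from rfl, coeff_C_mul, coeff_add, coeff_pow_of_natDegree_le d1,
      coeff_pow_of_natDegree_le d2, sh_coeff, sh_coeff, cs_coeff, sn_coeff, show k - 2 + 1 = k - 1 by omega]
    have h1 : Real.sin ((k - 1 : ℕ) * th k l) ≠ 0 := by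
      rw [(th_ang hl hlk).sk1 (by omega), th_cos (by omega)]
      have := th_pos hlk hl
      simp [this.ne']
    have h3 := RR_pos (k := k) (n := k - 1) (by omega) hy (by omega)
    rw [show ∀ a c s t : ℝ, 4 * ((a * c * t) ^ 2 + (a * s * t) ^ 2) = 4 * (a * t) ^ 2 * (s ^ 2 + c ^ 2) by intros; ring,
      Real.sin_sq_add_cos_sq]
    have := h3.ne'
    positivity

lemma th_add (m n : ℕ) : th k m + th k n = th k (m + n) := by
  rw [th, th, th]; push_cast; ring

lemma mid {l : ℕ} (hk : 3 ≤ k) (hy : 0 < y) (hl : 2 ≤ l) (hlk : l + 2 ≤ k)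
    (hc : ∀ x, (sh (th k (l - 1)) (RR k y)).eval x = 0 → (sh (th k (l + 1)) (RR k y)).eval x ≠ 0)
    {b e : ℝ → ℝ[X]} (hb : CP b) (he : CP e) (hb0 : b 0 = cs (th k 1) (RR k y))
    (he0 : e 0 = -(sn (th k 1) (RR k y)) ^ 2)
    (H : ∀ᶠ ν in 𝓝[>] (0 : ℝ), CU k (zt k) (cx (b ν)) (cx (e ν)) ∧ (e ν).coeff 0 ≤ 0 ∧ (e ν).coeff (2 * k) ≤ 0) :
    ∀ᶠ ν in 𝓝[>] (0 : ℝ), (Fl (th k l) (b ν) (e ν)).roots.toFinset.card = 2 * k := by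
  have t1 : th k l - th k 1 = th k (l - 1) := by
    rw [sub_eq_iff_eq_add, th_add]; congr 1; omega
  have d1 := p_deg (k := k) (y := y) (m := l - 1) (by omega) hy (by omega) (by omega)
  have d2 := p_deg (k := k) (y := y) (m := l + 1) (by omega) hy (by omega) (by omega)
  have r1 := RR_RS (k := k) (by omega) hy (th_pos (l := l - 1) (k := k) (by omega) (by omega))
  have r2 := RR_RS (k := k) (by omega) hy (th_pos (l := l + 1) (k := k) (by omega) (by omega))
  have s1 := th_pos (l := l - 1) (k := k) (by omega) (by omega)
  have s2 := th_pos (l := l + 1) (k := k) (by omega) (by omega)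
  have hA := r1.mul r2 hc
  have hdA : (sh (th k (l - 1)) (RR k y) * sh (th k (l + 1)) (RR k y)).natDegree = 2 * (k - 2) := by
    rw [natDegree_mul r1.ne r2.ne, d1, d2]; omega
  have R1 := RR_pos (k := k) (n := 1) (by omega) hy (by omega)
  have R2 := RR_pos (k := k) (n := k - 1) (by omega) hy (by omega)
  have main := count_mid (l := 𝓝[>] (0 : ℝ)) (G := fun ν => Fl (th k l) (b ν) (e ν)) (D := 4 * k - 4)
    (A := sh (th k (l - 1)) (RR k y) * sh (th k (l + 1)) (RR k y))
    (N := 4 * (sh (th k l) (cs (th k 1) (RR k y)) ^ 2 + sh (th k l) (sn (th k 1) (RR k y)) ^ 2))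
    (by rw [show 4 * k - 4 = 2 * (2 * k - 2) by omega]; exact even_two_mul _)
    (by filter_upwards [H] with ν h; exact (Fl_top_neg h.1 (by omega) (by omega) h.2.2).1)
    (by
      intro n
      have := (hb.Fl he (th k l)).tend n
      simp only [hb0, he0] at this
      rwa [Fl_base, t1, th_add] at this)
    hA
    (by rw [eval_mul, p_zero, p_zero]; positivity)
    (by
      rw [leadingCoeff_mul, leadingCoeff, leadingCoeff, d1, d2, p_top (by omega) (by omega) (by omega),
        p_top (by omega) (by omega) (by omega), show l + 1 + 1 = (l - 1 + 1) + 2 by omega, pow_add (-1 : ℝ) (l - 1 + 1) 2]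
      have : ((-1 : ℝ) ^ (l - 1 + 1)) ^ 2 = 1 := by rw [← pow_mul, mul_comm, pow_mul]; simp
      generalize (-1 : ℝ) ^ (l - 1 + 1) = u at *
      have : 0 < (RR k y).coeff (k - 1) * Real.sin (th k (l - 1)) * ((RR k y).coeff (k - 1) * Real.sin (th k (l + 1))) := by positivity
      nlinarith)
    (N_pos (by omega) hy (th_pos (by omega) (by omega)) (th_pos (by omega) (by omega)))
    (by rw [hdA, N_deg (by omega) hy (by omega) (by omega)]; omega)
    (by filter_upwards [H] with ν h; exact Fl_zero_neg h.1 (by omega) (by omega) h.2.1)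
    (by filter_upwards [H] with ν h; exact (Fl_top_neg h.1 (by omega) (by omega) h.2.2).2)
  filter_upwards [main] with ν h
  rw [h, hdA]; omega
end
end Polynomial.PN

namespace Polynomial.PN
open NC Filter Topology

lemma zfin {c w : ℂ} (hc : c ≠ 0) (hw : w.im ≠ 0) {N : ℕ} (hN : 0 < N) : {z : ℝ | (c * (w - z) ^ N).re = 0}.Finite := by
  set H : ℂ[X] := C c * (C w - X) ^ N + C (starRingEnd ℂ c) * (C (starRingEnd ℂ w) - X) ^ N with hH
  have h0 : H ≠ 0 := by
    intro h
    have h1 := congrArg (eval w) h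
    simp [hH, hN.ne', hc] at h1
    have := congrArg Complex.im h1
    simp at this
    apply hw; linarith
  refine Set.Finite.subset (Set.Finite.preimage (Complex.ofReal_injective.injOn) (H.roots.toFinset.finite_toSet)) ?_
  intro z hz
  simp only [Set.mem_preimage, Finset.mem_coe, Multiset.mem_toFinset, mem_roots h0, IsRoot]
  have hz : (c * (w - z) ^ N).re = 0 := hz
  have := Complex.add_conj (c * (w - z) ^ N)
  rw [hz] at this
  simp at this
  simpa [hH] using this

/-- first-order factor on the first ray -/
noncomputable def MM (θ : ℝ) (q m : ℝ[X]) : ℝ[X] := cs θ q * cs θ m + sn θ q * sn θ m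

lemma MM_re (θ : ℝ) (q m : ℝ[X]) (r : ℝ) :
    (MM θ q m).eval r = ((cx q).eval (ex (-θ) * r) * (cx m).eval (ex θ * r)).re := by
  rw [Complex.mul_re, ev_re, ev_re, ev_im, ev_im, MM, eval_add, eval_mul, eval_mul]
  have h1 : cs (-θ) q = cs θ q := by ext n; rw [cs_coeff, cs_coeff, mul_neg, Real.cos_neg]
  have h2 : sn (-θ) q = - sn θ q := by ext n; rw [coeff_neg, sn_coeff, sn_coeff, mul_neg, Real.sin_neg]; ring
  rw [h1, h2, eval_neg]; ring

lemma MM_RS {θ : ℝ} (hθ : 0 < Real.sin θ) {q m : ℝ[X]} (hq0 : q ≠ 0) (hm0 : m ≠ 0) (hd : 1 ≤ m.natDegree)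
    (hq : ∀ z : ℂ, (cx q).eval z = 0 → z.im = 0 ∧ z.re < 0)
    (hm : ∀ z : ℂ, (cx m).eval z = 0 → z.im = 0 ∧ 0 < z.re) : RS (MM θ q m) := by
  apply HB (G := sc (ex (-θ)) (cx q) * sc (ex θ) (cx m))
  · intro x; rw [MM_re, eval_mul, sc_eval, sc_eval]
  · have inj : Function.Injective (algebraMap ℝ ℂ) := Complex.ofReal_injective
    have e : ∀ (φ : ℝ) (p : ℝ[X]), p ≠ 0 → (sc (ex φ) (cx p)).coeff p.natDegree ≠ 0 := by
      intro φ p hp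
      rw [sc_coeff, cx, coeff_map]
      exact mul_ne_zero (by simpa using hp) (pow_ne_zero _ (ex_ne _))
    have n1 : sc (ex (-θ)) (cx q) ≠ 0 := fun h => e (-θ) q hq0 (by rw [h, coeff_zero])
    have n2 : sc (ex θ) (cx m) ≠ 0 := fun h => e θ m hm0 (by rw [h, coeff_zero])
    rw [natDegree_mul n1 n2]
    have := le_natDegree_of_ne_zero (e θ m hm0)
    omega
  · intro z hz
    rw [eval_mul, sc_eval, sc_eval] at hz
    have key : ∀ φ, ex (-φ) * ex φ = 1 := by intro φ; rw [← ex_add, neg_add_cancel, ex_zero]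
    rcases mul_eq_zero.1 hz with h | h
    · obtain ⟨h1, h2⟩ := hq _ h
      have e : z = ex θ * (ex (-θ) * z) := by linear_combination -z * key θ
      rw [e, Complex.mul_im, h1, ex_im, ex_re]
      nlinarith
    · obtain ⟨h1, h2⟩ := hm _ h
      have e : z = ex (-θ) * (ex θ * z) := by linear_combination -z * key θ
      rw [e, Complex.mul_im, h1, ex_im, ex_re, Real.sin_neg]
      nlinarith

lemma MM_deg {θ : ℝ} {q m : ℝ[X]} (hq0 : q ≠ 0) (hm0 : m ≠ 0)
    (h : Real.cos (m.natDegree * θ - q.natDegree * θ) ≠ 0) : (MM θ q m).natDegree = q.natDegree + m.natDegree := by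
  apply le_antisymm
  · exact add_deg (natDegree_mul_le.trans (add_le_add (cs_deg le_rfl) (cs_deg le_rfl)))
      (natDegree_mul_le.trans (add_le_add (sn_deg le_rfl) (sn_deg le_rfl)))
  · apply le_natDegree_of_ne_zero
    rw [MM, coeff_add, coeff_mul_add_eq_of_natDegree_le (cs_deg le_rfl) (cs_deg le_rfl),
      coeff_mul_add_eq_of_natDegree_le (sn_deg le_rfl) (sn_deg le_rfl), cs_coeff, cs_coeff, sn_coeff, sn_coeff]
    rw [Real.cos_sub] at h
    have : (q.leadingCoeff * m.leadingCoeff) * (Real.cos (m.natDegree * θ) * Real.cos (q.natDegree * θ) +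
      Real.sin (m.natDegree * θ) * Real.sin (q.natDegree * θ)) ≠ 0 :=
        mul_ne_zero (mul_ne_zero (leadingCoeff_ne_zero.2 hq0) (leadingCoeff_ne_zero.2 hm0)) h
    intro h2; apply this; rw [← h2, leadingCoeff, leadingCoeff]; ring

lemma MM_zero (θ : ℝ) (q m : ℝ[X]) : (MM θ q m).eval 0 = q.eval 0 * m.eval 0 := by
  rw [MM]; simp only [eval_add, eval_mul, ← coeff_zero_eq_eval_zero, cs_coeff, sn_coeff]; simp

lemma sq_deg (θ : ℝ) (t : ℝ[X]) : ((cs θ t) ^ 2 + (sn θ t) ^ 2).natDegree = 2 * t.natDegree := by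
  rcases eq_or_ne t 0 with rfl | h
  · have h1 : cs θ 0 = 0 := by ext; simp [cs_coeff]
    have h2 : sn θ 0 = 0 := by ext; simp [sn_coeff]
    simp [h1, h2]
  apply le_antisymm
  · exact add_deg (natDegree_pow_le_of_le 2 (cs_deg le_rfl)) (natDegree_pow_le_of_le 2 (sn_deg le_rfl))
  · apply le_natDegree_of_ne_zero
    rw [coeff_add, coeff_pow_of_natDegree_le (cs_deg le_rfl), coeff_pow_of_natDegree_le (sn_deg le_rfl), cs_coeff, sn_coeff,
      mul_pow, mul_pow, ← mul_add, Real.cos_sq_add_sin_sq, mul_one]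
    exact pow_ne_zero _ (leadingCoeff_ne_zero.2 h)

section
variable {k g : ℕ} {y : ℝ}

set_option maxHeartbeats 1000000 in
lemma one {q t m : ℝ[X]} (hk : 3 ≤ k) (hg : g + 3 ≤ k) (hy : 0 < y) (hqt : q * t = sh (th k 1) (RR k y))
    (hq : ∀ z : ℂ, (cx q).eval z = 0 → z.im = 0 ∧ z.re < 0) (hqd : q.natDegree = g + 1)
    (hm : ∀ z : ℂ, (cx m).eval z = 0 → z.im = 0 ∧ 0 < z.re) (hmd : m.natDegree = k + g + 1)
    (hc : ∀ x, (sh (th k 2) (RR k y)).eval x = 0 → (MM (th k 1) q m).eval x ≠ 0)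
    {b2 e2 : ℝ → ℝ[X]} (hb : CP b2) (he : CP e2)
    (H : ∀ᶠ ν in 𝓝[>] (0 : ℝ), CU k (zt k) (cx (cs (th k 1) (RR k y) + C (ν ^ 2) * b2 ν))
        (cx (-(sn (th k 1) (RR k y)) ^ 2 + C ν * (-2 * (X * t) * m) + C (ν ^ 2) * e2 ν)) ∧
      (-(sn (th k 1) (RR k y)) ^ 2 + C ν * (-2 * (X * t) * m) + C (ν ^ 2) * e2 ν).coeff (2 * k) ≤ 0) :
    ∀ᶠ ν in 𝓝[>] (0 : ℝ), (Fl (th k 1) (cs (th k 1) (RR k y) + C (ν ^ 2) * b2 ν)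
      (-(sn (th k 1) (RR k y)) ^ 2 + C ν * (-2 * (X * t) * m) + C (ν ^ 2) * e2 ν)).roots.toFinset.card = 2 * k + 2 * g + 2 := by
  have s1 := th_pos (l := 1) (k := k) (by omega) (by omega)
  have s2 := th_pos (l := 2) (k := k) (by omega) (by omega)
  have hp1 := RR_RS (k := k) (by omega) hy s1
  have hp2 := RR_RS (k := k) (by omega) hy s2
  have d1 := p_deg (k := k) (y := y) (m := 1) (by omega) hy (by omega) (by omega)
  have d2 := p_deg (k := k) (y := y) (m := 2) (by omega) hy (by omega) (by omega)
  have R1 := RR_pos (k := k) (n := 1) (by omega) hy (by omega)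
  have hp1' := hp1
  rw [← hqt] at hp1'
  have hq0 : q ≠ 0 := left_ne_zero_of_mul hp1'.ne
  have ht0 : t ≠ 0 := right_ne_zero_of_mul hp1'.ne
  have hm0 : m ≠ 0 := by rintro rfl; simp at hmd
  have htd : t.natDegree = k - g - 3 := by
    rw [← hqt, natDegree_mul hq0 ht0] at d1; omega
  have hrt := hp1'.of_mul
  have hz : q.eval 0 * t.eval 0 ≠ 0 := by
    rw [← eval_mul, hqt, p_zero]; positivity
  have hm00 : m.eval 0 ≠ 0 := by
    intro h
    have := hm (0 : ℝ) (by rw [eval_cx_real, h]; simp)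
    simp at this
  have h2th : 2 * th k 1 = th k 2 := by rw [two_mul, th_add]
  have hF0 : Fl (th k 1) (cs (th k 1) (RR k y)) (-(sn (th k 1) (RR k y)) ^ 2) = 0 := by
    rw [Fl_base, sub_self, show sh 0 (RR k y) = 0 by ext n; simp [sh_coeff]]; ring
  obtain ⟨W, hW, hF⟩ := Fl_expand (th k 1) (e1 := -2 * (X * t) * m) hb he hF0
  rw [L1_eq (q0 := q) (by rw [← X_mul_sh, ← hqt]; ring), h2th] at hF
  change ∀ ν, _ = C ν * (X * (sh (th k 2) (RR k y) * MM (th k 1) q m) * (-4 * ((cs (th k 1) t) ^ 2 + (sn (th k 1) t) ^ 2)) + C ν * W ν) at hF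
  have hM := MM_RS s1 hq0 hm0 (by omega) hq hm
  have hA := RS.X.mul (hp2.mul hM hc) (by
    intro x hx
    rw [eval_X] at hx; subst hx
    rw [eval_mul, p_zero, MM_zero]
    have := left_ne_zero_of_mul hz
    positivity)
  have hMd : (MM (th k 1) q m).natDegree = k + 2 * g + 2 := by
    rw [MM_deg hq0 hm0, hqd, hmd]
    · omega
    · rw [hqd, hmd, show ((k + g + 1 : ℕ) : ℝ) * th k 1 - ((g + 1 : ℕ) : ℝ) * th k 1 = k * th k 1 by push_cast; ring,
        th_cos (by omega)]
      norm_num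
  have hAd : (X * (sh (th k 2) (RR k y) * MM (th k 1) q m)).natDegree = 2 * k + 2 * g + 1 := by
    rw [natDegree_mul X_ne_zero (mul_ne_zero hp2.ne hM.ne), natDegree_X, natDegree_mul hp2.ne hM.ne, d2, hMd]; omega
  have hNd : (-4 * ((cs (th k 1) t) ^ 2 + (sn (th k 1) t) ^ 2)).natDegree = 2 * (k - g - 3) := by
    rw [show (-4 : ℝ[X]) = C (-4) by rw [C_neg]; rfl, natDegree_C_mul (by norm_num), sq_deg, htd]
  have hf : ∀ᶠ ν in 𝓝[>] (0 : ℝ), 0 < ν := eventually_mem_nhdsWithin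
  have hdc : ∀ (ν : ℝ), 0 < ν → ∀ (P : ℝ[X]), (C ν * P).natDegree = P.natDegree := fun ν h P => natDegree_C_mul h.ne'
  have main := count_one (l := 𝓝[>] (0 : ℝ)) (D := 4 * k - 4)
    (G := fun ν => X * (sh (th k 2) (RR k y) * MM (th k 1) q m) * (-4 * ((cs (th k 1) t) ^ 2 + (sn (th k 1) t) ^ 2)) + C ν * W ν)
    (A := X * (sh (th k 2) (RR k y) * MM (th k 1) q m)) (N := -4 * ((cs (th k 1) t) ^ 2 + (sn (th k 1) t) ^ 2))
    (by rw [show 4 * k - 4 = 2 * (2 * k - 2) by omega]; exact even_two_mul _)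
    (by
      filter_upwards [H, hf] with ν h h0
      have := (Fl_top_neg h.1 (l := 1) (by omega) (by omega) h.2).1
      rwa [hF, hdc ν h0] at this)
    (by
      intro n
      have := (((CP.const (X * (sh (th k 2) (RR k y) * MM (th k 1) q m) * (-4 * ((cs (th k 1) t) ^ 2 + (sn (th k 1) t) ^ 2)))).add
        ((CP.C continuous_id).mul hW))).tend n
      simpa using this)
    hA
    (by
      intro x h
      rw [eval_mul, eval_add, eval_pow, eval_pow, ev_nsq] at h
      have h : (cx t).eval (ex (th k 1) * x) = 0 := by
        rcases mul_eq_zero.1 h with h | h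
        · exfalso; simp at h
        · exact norm_eq_zero.1 (eq_zero_of_pow_eq_zero h)
      have h1 := hrt.re _ h
      rw [Complex.mul_im, ex_im, ex_re] at h1
      simp at h1
      rcases h1 with h1 | h1
      · exact s1.ne' h1
      · subst h1
        rw [Complex.ofReal_zero, mul_zero, show (0 : ℂ) = ((0 : ℝ) : ℂ) by simp, eval_cx_real] at h
        exact (right_ne_zero_of_mul hz) (by exact_mod_cast h))
    (by rw [hAd, hNd]; omega)
    (by
      filter_upwards [H, hf] with ν h h0
      have := (Fl_top_neg h.1 (l := 1) (by omega) (by omega) h.2).2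
      rw [hF, coeff_C_mul] at this
      by_contra hh
      nlinarith [mul_nonneg h0.le (not_lt.1 hh)])
  filter_upwards [main, hf] with ν h h0
  rw [hF, roots_C_mul _ h0.ne', h, hAd]
end
end Polynomial.PN

namespace Polynomial.PN
open NC Filter Topology

lemma select (S : Finset ℝ) (n : ℕ) (hn : n ≤ S.card) :
    ∃ J ⊆ S, J.card = n ∧ ∀ a ∈ J, ∀ b ∈ S \ J, a < b := by
  classical
  induction n with
  | zero => exact ⟨∅, by simp, by simp, by simp⟩
  | succ n ih =>
    obtain ⟨J, hJ, hc, hl⟩ := ih (by omega)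
    have hne : (S \ J).Nonempty := by
      rw [← Finset.card_pos, Finset.card_sdiff_of_subset hJ]; omega
    have hmem := Finset.min'_mem _ hne
    set c := (S \ J).min' hne with hcdef
    rw [Finset.mem_sdiff] at hmem
    refine ⟨insert c J, ?_, ?_, ?_⟩
    · intro x hx
      rcases Finset.mem_insert.1 hx with rfl | h
      · exact hmem.1
      · exact hJ h
    · rw [Finset.card_insert_of_notMem hmem.2, hc]
    · intro a ha b hb
      rw [Finset.mem_sdiff, Finset.mem_insert, not_or] at hb
      have hb' : b ∈ S \ J := Finset.mem_sdiff.2 ⟨hb.1, hb.2.2⟩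
      rcases Finset.mem_insert.1 ha with rfl | h
      · exact lt_of_le_of_ne (Finset.min'_le _ _ hb') (Ne.symm hb.2.1)
      · exact hl a h b hb'

lemma p1_neg {k : ℕ} {y : ℝ} (hk : 3 ≤ k) (hy : 0 < y) {x : ℝ} (hx : (sh (th k 1) (RR k y)).eval x = 0) : x < 0 := by
  by_contra hc
  rw [not_lt] at hc
  have hpos : ∀ n ≤ k - 2, 0 < (sh (th k 1) (RR k y)).coeff n := by
    intro n hn
    rw [sh_coeff]
    apply mul_pos (RR_pos (by omega) hy (by omega))
    have := th_pos (k := k) (l := n + 1) (by omega) (by omega)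
    rwa [show ((n + 1 : ℕ) : ℝ) * th k 1 = th k (n + 1) by rw [th, th]; push_cast; ring]
  rw [eval_range (p_deg (m := 1) (by omega) hy (by omega) (by omega)).le] at hx
  have : 0 < ∑ n ∈ Finset.range (k - 2 + 1), (sh (th k 1) (RR k y)).coeff n * x ^ n := by
    apply Finset.sum_pos'
    · intro n hn
      have := hpos n (by rw [Finset.mem_range] at hn; omega)
      positivity
    · exact ⟨0, by simp, by simpa using hpos 0 (by omega)⟩
  linarith

/-- joint continuity -/
lemma CP.joint {G : ℝ → ℝ[X]} (h : CP G) {d : ℕ} (hd : ∀ ν, (G ν).natDegree ≤ d) :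
    Continuous (fun z : ℝ × ℝ => (G z.1).eval z.2) := by
  have : (fun z : ℝ × ℝ => (G z.1).eval z.2) = fun z : ℝ × ℝ => ∑ n ∈ Finset.range (d + 1), (G z.1).coeff n * z.2 ^ n :=
    _root_.funext fun z => eval_range (hd z.1) z.2
  rw [this]
  exact continuous_finsetSum _ fun n _ => ((h n).comp continuous_fst).mul (continuous_snd.pow n)

lemma cpt_pos {K : Set ℝ} (hK : IsCompact K) {A B : ℝ[X]} {E : ℝ → ℝ[X]} (hE : CP E) {d : ℕ} (hd : ∀ ν, (E ν).natDegree ≤ d)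
    (hA : ∀ x, 0 ≤ A.eval x) (hB : ∀ x, A.eval x = 0 → 0 < B.eval x) :
    ∀ᶠ ν in 𝓝[>] (0 : ℝ), ∀ x ∈ K, 0 < (A + C ν * B + C (ν ^ 2) * E ν).eval x := by
  have cE := hE.joint hd
  have cA : Continuous (fun z : ℝ × ℝ => A.eval z.2) := A.continuous.comp continuous_snd
  have cB : Continuous (fun z : ℝ × ℝ => B.eval z.2) := B.continuous.comp continuous_snd
  have main : ∀ᶠ ν in 𝓝 (0 : ℝ), ∀ x ∈ K, 0 < ν → 0 < (A + C ν * B + C (ν ^ 2) * E ν).eval x := by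
    apply hK.eventually_forall_of_forall_eventually
    intro x hx
    simp only [eval_add, eval_mul, eval_C]
    rcases (hA x).eq_or_lt' with h | h
    · have h1 : Continuous (fun z : ℝ × ℝ => B.eval z.2 + z.1 * (E z.1).eval z.2) := cB.add (continuous_fst.mul cE)
      have h2 := h1.tendsto (0, x)
      have h3 := h2.eventually_const_lt (show (0 : ℝ) < _ by simpa using hB x h)
      filter_upwards [h3] with z hz h0
      nlinarith [hA z.2, mul_pos h0 hz]
    · have h1 : Continuous (fun z : ℝ × ℝ => A.eval z.2 + z.1 * B.eval z.2 + z.1 ^ 2 * (E z.1).eval z.2) :=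
        (cA.add (continuous_fst.mul cB)).add ((continuous_fst.pow 2).mul cE)
      have h2 := h1.tendsto (0, x)
      have h3 := h2.eventually_const_lt (show (0 : ℝ) < _ by simpa using h)
      filter_upwards [h3] with z hz h0
      exact hz
  have hf : ∀ᶠ ν in 𝓝[>] (0 : ℝ), 0 < ν := eventually_mem_nhdsWithin
  filter_upwards [main.filter_mono nhdsWithin_le_nhds, hf] with ν h h0 x hx
  exact h x hx h0

lemma refl_eval {p : ℝ[X]} {d : ℕ} (h : p.natDegree ≤ d) {x : ℝ} (hx : x ≠ 0) : (reflect d p).eval x⁻¹ * x ^ d = p.eval x := by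
  let _ := invertibleOfNonzero hx
  have := eval₂_reflect_mul_pow (RingHom.id ℝ) x d p h
  rw [invOf_eq_inv] at this
  exact this

lemma h_pos {d : ℕ} {q h1 : ℝ[X]} (hq : q.Monic) (hqd : q.natDegree = d) (h1d : h1.natDegree ≤ 2 * d)
    {h2 : ℝ → ℝ[X]} (hh : CP h2) (hd : ∀ ν, (h2 ν).natDegree ≤ 2 * d) (hp : ∀ x, q.eval x = 0 → 0 < h1.eval x) :
    ∀ᶠ ν in 𝓝[>] (0 : ℝ), ∀ x, 0 < (q ^ 2 + C ν * h1 + C (ν ^ 2) * h2 ν).eval x := by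
  have hq2 : (q ^ 2).natDegree ≤ 2 * d := natDegree_pow_le_of_le 2 hqd.le
  have hev : ∀ x : ℝ, 0 ≤ x ^ (2 * d) := fun x => by rw [pow_mul]; positivity
  have r0 : (reflect (2 * d) (q ^ 2)).eval 0 = 1 := by
    rw [← coeff_zero_eq_eval_zero, coeff_reflect, revAt_le (by omega), Nat.sub_zero, coeff_pow_of_natDegree_le hqd.le]
    rw [Monic, leadingCoeff, hqd] at hq
    rw [hq]; simp
  have rp : ∀ (p : ℝ[X]), p.natDegree ≤ 2 * d → ∀ x : ℝ, x ≠ 0 → (reflect (2 * d) p).eval x = x ^ (2 * d) * p.eval x⁻¹ := by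
    intro p hp x hx
    have := refl_eval hp (inv_ne_zero hx)
    rw [inv_inv] at this
    have h3 : x⁻¹ ^ (2 * d) * x ^ (2 * d) = 1 := by rw [← mul_pow, inv_mul_cancel₀ hx, one_pow]
    rw [← this]; linear_combination -(reflect (2 * d) p).eval x * h3
  have e1 := cpt_pos (K := Set.Icc (-1) 1) isCompact_Icc (A := q ^ 2) (B := h1) hh hd
    (fun x => by rw [eval_pow]; positivity) (fun x hx => hp x (by rw [eval_pow] at hx; exact eq_zero_of_pow_eq_zero hx))
  have e2 := cpt_pos (K := Set.Icc (-1) 1) isCompact_Icc (A := reflect (2 * d) (q ^ 2)) (B := reflect (2 * d) h1)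
    (E := fun ν => reflect (2 * d) (h2 ν)) (d := 2 * d)
    (fun n => by simpa only [coeff_reflect] using hh _)
    (fun ν => by
      refine (natDegree_le_iff_coeff_eq_zero).2 fun N hN => ?_
      rw [coeff_reflect, revAt_eq_self_of_lt hN]
      exact (natDegree_le_iff_coeff_eq_zero).1 (hd ν) N hN)
    (fun x => by
      rcases eq_or_ne x 0 with rfl | hx
      · rw [r0]; norm_num
      · rw [rp _ hq2 x hx, eval_pow]; exact mul_nonneg (hev x) (sq_nonneg _))
    (fun x h => by
      rcases eq_or_ne x 0 with rfl | hx
      · rw [r0] at h; norm_num at h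
      · rw [rp _ hq2 x hx, eval_pow] at h
        rw [rp _ h1d x hx]
        have hx2 : 0 < x ^ (2 * d) := lt_of_le_of_ne (hev x) (pow_ne_zero _ hx).symm
        refine mul_pos hx2 (hp _ ?_)
        exact eq_zero_of_pow_eq_zero ((mul_eq_zero.1 h).resolve_left hx2.ne'))
  filter_upwards [e1, e2] with ν a1 a2 x
  by_cases hx : x ∈ Set.Icc (-1 : ℝ) 1
  · exact a1 x hx
  · have hx1 : 1 < |x| := by
      rw [Set.mem_Icc, ← abs_le] at hx; exact not_le.1 hx
    have hx0 : x ≠ 0 := by rintro rfl; simp at hx1; linarith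
    have := a2 x⁻¹ (by rw [Set.mem_Icc, ← abs_le, abs_inv]; exact inv_le_one_of_one_le₀ hx1.le)
    simp only [eval_add, eval_mul, eval_C] at this ⊢
    rw [rp _ hq2 _ (inv_ne_zero hx0), rp _ h1d _ (inv_ne_zero hx0), rp _ (hd ν) _ (inv_ne_zero hx0), inv_inv] at this
    have hx2 : 0 < x⁻¹ ^ (2 * d) := lt_of_le_of_ne (hev _) (pow_ne_zero _ (inv_ne_zero hx0)).symm
    by_contra hc
    nlinarith [mul_nonneg hx2.le (neg_nonneg.2 (not_lt.1 hc))]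

lemma s_roots {n : ℕ} {s0 : ℝ[X]} {s : ℝ → ℝ[X]} (hs : CP s) (h0 : s 0 = s0) (hS : RS s0) (hd0 : s0.natDegree = n)
    (H : ∀ᶠ ν in 𝓝[>] (0 : ℝ), (cx (s ν)).Separable ∧ (s ν).natDegree = n + 1) :
    ∀ᶠ ν in 𝓝[>] (0 : ℝ), (s ν).roots.toFinset.card = n + 1 := by
  classical
  have ht : ∀ n, Tendsto (fun ν => (s ν).coeff n) (𝓝[>] 0) (𝓝 (s0.coeff n)) := by
    intro n; have := hs.tend n; rwa [h0] at this
  have hd : ∀ᶠ ν in 𝓝[>] (0 : ℝ), (s ν).natDegree ≤ n + 1 := by filter_upwards [H] with ν h; exact h.2.le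
  have hE : ∀ x, Tendsto (fun ν => (s ν).eval x) (𝓝[>] 0) (𝓝 (s0.eval x)) := fun x =>
    tendsto_eval hd (lim_deg hd ht) ht tendsto_const_nhds
  have LB := lb_roots (l := 𝓝[>] (0 : ℝ)) (G := s) (ι := s0.roots.toFinset) (fun r => 𝓝 (r : ℝ))
    (fun a b hab => dj_nhds (fun h => hab (Subtype.ext h)))
    (fun r => tg_simple hE (isRoot_of_mem_roots (Multiset.mem_toFinset.1 r.2))
      (hS.si _ (isRoot_of_mem_roots (Multiset.mem_toFinset.1 r.2))))
    (by filter_upwards [H] with ν h h1; rw [h1] at h; simp at h)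
  filter_upwards [LB, H] with ν h1 h2
  rw [Fintype.card_coe, hS.card', hd0] at h1
  have hsep : (s ν).Separable := by
    have := h2.1; rwa [cx, separable_map] at this
  rw [Multiset.toFinset_card_of_nodup (nodup_roots hsep)] at h1 ⊢
  obtain ⟨p, e1, e2, e3⟩ := exists_prod_multiset_X_sub_C_mul (s ν)
  rw [h2.2] at e2
  by_contra hc
  have hp1 : p.natDegree = 1 := by omega
  obtain ⟨x, hx⟩ := exists_root_of_degree_eq_one (p := p) ((degree_eq_iff_natDegree_eq_of_pos one_pos).2 hp1)
  have hp0 : p ≠ 0 := by rintro rfl; simp at hp1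
  have : x ∈ p.roots := (mem_roots hp0).2 hx
  rw [e3] at this; simp at this
end Polynomial.PN

namespace Polynomial.PN
open NC Filter Topology

section
variable {k g : ℕ} {y : ℝ}

lemma data1 (hk : 3 ≤ k) (hg : g + 3 ≤ k) (hy : 0 < y) : ∃ (q t : ℝ[X]) (σ : ℝ), σ ≠ 0 ∧ q.Monic ∧ q.natDegree = g + 1 ∧
    q * t = sh (th k 1) (RR k y) ∧ (∀ x, q.eval x = 0 → x < 0 ∧ 0 < σ * (X * t).eval x) ∧
    (∀ z : ℂ, (cx q).eval z = 0 → z.im = 0 ∧ z.re < 0) ∧ IsCoprime (X * t) (q ^ 2) := by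
  classical
  have hp1 := RR_RS (k := k) (by omega) hy (th_pos (l := 1) (k := k) (by omega) (by omega))
  have d1 := p_deg (k := k) (y := y) (m := 1) (by omega) hy (by omega) (by omega)
  set p := sh (th k 1) (RR k y) with hp
  have hneg : ∀ x, p.eval x = 0 → x < 0 := fun x hx => p1_neg hk hy hx
  obtain ⟨J, hJ, hJc, hJl⟩ := select p.roots.toFinset (g + 1) (by rw [hp1.card', d1]; omega)
  have hpe : C p.leadingCoeff * (p.roots.map fun a => X - C a).prod = p :=
    C_leadingCoeff_mul_prod_multiset_X_sub_C hp1.card.1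
  have hpm : (p.roots.map fun a => X - C a).prod = ∏ a ∈ p.roots.toFinset, (X - C a) := by
    rw [Finset.prod_multiset_map_count]
    apply Finset.prod_congr rfl
    intro a ha
    rw [Multiset.count_eq_one_of_mem hp1.card.2 (Multiset.mem_toFinset.1 ha), pow_one]
  have hJn : ∀ a ∈ J, a < 0 := fun a ha => hneg a (isRoot_of_mem_roots (Multiset.mem_toFinset.1 (hJ ha)))
  set K := p.roots.toFinset \ J with hK
  have hlc : p.leadingCoeff ≠ 0 := leadingCoeff_ne_zero.2 hp1.ne
  have hroot : ∀ x : ℝ, (∏ a ∈ J, (X - C a)).eval x = 0 → x ∈ J := by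
    intro x hx
    rw [eval_prod, Finset.prod_eq_zero_iff] at hx
    obtain ⟨a, ha, h⟩ := hx
    simp [sub_eq_zero] at h
    rwa [h]
  have hpos : ∀ x ∈ J, 0 < (-(p.leadingCoeff * (-1) ^ K.card)) * (X * (C p.leadingCoeff * ∏ a ∈ K, (X - C a))).eval x := by
    intro x hx
    have h1 : (∏ a ∈ K, (x - a)) = (-1) ^ K.card * ∏ a ∈ K, (a - x) := by
      rw [← Finset.prod_const, ← Finset.prod_mul_distrib]
      exact Finset.prod_congr rfl fun a _ => by ring
    have h2 : 0 < ∏ a ∈ K, (a - x) := Finset.prod_pos fun a ha => by linarith [hJl x hx a ha]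
    simp only [eval_mul, eval_X, eval_C, eval_prod, eval_sub]
    rw [h1]
    have h3 : ((-1 : ℝ) ^ K.card) ^ 2 = 1 := by rw [← pow_mul, mul_comm, pow_mul]; simp
    have h4 := hJn x hx
    have h5 : 0 < p.leadingCoeff ^ 2 := by positivity
    have : 0 < (-x) * p.leadingCoeff ^ 2 * ∏ a ∈ K, (a - x) := by
      have : 0 < -x := by linarith
      positivity
    calc 0 < _ := this
      _ = _ := by linear_combination (x * p.leadingCoeff ^ 2 * ∏ a ∈ K, (a - x)) * h3
  refine ⟨∏ a ∈ J, (X - C a), C p.leadingCoeff * ∏ a ∈ K, (X - C a), -(p.leadingCoeff * (-1) ^ K.card), ?_, ?_, ?_, ?_, ?_, ?_, ?_⟩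
  · simpa using hlc
  · exact monic_prod_of_monic _ _ fun a _ => monic_X_sub_C a
  · rw [natDegree_prod_of_monic _ _ fun a _ => monic_X_sub_C a]; simp [hJc]
  · refine Eq.trans ?_ hpe
    rw [hpm, mul_left_comm, mul_comm (∏ a ∈ J, _), Finset.prod_sdiff hJ]
  · intro x hx
    exact ⟨hJn x (hroot x hx), hpos x (hroot x hx)⟩
  · intro z hz
    rw [cx, Polynomial.map_prod, eval_prod, Finset.prod_eq_zero_iff] at hz
    obtain ⟨a, ha, h⟩ := hz
    simp [sub_eq_zero] at h
    rw [h]; simpa using hJn a ha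
  · apply IsCoprime.pow_right
    apply IsCoprime.prod_right
    intro a ha
    apply IsCoprime.symm
    rw [(irreducible_X_sub_C a).coprime_iff_not_dvd, dvd_iff_isRoot]
    intro h
    have := hpos a ha
    rw [h.eq_zero, mul_zero] at this
    exact lt_irrefl _ this

lemma data2 (hg : g + 3 ≤ k) {q t : ℝ[X]} {σ : ℝ} (hq : q.Monic) (hqd : q.natDegree = g + 1) (htd : t.natDegree = k - g - 3)
    (hs : ∀ x, q.eval x = 0 → x < 0 ∧ 0 < σ * (X * t).eval x) (hc : IsCoprime (X * t) (q ^ 2)) {z : ℝ} (hz : 0 < z) :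
    ∃ h1 s1 : ℝ[X], h1.natDegree ≤ 2 * g + 2 ∧ s1.natDegree ≤ k - g - 1 ∧
      h1 * (X * t) + 2 * q ^ 2 * s1 = 2 * (C (σ * (-1) ^ (k + g + 1)) * (X - C z) ^ (k + g + 1)) ∧
      ∀ x, q.eval x = 0 → 0 < h1.eval x := by
  obtain ⟨u, v, huv⟩ := hc
  set m := C (σ * (-1) ^ (k + g + 1)) * (X - C z) ^ (k + g + 1) with hm
  have hq2 : (q ^ 2).Monic := hq.pow 2
  have hq2d : (q ^ 2).natDegree = 2 * g + 2 := by rw [hq.natDegree_pow, hqd]; ring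
  set w := (m * u) %ₘ (q ^ 2) with hw
  have hdiv := modByMonic_add_div (m * u) (q ^ 2)
  set d := (m * u) /ₘ (q ^ 2)
  have hwd : w.natDegree < 2 * g + 2 := by
    rw [← hq2d]; apply natDegree_modByMonic_lt _ hq2
    intro h; rw [h] at hq2d; simp at hq2d
  have id : w * (X * t) + q ^ 2 * (d * (X * t) + m * v) = m := by
    rw [← hw] at hdiv
    linear_combination (X * t) * hdiv + m * huv
  have hmd : m.natDegree ≤ k + g + 1 := by
    rw [hm]
    refine natDegree_mul_le.trans ?_
    rw [natDegree_C, natDegree_pow, natDegree_X_sub_C]; omega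
  refine ⟨2 * w, d * (X * t) + m * v, ?_, ?_, ?_, ?_⟩
  · refine natDegree_mul_le.trans ?_
    rw [natDegree_ofNat]; omega
  · by_cases h0 : d * (X * t) + m * v = 0
    · rw [h0]; simp
    have e : q ^ 2 * (d * (X * t) + m * v) = m - w * (X * t) := by linear_combination id
    have h1 : (m - w * (X * t)).natDegree ≤ k + g + 1 := by
      apply sub_deg hmd
      have a1 := natDegree_mul_le (p := w) (q := X * t)
      have a2 := natDegree_mul_le (p := (X : ℝ[X])) (q := t)
      rw [natDegree_X] at a2; omega
    rw [← e, natDegree_mul hq2.ne_zero h0, hq2d] at h1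
    omega
  · linear_combination 2 * id
  · intro x hx
    obtain ⟨x0, hσ⟩ := hs x hx
    have e := congrArg (eval x) id
    rw [eval_add, eval_mul, eval_mul (p := q ^ 2), eval_pow, hx, hm] at e
    simp only [eval_mul (p := C _) (q := _ ^ _), eval_C, eval_pow, eval_sub, eval_X] at e
    have hz : 0 < (z - x) ^ (k + g + 1) := pow_pos (by linarith) _
    have e2 : (x - z) ^ (k + g + 1) = (-1) ^ (k + g + 1) * (z - x) ^ (k + g + 1) := by rw [← mul_pow]; ring
    have h3 : ((-1 : ℝ) ^ (k + g + 1)) ^ 2 = 1 := by rw [← pow_mul, mul_comm, pow_mul]; simp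
    have e3 : w.eval x * (X * t).eval x = σ * (z - x) ^ (k + g + 1) := by
      rw [e2] at e; linear_combination e + σ * (z - x) ^ (k + g + 1) * h3
    rw [eval_mul, eval_ofNat]
    by_contra hcon
    have hw0 : w.eval x ≤ 0 := by linarith
    have hσ2 : 0 < σ ^ 2 := by
      have : σ ≠ 0 := by rintro rfl; simp at hσ
      positivity
    have e4 : w.eval x * (σ * (X * t).eval x) = σ ^ 2 * (z - x) ^ (k + g + 1) := by linear_combination σ * e3
    have := mul_pos hσ2 hz
    nlinarith [mul_nonneg (neg_nonneg.2 hw0) hσ.le]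

lemma ev_avoid {F : Set ℝ} (hF : F.Finite) : ∀ᶠ ν in 𝓝[>] (0 : ℝ), ν ∉ F := by
  have h1 : (F \ {0})ᶜ ∈ 𝓝 (0 : ℝ) := (hF.subset Set.sdiff_subset).isClosed.isOpen_compl.mem_nhds (by simp)
  have hf : ∀ᶠ ν in 𝓝[>] (0 : ℝ), 0 < ν := eventually_mem_nhdsWithin
  filter_upwards [mem_nhdsWithin_of_mem_nhds h1, hf] with ν h h0 hν
  exact h ⟨hν, h0.ne'⟩

lemma pos_avoid {F : Set ℝ} (hF : F.Finite) : ∃ x, 0 < x ∧ x ∉ F := by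
  obtain ⟨x, h1, h2⟩ := ((ev_avoid hF).and (eventually_mem_nhdsWithin (s := Set.Ioi (0 : ℝ)))).exists
  exact ⟨x, h2, h1⟩
end
end Polynomial.PN

namespace Polynomial.PN
open NC Filter Topology

lemma e_expand (h0 h1 s0 s1 h2 s2 : ℝ[X]) (ν : ℝ) :
    -((h0 + C ν * h1 + C (ν ^ 2) * h2) * (s0 + C ν * s1 + C (ν ^ 2) * s2) ^ 2) =
    -(h0 * s0 ^ 2) + C ν * (-(h1 * s0 ^ 2 + 2 * h0 * s0 * s1)) + C (ν ^ 2) * (-(h2 * s0 ^ 2 + 2 * h0 * s0 * s2 +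
      h0 * (s1 + C ν * s2) ^ 2 + 2 * (h1 + C ν * h2) * s0 * (s1 + C ν * s2) + C ν * ((h1 + C ν * h2) * (s1 + C ν * s2) ^ 2))) := by
  rw [C_pow]; ring

set_option maxHeartbeats 1000000 in
theorem main (k g : ℕ) (hk : 3 ≤ k) (hg : g + 3 ≤ k) :
    ∃ P : MvPolynomial (Fin 3) ℝ, P ≠ 0 ∧ P.IsHomogeneous (2 * k) ∧
      Squarefree (MvPolynomial.map (algebraMap ℝ ℂ) P) ∧
      (∀ x ∈ SingSet (MvPolynomial.map (algebraMap ℝ ℂ) P),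
        IsNodeAt (MvPolynomial.map (algebraMap ℝ ℂ) P) x) ∧
      ((SingSet (MvPolynomial.map (algebraMap ℝ ℂ) P)).ncard : ℤ) =
        (2 * (k : ℤ) - 1) * ((k : ℤ) - 1) - (g : ℤ) ∧
      (RZ P).Finite ∧ (RZ P).ncard = k ^ 2 + g + 1 := by
  -- choice of y
  obtain ⟨y, hy, hyF⟩ := pos_avoid (F := ⋃ l ∈ Finset.Ico 2 (k - 1),
      {y : ℝ | ∃ x, (sh (th k (l - 1)) (RR k y)).eval x = 0 ∧ (sh (th k (l + 1)) (RR k y)).eval x = 0}) (by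
    apply Set.Finite.biUnion (Finset.finite_toSet _)
    intro l hl
    have hl := Finset.mem_Ico.1 hl
    exact p_cop hk (by omega) (by omega) (by omega))
  have hcop : ∀ l ∈ Finset.Ico 2 (k - 1), ∀ x, (sh (th k (l - 1)) (RR k y)).eval x = 0 →
      (sh (th k (l + 1)) (RR k y)).eval x ≠ 0 := by
    intro l hl x h1 h2
    exact hyF (Set.mem_biUnion hl ⟨x, h1, h2⟩)
  obtain ⟨q, t, σ, hσ, hq, hqd, hqt, hqs, hqz, hqc⟩ := data1 hk hg hy
  have s1 := th_pos (l := 1) (k := k) (by omega) (by omega)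
  have hp1 := RR_RS (k := k) (by omega) hy s1
  have hp2 := RR_RS (k := k) (by omega) hy (th_pos (l := 2) (k := k) (by omega) (by omega))
  have d1 := p_deg (k := k) (y := y) (m := 1) (by omega) hy (by omega) (by omega)
  have R1 := RR_pos (k := k) (n := 1) (by omega) hy (by omega)
  have hp1' := hp1
  rw [← hqt] at hp1'
  have ht0 : t ≠ 0 := right_ne_zero_of_mul hp1'.ne
  have htd : t.natDegree = k - g - 3 := by
    rw [← hqt, natDegree_mul hq.ne_zero ht0] at d1; omega
  have hz0 : q.eval 0 * t.eval 0 ≠ 0 := by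
    rw [← eval_mul, hqt, p_zero]; positivity
  have hS0 : RS (X * t) := RS.X.mul hp1'.of_mul (by
    intro x hx; rw [eval_X] at hx; subst hx; exact right_ne_zero_of_mul hz0)
  have hS0d : (X * t).natDegree = k - g - 2 := by
    rw [natDegree_mul X_ne_zero ht0, natDegree_X, htd]; omega
  -- choice of z
  have hr0 : ∀ r : ℝ, (sh (th k 2) (RR k y)).eval r = 0 → r ≠ 0 := by
    rintro r h rfl
    rw [p_zero] at h
    have := th_pos (l := 2) (k := k) (by omega) (by omega)
    have : 0 < (RR k y).coeff 1 * Real.sin (th k 2) := by positivity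
    linarith
  obtain ⟨z, hz, hzF⟩ := pos_avoid (F := ⋃ r ∈ (sh (th k 2) (RR k y)).roots.toFinset,
      {z : ℝ | ((cx q).eval (ex (-th k 1) * r) * (ex (th k 1) * r - z) ^ (k + g + 1)).re = 0}) (by
    apply Set.Finite.biUnion (Finset.finite_toSet _)
    intro r hr
    have hr := hr0 r (isRoot_of_mem_roots (Multiset.mem_toFinset.1 hr))
    apply zfin _ _ (by omega)
    · intro h
      have := (hqz _ h).1
      rw [Complex.mul_im, ex_im, Real.sin_neg] at this
      simp [hr, s1.ne'] at this
    · rw [Complex.mul_im, ex_im]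
      simp [hr, s1.ne'])
  obtain ⟨h1, s1', h1d, s1d, hid, h1p⟩ := data2 hg hq hqd htd hqs hqc hz
  set m := C (σ * (-1) ^ (k + g + 1)) * (X - C z) ^ (k + g + 1) with hm
  have hσ' : σ * (-1) ^ (k + g + 1) ≠ 0 := mul_ne_zero hσ (pow_ne_zero _ (by norm_num))
  have hmd : m.natDegree = k + g + 1 := by
    rw [hm, natDegree_C_mul hσ', natDegree_pow, natDegree_X_sub_C, mul_one]
  have hmev : ∀ w : ℂ, (cx m).eval w = ((σ * (-1) ^ (k + g + 1) : ℝ) : ℂ) * (w - z) ^ (k + g + 1) := by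
    intro w; simp [hm, cx]
  have hmz : ∀ w : ℂ, (cx m).eval w = 0 → w.im = 0 ∧ 0 < w.re := by
    intro w hw
    rw [hmev] at hw
    have h2 := eq_zero_of_pow_eq_zero ((mul_eq_zero.1 hw).resolve_left (by exact_mod_cast hσ'))
    rw [sub_eq_zero.1 h2]; simpa using hz
  have hMc : ∀ x, (sh (th k 2) (RR k y)).eval x = 0 → (MM (th k 1) q m).eval x ≠ 0 := by
    intro x hx h
    apply hzF
    refine Set.mem_biUnion (show x ∈ _ from Finset.mem_coe.2 (Multiset.mem_toFinset.2 ((mem_roots hp2.ne).2 hx))) ?_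
    rw [MM_re, hmev, mul_left_comm, Complex.re_ofReal_mul] at h
    exact (mul_eq_zero.1 h).resolve_left hσ'
  obtain ⟨b2, s2, h2, cb2, cs2, ch2, s2d, h2d, hfin⟩ := family (k := k) (g := g) (b0 := cs (th k 1) (RR k y)) (s0 := X * t) (s1 := s1')
    (h0 := q ^ 2) (h1 := h1) hg (cs_deg (RR_deg (by omega))) (by omega) s1d
    (by rw [hq.natDegree_pow, hqd]; omega) h1d
  have hgood := ev_avoid hfin
  simp only [Set.mem_ofPred_eq, not_not] at hgood
  set h : ℝ → ℝ[X] := fun ν => q ^ 2 + C ν * h1 + C (ν ^ 2) * h2 ν with hh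
  set s : ℝ → ℝ[X] := fun ν => X * t + C ν * s1' + C (ν ^ 2) * s2 ν with hs
  set b : ℝ → ℝ[X] := fun ν => cs (th k 1) (RR k y) + C (ν ^ 2) * b2 ν with hb
  have cν : CP (fun ν => C ν) := CP.C continuous_id
  have cν2 : CP (fun ν => C (ν ^ 2)) := CP.C (continuous_id.pow 2)
  have ch : CP h := ((CP.const _).add (cν.mul (CP.const _))).add (cν2.mul ch2)
  have cs' : CP s := ((CP.const _).add (cν.mul (CP.const _))).add (cν2.mul cs2)
  have cb : CP b := (CP.const _).add (cν2.mul cb2)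
  set e2 : ℝ → ℝ[X] := fun ν => (-(h2 ν * (X * t) ^ 2 + 2 * q ^ 2 * (X * t) * s2 ν +
      q ^ 2 * (s1' + C ν * s2 ν) ^ 2 + 2 * (h1 + C ν * h2 ν) * (X * t) * (s1' + C ν * s2 ν) +
      C ν * ((h1 + C ν * h2 ν) * (s1' + C ν * s2 ν) ^ 2))) with he2
  have ce2 : CP e2 := by
    have cS : CP (fun ν => s1' + C ν * s2 ν) := (CP.const _).add (cν.mul cs2)
    have cH : CP (fun ν => h1 + C ν * h2 ν) := (CP.const _).add (cν.mul ch2)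
    exact (((((ch2.mul (CP.const _)).add ((CP.const _).mul cs2)).add ((CP.const _).mul (cS.pow 2))).add
      ((((CP.const _).mul cH).mul (CP.const _)).mul cS)).add (cν.mul (cH.mul (cS.pow 2)))).neg
  have hsn : q * (X * t) = sn (th k 1) (RR k y) := by rw [← X_mul_sh, ← hqt]; ring
  have hexp : ∀ ν, -(h ν * s ν ^ 2) = -(sn (th k 1) (RR k y)) ^ 2 + C ν * (-2 * (X * t) * m) + C (ν ^ 2) * e2 ν := by
    intro ν
    have e1 : -(h1 * (X * t) ^ 2 + 2 * q ^ 2 * (X * t) * s1') = -2 * (X * t) * m := by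
      linear_combination (-(X * t)) * hid
    have e0 : -(q ^ 2 * (X * t) ^ 2) = -(sn (th k 1) (RR k y)) ^ 2 := by rw [← hsn]; ring
    simp only [hh, hs, he2]
    rw [e_expand, e1, e0]
  -- positivity and roots
  have hpos : ∀ᶠ ν in 𝓝[>] (0 : ℝ), ∀ x, 0 < (h ν).eval x :=
    h_pos (d := g + 1) hq hqd (by omega) ch2 (fun ν => by have := h2d ν; omega) h1p
  have hroots : ∀ᶠ ν in 𝓝[>] (0 : ℝ), (s ν).roots.toFinset.card = k - g - 2 + 1 := by
    apply s_roots cs' (s0 := X * t) (by simp [hs]) hS0 hS0d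
    filter_upwards [hgood] with ν hν
    exact ⟨hν.2.1, by rw [show k - g - 2 + 1 = k - g - 1 by omega]; exact hν.2.2.1⟩
  have H : ∀ᶠ ν in 𝓝[>] (0 : ℝ), CU k (zt k) (cx (b ν)) (cx (-(h ν * s ν ^ 2))) ∧
      (-(h ν * s ν ^ 2)).coeff 0 ≤ 0 ∧ (-(h ν * s ν ^ 2)).coeff (2 * k) ≤ 0 := by
    filter_upwards [hgood, hpos] with ν hν hp
    refine ⟨hν.1, ?_, ?_⟩
    · rw [coeff_zero_eq_eval_zero, eval_neg, eval_mul, eval_pow]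
      have := mul_nonneg (hp 0).le (sq_nonneg ((s ν).eval 0))
      linarith
    · have a1 : (h ν).natDegree = 2 * g + 2 := hν.2.2.2.2
      have a2 : (s ν).natDegree = k - g - 1 := hν.2.2.1
      rw [coeff_neg, show 2 * k = 2 * g + 2 + 2 * (k - g - 1) by omega,
        coeff_mul_add_eq_of_natDegree_le a1.le (natDegree_pow_le_of_le 2 a2.le), coeff_pow_of_natDegree_le a2.le]
      have a3 := lc_pos hp
      rw [leadingCoeff, a1] at a3
      have := mul_nonneg a3.le (sq_nonneg ((s ν).coeff (k - g - 1)))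
      linarith
  have cmid : ∀ᶠ ν in 𝓝[>] (0 : ℝ), ∀ l ∈ Finset.Ico 2 (k - 1),
      (Fl (th k l) (b ν) (-(h ν * s ν ^ 2))).roots.toFinset.card = 2 * k := by
    rw [Filter.eventually_all_finset]
    intro l hl
    have hl' := Finset.mem_Ico.1 hl
    refine mid (l := l) hk hy (by omega) (by omega) (hcop l hl) cb ((ch.mul (cs'.pow 2)).neg) (by simp [hb]) ?_ H
    have := hexp 0
    simpa using this
  have cone : ∀ᶠ ν in 𝓝[>] (0 : ℝ), (Fl (th k 1) (b ν) (-(h ν * s ν ^ 2))).roots.toFinset.card = 2 * k + 2 * g + 2 := by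
    have := one hk hg hy hqt hqz hqd hmz hmd hMc cb2 ce2 (by
      filter_upwards [H] with ν hν
      rw [hexp] at hν
      exact ⟨hν.1, hν.2.2⟩)
    filter_upwards [this] with ν hν
    rw [hexp]; exact hν
  obtain ⟨ν, ⟨g1, g2, g3, g4, g5⟩, n1, n2, n3, n4⟩ := (hgood.and (hpos.and (hroots.and (cmid.and cone)))).exists
  refine final hk hg g1 g2 g3 (n2.trans (by omega)) g4 g5 n1 ?_
  have hlast : (Fl (th k (k - 1)) (b ν) (-(h ν * s ν ^ 2))).roots.toFinset.card = 2 * k + 2 * g + 2 := by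
    rw [← n4, ← Fl_refl_card]
    congr 4
    have hk' : (k : ℝ) ≠ 0 := by exact_mod_cast (by omega : k ≠ 0)
    rw [th, th, Nat.cast_sub (by omega)]
    field_simp
    push_cast; ring
  have hsum : ∑ l ∈ Finset.Ico 1 k, (Fl (th k l) (b ν) (-(h ν * s ν ^ 2))).roots.toFinset.card =
      (2 * k + 2 * g + 2) + (k - 3) * (2 * k) + (2 * k + 2 * g + 2) := by
    obtain ⟨j, rfl⟩ : ∃ j, k = j + 1 := ⟨k - 1, by omega⟩
    rw [Finset.sum_Ico_succ_top (by omega), Finset.sum_eq_sum_Ico_succ_bot (by omega), n4,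
      Finset.sum_congr rfl (fun l hl => n3 l (by simpa using hl)), Finset.sum_const, Nat.card_Ico]
    rw [show j + 1 - 1 = j by omega] at hlast
    rw [hlast, smul_eq_mul, show j - (1 + 1) = j + 1 - 3 by omega]
  refine Eq.trans (congrArg (· + 2 * k) hsum) ?_
  obtain ⟨j, rfl⟩ : ∃ j, k = j + 3 := ⟨k - 3, by omega⟩
  rw [show j + 3 - 3 = j by omega]; ring
end Polynomial.PN

theorem stmt_6 (k g : ℕ) (hk : 3 ≤ k) (hg : g + 3 ≤ k) :
    ∃ P : MvPolynomial (Fin 3) ℝ, P ≠ 0 ∧ P.IsHomogeneous (2 * k) ∧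
      Squarefree (MvPolynomial.map (algebraMap ℝ ℂ) P) ∧
      (∀ x ∈ SingSet (MvPolynomial.map (algebraMap ℝ ℂ) P),
        IsNodeAt (MvPolynomial.map (algebraMap ℝ ℂ) P) x) ∧
      ((SingSet (MvPolynomial.map (algebraMap ℝ ℂ) P)).ncard : ℤ) =
        (2 * (k : ℤ) - 1) * ((k : ℤ) - 1) - (g : ℤ) ∧
      (RZ P).Finite ∧ (RZ P).ncard = k ^ 2 + g + 1 := Polynomial.PN.main k g hk hg
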